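/- Level-set estimate for the logarithm of a supersolution: Let 0 < r ≤ 1 with r < R/2. Let u be a weak supersolution of −div(A(x,∇u)) + Lu = f in Ω with u ≥ 0 in B_R(x₀) ⊂ Ω, where f ∈ L^{q/p}(B_R(x₀)) and q > n. Set v = u + d, where d > r^{p'} R^{−p'} Tail(u₋; x₀, R) + r^{(p−n)/(p−1)} R^{n(q−p)/(q(p−1))} ‖f‖_{L^{q/p}(B_R(x₀))}^{1/(p−1)}, with u₋ = max{−u, 0}. Let ψ ∈ C_c^∞(B_{3r/2}(x₀)) satisfy 0 ≤ ψ ≤ 1, ψ ≡ 1 in B_r(x₀), and |∇ψ| ≤ c₀/r in B_{3r/2}(x₀) for some constant c₀ = c₀(n,p) > 0, and set b = −(∫_{B_{3r/2}(x₀)} ψ^p log v dx)/(∫_{B_{3r/2}(x₀)} ψ^p dx). Then there exists a constant C = C(n,p,q,s,C₁,C₂,Λ) > 0 (depending also on c₀) such that for every a > 0, |{x ∈ B_r(x₀) : log v(x) + b > a}| ≤ C |B_{r/2}(x₀)| a^{−p} and |{x ∈ B_r(x₀) : −log v(x) − b > a}| ≤ C |B_{r/2}(x₀)| a^{−p}, where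 |·| denotes Lebesgue measure. -/

import Mathlib

open MeasureTheory Real Set Metric
open scoped RealInnerProductSpace ENNReal Topology NNReal

noncomputable section

abbrev En (n : ℕ) := EuclideanSpace ℝ (Fin n)

/-- Smooth test function compactly supported in `s`. -/
def TestFun {n : ℕ} (s : Set (En n)) (φ : En n → ℝ) : Prop :=
  ContDiff ℝ (⊤ : ℕ∞) φ ∧ HasCompactSupport φ ∧ tsupport φ ⊆ s

/-- `J_p(t) = |t|^{p-2} t`. -/
def Jp (p t : ℝ) : ℝ := |t| ^ (p - 2) * t

/-- `G` is a weak gradient of `u` on the open set `Ω`. -/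
def HasWeakGradOn {n : ℕ} (u : En n → ℝ) (G : En n → En n) (Ω : Set (En n)) : Prop :=
  ∀ φ : En n → ℝ, TestFun Ω φ → ∫ x, u x • gradient φ x = - ∫ x, φ x • G x

/-- `u ∈ W^{1,p}_loc(Ω)` with weak gradient `G`. -/
def MemW1pLoc {n : ℕ} (p : ℝ) (u : En n → ℝ) (G : En n → En n) (Ω : Set (En n)) : Prop :=
  HasWeakGradOn u G Ω ∧
    ∀ k : Set (En n), IsCompact k → k ⊆ Ω →
      IntegrableOn (fun x => |u x| ^ p) k ∧ IntegrableOn (fun x => ‖G x‖ ^ p) k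

/-- `u` belongs to the tail space `L^{p-1}_{ps}(ℝⁿ)`. -/
def MemTailSpace {n : ℕ} (p s : ℝ) (u : En n → ℝ) : Prop :=
  Integrable (fun y : En n => |u y| ^ (p - 1) * (1 + ‖y‖) ^ (-((n : ℝ) + p * s)))

/-- The structural setting for the mixed local-nonlocal operator
`-div(A(x,∇u)) + L u` on a bounded open set `Ω ⊆ ℝⁿ`. -/
structure Setting (n : ℕ) (p s C₁ C₂ Λ : ℝ) where
  Ω : Set (En n)
  A : En n → En n → En n
  K : En n → En n → ℝ
  hΩopen : IsOpen Ω
  hΩbdd : Bornology.IsBounded Ω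
  hC₁ : 0 < C₁
  hC₂ : 0 < C₂
  hΛ : 1 ≤ Λ
  hAmeas : ∀ ξ, Measurable fun x => A x ξ
  hAcont : ∀ x, Continuous (A x)
  hAgrowth : ∀ᵐ x ∂(volume : Measure (En n)), x ∈ Ω → ∀ ξ, ‖A x ξ‖ ≤ C₂ * ‖ξ‖ ^ (p - 1)
  hAcoerc : ∀ᵐ x ∂(volume : Measure (En n)), x ∈ Ω → ∀ ξ, C₁ * ‖ξ‖ ^ p ≤ ⟪A x ξ, ξ⟫
  hKmeas : Measurable (Function.uncurry K)
  hKnonneg : ∀ x y, 0 ≤ K x y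
  hKsymm : ∀ x y, K x y = K y x
  hKlower : ∀ᵐ z ∂(volume : Measure (En n × En n)),
    Λ⁻¹ * ‖z.1 - z.2‖ ^ (-((n : ℝ) + p * s)) ≤ K z.1 z.2
  hKupper : ∀ᵐ z ∂(volume : Measure (En n × En n)),
    K z.1 z.2 ≤ Λ * ‖z.1 - z.2‖ ^ (-((n : ℝ) + p * s))

variable {n : ℕ} {p s C₁ C₂ Λ : ℝ}

/-- The mixed local-nonlocal energy form tested against `φ`. -/
def Eform (S : Setting n p s C₁ C₂ Λ) (u : En n → ℝ) (G : En n → En n) (φ : En n → ℝ) : ℝ :=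
  (∫ x, ⟪S.A x (G x), gradient φ x⟫) +
    ∫ x, ∫ y, Jp p (u x - u y) * (φ x - φ y) * S.K x y

/-- Weak supersolution of `-div(A(x,∇u)) + L u = f` in `Ω`. -/
def IsSupersol (S : Setting n p s C₁ C₂ Λ) (f u : En n → ℝ) (G : En n → En n) : Prop :=
  MemW1pLoc p u G S.Ω ∧ MemTailSpace p s u ∧
    ∀ φ : En n → ℝ, TestFun S.Ω φ → (∀ x, 0 ≤ φ x) → (∫ x, f x * φ x) ≤ Eform S u G φ

/-- Weak subsolution of `-div(A(x,∇u)) + L u = f` in `Ω`. -/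
def IsSubsol (S : Setting n p s C₁ C₂ Λ) (f u : En n → ℝ) (G : En n → En n) : Prop :=
  MemW1pLoc p u G S.Ω ∧ MemTailSpace p s u ∧
    ∀ φ : En n → ℝ, TestFun S.Ω φ → (∀ x, 0 ≤ φ x) → Eform S u G φ ≤ ∫ x, f x * φ x

/-- Weak solution of `-div(A(x,∇u)) + L u = f` in `Ω`. -/
def IsSol (S : Setting n p s C₁ C₂ Λ) (f u : En n → ℝ) (G : En n → En n) : Prop :=
  MemW1pLoc p u G S.Ω ∧ MemTailSpace p s u ∧
    ∀ φ : En n → ℝ, TestFun S.Ω φ → Eform S u G φ = ∫ x, f x * φ x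

/-- The nonlocal tail `Tail(v; x₀, ρ)`. -/
def Tail (n : ℕ) (p s : ℝ) (v : En n → ℝ) (x₀ : En n) (ρ : ℝ) : ℝ :=
  (ρ ^ p * ∫ y in (ball x₀ ρ)ᶜ, |v y| ^ (p - 1) * ‖y - x₀‖ ^ (-((n : ℝ) + p * s))) ^ (1 / (p - 1))

/-- `L^m`-norm of `f` on a set `B`. -/
def normLp {n : ℕ} (m : ℝ) (f : En n → ℝ) (B : Set (En n)) : ℝ :=
  (∫ x in B, |f x| ^ m) ^ (1 / m)

/-- Negative part `u₋ = max (−u) 0`. -/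
def nneg {n : ℕ} (u : En n → ℝ) : En n → ℝ := fun x => max (-u x) 0

/-- Positive part `u₊ = max u 0`. -/
def npos {n : ℕ} (u : En n → ℝ) : En n → ℝ := fun x => max (u x) 0

/-- The threshold quantity
`r^{p'} R^{−p'} Tail(u₋; x₀, R) + r^{(p−n)/(p−1)} R^{n(q−p)/(q(p−1))} ‖f‖_{L^{q/p}(B_R(x₀))}^{1/(p−1)}`. -/
def dBound (n : ℕ) (p s q : ℝ) (u f : En n → ℝ) (x₀ : En n) (r R : ℝ) : ℝ :=
  r ^ (p / (p - 1)) * R ^ (-(p / (p - 1))) * Tail n p s (nneg u) x₀ R +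
    r ^ ((p - n) / (p - 1)) * R ^ (n * (q - p) / (q * (p - 1))) *
      (normLp (q / p) f (ball x₀ R)) ^ (1 / (p - 1))

section Mollification

open Filter

/-- Translations are continuous in `L^P`. -/
theorem tendsto_eLpNorm_translate_sub {n : ℕ} {F : Type*} [NormedAddCommGroup F]
    {P : ℝ≥0∞} (hP : 1 ≤ P) (hP' : P ≠ ∞) {U : En n → F} (hU : MemLp U P volume) :
    Tendsto (fun h : En n => eLpNorm (fun x => U (x - h) - U x) P volume) (𝓝 0) (𝓝 0) := by
  have : Fact (1 ≤ P) := ⟨hP⟩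
  let g : C(En n × En n, En n) := ⟨fun a => a.2 - a.1, by fun_prop⟩
  have hg : Continuous g.curry := g.curry.continuous
  have hmp : ∀ h : En n, MeasurePreserving (g.curry h) volume volume := fun h =>
    measurePreserving_sub_right volume h
  have h1 := (tendsto_const_nhds (x := hU.toLp U) (f := 𝓝 (0 : En n))).compMeasurePreservingLp
    (hg.tendsto 0) hmp (hmp 0) hP'
  have h2 := h1.sub_const (Lp.compMeasurePreserving (g.curry 0) (hmp 0) (hU.toLp U))
  rw [sub_self] at h2
  have h3 := (continuous_enorm.tendsto _).comp h2
  rw [enorm_zero] at h3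
  refine h3.congr fun h => ?_
  simp only [Function.comp_apply]
  rw [Lp.toLp_compMeasurePreserving hU (hmp h), Lp.toLp_compMeasurePreserving hU (hmp 0),
    ← MemLp.toLp_sub, Lp.enorm_toLp]
  refine eLpNorm_congr_ae (Eventually.of_forall fun x => ?_)
  simp [g]

theorem lintegral_enorm_rpow_le_of_isProbabilityMeasure {α F : Type*} [MeasurableSpace α]
    [NormedAddCommGroup F] {ν : Measure α} [IsProbabilityMeasure ν] {p : ℝ} (hp : 1 ≤ p)
    {g : α → F} (hg : AEStronglyMeasurable g ν) :
    (∫⁻ t, ‖g t‖ₑ ∂ν) ^ p ≤ ∫⁻ t, ‖g t‖ₑ ^ p ∂ν := by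
  have hp0 : 0 < p := by linarith
  have h := eLpNorm_le_eLpNorm_of_exponent_le (p := 1) (q := ENNReal.ofReal p)
    (by simpa using ENNReal.ofReal_le_ofReal hp) hg
  rw [eLpNorm_one_eq_lintegral_enorm, eLpNorm_eq_lintegral_rpow_enorm_toReal
    (by simpa using hp0) ENNReal.ofReal_ne_top, ENNReal.toReal_ofReal hp0.le] at h
  have h2 := ENNReal.rpow_le_rpow h hp0.le
  rwa [← ENNReal.rpow_mul, one_div, inv_mul_cancel₀ hp0.ne', ENNReal.rpow_one] at h2

theorem integrable_smul_translate {n : ℕ} {F : Type*} [NormedAddCommGroup F] [NormedSpace ℝ F]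
    {U : En n → F} (hU : LocallyIntegrable U volume) {ρ : En n → ℝ} (hρ : Continuous ρ)
    (hρc : HasCompactSupport ρ) (x : En n) :
    Integrable (fun t => ρ t • U (x - t)) volume :=
  (hρc.convolutionExists_left (ContinuousLinearMap.lsmul ℝ ℝ) hρ hU x)

theorem lintegral_convolution_sub_rpow_le {n : ℕ} {F : Type*} [NormedAddCommGroup F]
    [NormedSpace ℝ F] [CompleteSpace F] {p : ℝ} (hp : 1 ≤ p) {U : En n → F}
    (hU : MemLp U (ENNReal.ofReal p) volume) {ρ : En n → ℝ} (hρ : Continuous ρ)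
    (hρc : HasCompactSupport ρ) (hρ0 : ∀ x, 0 ≤ ρ x) (hρ1 : ∫ x, ρ x = 1) :
    ∫⁻ x, ‖(∫ t, ρ t • U (x - t)) - U x‖ₑ ^ p ≤
      ∫⁻ t, ENNReal.ofReal (ρ t) * ∫⁻ x, ‖U (x - t) - U x‖ₑ ^ p := by
  have hp0 : 0 < p := by linarith
  have hUl : LocallyIntegrable U volume := hU.locallyIntegrable
    (by simpa using ENNReal.ofReal_le_ofReal hp)
  have hρm : Measurable fun t => ENNReal.ofReal (ρ t) := hρ.measurable.ennreal_ofReal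
  have hρi : Integrable ρ volume := hρ.integrable_of_hasCompactSupport hρc
  have hUm := hU.1
  have hjoint : AEStronglyMeasurable (fun z : En n × En n => U (z.1 - z.2) - U z.1)
      (volume.prod volume) := by
    refine AEStronglyMeasurable.sub ?_ hUm.comp_fst
    exact hUm.comp_quasiMeasurePreserving (quasiMeasurePreserving_sub volume volume)
  set ν : Measure (En n) := volume.withDensity fun t => ENNReal.ofReal (ρ t) with hν
  have : IsProbabilityMeasure ν := ⟨by
    rw [hν, withDensity_apply _ MeasurableSet.univ, Measure.restrict_univ,
      ← ofReal_integral_eq_lintegral_ofReal hρi (Eventually.of_forall hρ0), hρ1, ENNReal.ofReal_one]⟩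
  have key : ∀ x, ‖(∫ t, ρ t • U (x - t)) - U x‖ₑ ^ p ≤
      ∫⁻ t, ENNReal.ofReal (ρ t) * ‖U (x - t) - U x‖ₑ ^ p := by
    intro x
    have hm : AEStronglyMeasurable (fun t => U (x - t) - U x) volume := by
      refine AEStronglyMeasurable.sub ?_ aestronglyMeasurable_const
      exact hUm.comp_quasiMeasurePreserving
        (Measure.measurePreserving_sub_left volume x).quasiMeasurePreserving
    have hmν : AEStronglyMeasurable (fun t => U (x - t) - U x) ν :=
      hm.mono_ac (withDensity_absolutelyContinuous _ _)
    have e1 : (∫ t, ρ t • U (x - t)) - U x = ∫ t, ρ t • (U (x - t) - U x) := by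
      have : U x = ∫ t, ρ t • U x := by rw [integral_smul_const, hρ1, one_smul]
      conv_lhs => rw [this]
      rw [← integral_sub (integrable_smul_translate hUl hρ hρc x) (hρi.smul_const _)]
      simp only [smul_sub]
    have e2 : ‖(∫ t, ρ t • U (x - t)) - U x‖ₑ ≤ ∫⁻ t, ‖U (x - t) - U x‖ₑ ∂ν := by
      rw [e1, hν, lintegral_withDensity_eq_lintegral_mul₀ hρm.aemeasurable hm.enorm]
      refine (enorm_integral_le_lintegral_enorm _).trans (le_of_eq ?_)
      refine lintegral_congr fun t => ?_
      simp only [Pi.mul_apply, enorm_smul]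
      rw [Real.enorm_eq_ofReal (hρ0 t)]
    calc _ ≤ (∫⁻ t, ‖U (x - t) - U x‖ₑ ∂ν) ^ p := ENNReal.rpow_le_rpow e2 hp0.le
      _ ≤ ∫⁻ t, ‖U (x - t) - U x‖ₑ ^ p ∂ν :=
        lintegral_enorm_rpow_le_of_isProbabilityMeasure hp hmν
      _ = _ := by
        rw [hν, lintegral_withDensity_eq_lintegral_mul₀ hρm.aemeasurable (hm.enorm.pow_const p)]
        rfl
  calc _ ≤ ∫⁻ x, ∫⁻ t, ENNReal.ofReal (ρ t) * ‖U (x - t) - U x‖ₑ ^ p := lintegral_mono key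
    _ = ∫⁻ t, ∫⁻ x, ENNReal.ofReal (ρ t) * ‖U (x - t) - U x‖ₑ ^ p := by
      refine lintegral_lintegral_swap ?_
      exact (hρm.comp measurable_snd).aemeasurable.mul (hjoint.enorm.pow_const p)
    _ = _ := by
      refine lintegral_congr fun t => ?_
      rw [lintegral_const_mul' _ _ ENNReal.ofReal_ne_top]

theorem eLpNorm_convolution_sub_le {n : ℕ} {F : Type*} [NormedAddCommGroup F]
    [NormedSpace ℝ F] [CompleteSpace F] {p : ℝ} (hp : 1 ≤ p) {U : En n → F}
    (hU : MemLp U (ENNReal.ofReal p) volume) {ρ : En n → ℝ} (hρ : Continuous ρ)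
    (hρc : HasCompactSupport ρ) (hρ0 : ∀ x, 0 ≤ ρ x) (hρ1 : ∫ x, ρ x = 1) {ε : ℝ≥0∞}
    (hε : ∀ t, ρ t ≠ 0 → eLpNorm (fun x => U (x - t) - U x) (ENNReal.ofReal p) volume ≤ ε) :
    eLpNorm (fun x => (∫ t, ρ t • U (x - t)) - U x) (ENNReal.ofReal p) volume ≤ ε := by
  have hp0 : 0 < p := by linarith
  have hρi : Integrable ρ volume := hρ.integrable_of_hasCompactSupport hρc
  have hne : ENNReal.ofReal p ≠ 0 := by simpa using hp0
  have eq : ∀ f : En n → F, eLpNorm f (ENNReal.ofReal p) volume = (∫⁻ x, ‖f x‖ₑ ^ p) ^ (1 / p) := by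
    intro f
    rw [eLpNorm_eq_lintegral_rpow_enorm_toReal hne ENNReal.ofReal_ne_top,
      ENNReal.toReal_ofReal hp0.le]
  have bd : ∀ f : En n → F, eLpNorm f (ENNReal.ofReal p) volume ≤ ε ↔
      ∫⁻ x, ‖f x‖ₑ ^ p ≤ ε ^ p := by
    intro f
    rw [eq, one_div, ENNReal.rpow_inv_le_iff hp0]
  rw [bd]
  refine (lintegral_convolution_sub_rpow_le hp hU hρ hρc hρ0 hρ1).trans ?_
  calc _ ≤ ∫⁻ t, ENNReal.ofReal (ρ t) * ε ^ p := by
        refine lintegral_mono fun t => ?_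
        by_cases ht : ρ t = 0
        · simp [ht]
        · exact mul_le_mul_right ((bd _).1 (hε t ht)) _
    _ = ε ^ p := by
        rw [lintegral_mul_const _ hρ.measurable.ennreal_ofReal,
          ← ofReal_integral_eq_lintegral_ofReal hρi (Eventually.of_forall hρ0), hρ1,
          ENNReal.ofReal_one, one_mul]

theorem gradient_eq_of_hasFDerivAt {n : ℕ} {f : En n → ℝ} {x g : En n} {L : En n →L[ℝ] ℝ}
    (h : HasFDerivAt f L x) (hL : ∀ v, L v = ⟪g, v⟫) : gradient f x = g := by
  refine HasGradientAt.gradient ?_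
  rw [hasGradientAt_iff_hasFDerivAt]
  have hg : InnerProductSpace.toDual ℝ (En n) g = L := by
    ext1 v
    rw [hL, InnerProductSpace.toDual_apply_apply]
  rwa [hg]

theorem norm_gradient_eq {n : ℕ} (f : En n → ℝ) (x : En n) :
    ‖gradient f x‖ = ‖fderiv ℝ f x‖ := by
  simp [gradient]

theorem continuous_gradient {n : ℕ} {f : En n → ℝ} (hf : ContDiff ℝ (⊤ : ℕ∞) f) :
    Continuous (gradient f) := by
  have : Continuous (fderiv ℝ f) := hf.continuous_fderiv (by simp)
  exact (LinearIsometryEquiv.continuous _).comp this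

/-- The gradient of a mollification is the mollification of the weak gradient. -/
theorem gradient_convolution {n : ℕ} {U : En n → ℝ} {H : En n → En n}
    (hU : LocallyIntegrable U volume) (hH : LocallyIntegrable H volume)
    (hw : HasWeakGradOn U H univ) {ρ : En n → ℝ} (hρ : ContDiff ℝ (⊤ : ℕ∞) ρ)
    (hρc : HasCompactSupport ρ) (x : En n) :
    gradient (fun x => ∫ t, ρ t • U (x - t)) x = ∫ t, ρ t • H (x - t) := by
  have h1 := hρc.hasFDerivAt_convolution_left (ContinuousLinearMap.lsmul ℝ ℝ) (μ := volume)
    (hρ.of_le (by simp)) hU x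
  refine gradient_eq_of_hasFDerivAt h1 fun v => ?_
  have hex : Integrable (fun t => ((ContinuousLinearMap.lsmul ℝ ℝ : ℝ →L[ℝ] ℝ →L[ℝ] ℝ).precompL (En n)
      (fderiv ℝ ρ t)) (U (x - t))) volume :=
    (hρc.fderiv ℝ).convolutionExists_left _ (hρ.continuous_fderiv (by simp)) hU x
  rw [convolution, ContinuousLinearMap.integral_apply hex]
  have e1 : ∀ t, (((ContinuousLinearMap.lsmul ℝ ℝ : ℝ →L[ℝ] ℝ →L[ℝ] ℝ).precompL (En n)
      (fderiv ℝ ρ t)) (U (x - t))) v = (fderiv ℝ ρ t v) * U (x - t) := fun t => rfl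
  simp only [e1]
  set φ : En n → ℝ := fun y => ρ (x - y) with hφ
  have hφt : TestFun (univ : Set (En n)) φ := by
    refine ⟨hρ.comp (by fun_prop), ?_, subset_univ _⟩
    exact hρc.comp_homeomorph (Homeomorph.subLeft x)
  have hgφ : ∀ y, gradient φ y = -gradient ρ (x - y) := by
    intro y
    have hd : HasFDerivAt ρ (fderiv ℝ ρ (x - y)) (x - y) :=
      (hρ.differentiable (by simp)).differentiableAt.hasFDerivAt
    have hd2 : HasFDerivAt (fun y : En n => x - y) (-(ContinuousLinearMap.id ℝ (En n))) y :=
      (hasFDerivAt_id y).const_sub x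
    refine gradient_eq_of_hasFDerivAt (hd.comp y hd2) fun v => ?_
    simp
  have hwφ := hw φ hφt
  have e2 : ∫ t, ρ t • H (x - t) = ∫ y, φ y • H y := by
    rw [← integral_sub_left_eq_self _ volume x]
    simp [hφ]
  have hint1 : Integrable (fun y => U y • gradient φ y) volume := by
    have hc : Continuous (gradient φ) := continuous_gradient hφt.1
    have hcs : HasCompactSupport (gradient φ) := by
      have := hφt.2.1.fderiv ℝ
      exact this.comp_left (g := (InnerProductSpace.toDual ℝ (En n)).symm) (by simp)
    have := hU.integrable_smul_right_of_hasCompactSupport hc hcs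
    simpa using this
  have hint2 : Integrable (fun y => φ y • H y) volume := by
    exact hH.integrable_smul_left_of_hasCompactSupport hφt.1.continuous hφt.2.1
  have e3 := congrArg (fun w => ⟪w, v⟫) hwφ
  simp only [inner_neg_left] at e3
  rw [e2]
  have e4 : ⟪∫ y, U y • gradient φ y, v⟫ = - ∫ t, (fderiv ℝ ρ t v) * U (x - t) := by
    rw [real_inner_comm, ← integral_inner hint1, ← integral_sub_left_eq_self _ volume x,
      ← integral_neg]
    refine integral_congr_ae (Eventually.of_forall fun t => ?_)
    simp only [hgφ, inner_smul_right, sub_sub_cancel, inner_neg_right]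
    rw [inner_gradient_right]
    simp
    ring
  linarith [e3, e4]

/-- Smooth approximation of a nonnegative Sobolev function on the whole space. -/
theorem exists_smooth_approx {n : ℕ} {p : ℝ} (hp : 1 ≤ p) {U : En n → ℝ} {H : En n → En n}
    (hU : MemLp U (ENNReal.ofReal p) volume) (hH : MemLp H (ENNReal.ofReal p) volume)
    (hw : HasWeakGradOn U H univ) (h0 : ∀ x, 0 ≤ U x) :
    ∃ V : ℕ → En n → ℝ, (∀ k, ContDiff ℝ (⊤ : ℕ∞) (V k)) ∧ (∀ k x, 0 ≤ V k x) ∧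
      Tendsto (fun k => eLpNorm (fun x => V k x - U x) (ENNReal.ofReal p) volume) atTop (𝓝 0) ∧
      Tendsto (fun k => eLpNorm (fun x => gradient (V k) x - H x) (ENNReal.ofReal p) volume)
        atTop (𝓝 0) ∧
      (∀ᵐ x, Tendsto (fun k => V k x) atTop (𝓝 (U x))) ∧
      ∀ᵐ x, Tendsto (fun k => gradient (V k) x) atTop (𝓝 (H x)) := by
  have hP : 1 ≤ ENNReal.ofReal p := by simpa using ENNReal.ofReal_le_ofReal hp
  have hUl := hU.locallyIntegrable hP
  have hHl := hH.locallyIntegrable hP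
  let b : ℕ → ContDiffBump (0 : En n) := fun k =>
    ⟨1 / (2 * ((k : ℝ) + 1)), 1 / ((k : ℝ) + 1), by positivity, by
      apply one_div_lt_one_div_of_lt <;> nlinarith [(Nat.cast_nonneg k : (0 : ℝ) ≤ k)]⟩
  let ρ : ℕ → En n → ℝ := fun k => (b k).normed volume
  have hρs : ∀ k, ContDiff ℝ (⊤ : ℕ∞) (ρ k) := fun k => (b k).contDiff_normed
  have hρc : ∀ k, HasCompactSupport (ρ k) := fun k => (b k).hasCompactSupport_normed
  have hρ0 : ∀ k x, 0 ≤ ρ k x := fun k x => (b k).nonneg_normed x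
  have hρ1 : ∀ k, ∫ x, ρ k x = 1 := fun k => (b k).integral_normed
  have hsupp : ∀ k t, ρ k t ≠ 0 → dist t 0 < 1 / ((k : ℝ) + 1) := by
    intro k t ht
    have : t ∈ Function.support (ρ k) := ht
    rw [(b k).support_normed_eq] at this
    exact this
  have conv : ∀ {F : Type} [NormedAddCommGroup F] [NormedSpace ℝ F] [CompleteSpace F]
      {W : En n → F}, MemLp W (ENNReal.ofReal p) volume →
      Tendsto (fun k => eLpNorm (fun x => (∫ t, ρ k t • W (x - t)) - W x) (ENNReal.ofReal p) volume)
        atTop (𝓝 0) := by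
    intro F _ _ _ W hW
    have ht := tendsto_eLpNorm_translate_sub hP ENNReal.ofReal_ne_top hW
    rw [ENNReal.tendsto_nhds_zero] at ht ⊢
    intro ε hε
    obtain ⟨δ, hδ, hδε⟩ := Metric.eventually_nhds_iff.1 (ht ε hε)
    have hlim : ∀ᶠ k : ℕ in atTop, 1 / ((k : ℝ) + 1) < δ :=
      (tendsto_one_div_add_atTop_nhds_zero_nat (𝕜 := ℝ)).eventually_lt_const hδ
    filter_upwards [hlim] with k hk
    refine eLpNorm_convolution_sub_le hp hW (hρs k).continuous (hρc k) (hρ0 k) (hρ1 k)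
      fun t ht0 => hδε ((hsupp k t ht0).trans hk)
  let V : ℕ → En n → ℝ := fun k x => ∫ t, ρ k t • U (x - t)
  have hVs : ∀ k, ContDiff ℝ (⊤ : ℕ∞) (V k) := fun k =>
    (hρc k).contDiff_convolution_left (ContinuousLinearMap.lsmul ℝ ℝ) (hρs k) hUl
  have hVg : ∀ k x, gradient (V k) x = ∫ t, ρ k t • H (x - t) := fun k x =>
    gradient_convolution hUl hHl hw (hρs k) (hρc k) x
  have hV0 : ∀ k x, 0 ≤ V k x := fun k x =>
    integral_nonneg fun t => mul_nonneg (hρ0 k t) (h0 _)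
  have c1 := conv hU
  have c2 := conv hH
  have c2' : Tendsto (fun k => eLpNorm (fun x => gradient (V k) x - H x) (ENNReal.ofReal p) volume)
        atTop (𝓝 0) := by simpa only [hVg] using c2
  have hPne : ENNReal.ofReal p ≠ 0 := by
    intro h; rw [h] at hP; simp at hP
  obtain ⟨ns, hns, hae⟩ := (tendstoInMeasure_of_tendsto_eLpNorm hPne
    (fun k => (hVs k).continuous.aestronglyMeasurable) hU.1 c1).exists_seq_tendsto_ae
  have c3 : Tendsto (fun k => eLpNorm (fun x => gradient (V (ns k)) x - H x)
    (ENNReal.ofReal p) volume) atTop (𝓝 0) := c2'.comp hns.tendsto_atTop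
  obtain ⟨ms, hms, hae2⟩ := (tendstoInMeasure_of_tendsto_eLpNorm (f := fun k => gradient (V (ns k)))
    hPne (fun k => (continuous_gradient (hVs _)).aestronglyMeasurable) hH.1 c3).exists_seq_tendsto_ae
  refine ⟨fun k => V (ns (ms k)), fun k => hVs _, fun k => hV0 _,
    c1.comp (hns.tendsto_atTop.comp hms.tendsto_atTop), c3.comp hms.tendsto_atTop, ?_, hae2⟩
  filter_upwards [hae] with x hx
  exact hx.comp hms.tendsto_atTop

end Mollification

section Gagliardo

open Filter

theorem enorm_sub_rpow_le_lintegral_segment {n : ℕ} {p : ℝ} (hp : 1 ≤ p) {f : En n → ℝ}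
    (hf : ContDiff ℝ (⊤ : ℕ∞) f) (x y : En n) :
    ‖f y - f x‖ₑ ^ p ≤
      ‖y - x‖ₑ ^ p * ∫⁻ t in Ioc (0 : ℝ) 1, ‖gradient f (x + t • (y - x))‖ₑ ^ p := by
  have hp0 : 0 < p := by linarith
  have hg := continuous_gradient hf
  have hder : ∀ t : ℝ, HasDerivAt (fun t : ℝ => f (x + t • (y - x)))
      ⟪gradient f (x + t • (y - x)), y - x⟫ t := by
    intro t
    have h1 : HasDerivAt (fun t : ℝ => x + t • (y - x)) (y - x) t := by
      simpa using ((hasDerivAt_id t).smul_const (y - x)).const_add x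
    have h2 := ((hf.differentiable (by simp)) (x + t • (y - x))).hasFDerivAt.comp_hasDerivAt t h1
    rw [inner_gradient_left]
    exact h2
  have hc : Continuous fun t : ℝ => gradient f (x + t • (y - x)) := by fun_prop
  have hftc := intervalIntegral.integral_eq_sub_of_hasDerivAt (a := 0) (b := 1)
    (fun t _ => hder t) (Continuous.intervalIntegrable (by fun_prop) _ _)
  have e : f y - f x = ∫ t in Ioc (0 : ℝ) 1, ⟪gradient f (x + t • (y - x)), y - x⟫ := by
    rw [← intervalIntegral.integral_of_le zero_le_one, hftc]
    simp
  have : IsProbabilityMeasure (volume.restrict (Ioc (0 : ℝ) 1)) := ⟨by simp⟩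
  calc ‖f y - f x‖ₑ ^ p
      ≤ (∫⁻ t in Ioc (0 : ℝ) 1, ‖gradient f (x + t • (y - x))‖ₑ * ‖y - x‖ₑ) ^ p := by
        refine ENNReal.rpow_le_rpow ?_ hp0.le
        rw [e]
        refine (enorm_integral_le_lintegral_enorm _).trans (lintegral_mono fun t => ?_)
        rw [← ofReal_norm, ← ofReal_norm, ← ofReal_norm, ← ENNReal.ofReal_mul (norm_nonneg _)]
        exact ENNReal.ofReal_le_ofReal (norm_inner_le_norm _ _)
    _ = ‖y - x‖ₑ ^ p * (∫⁻ t in Ioc (0 : ℝ) 1, ‖gradient f (x + t • (y - x))‖ₑ) ^ p := by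
        rw [lintegral_mul_const _ hc.enorm.measurable, mul_comm,
          ENNReal.mul_rpow_of_nonneg _ _ hp0.le]
    _ ≤ _ := by
        gcongr
        exact lintegral_enorm_rpow_le_of_isProbabilityMeasure hp hc.aestronglyMeasurable

theorem lintegral_translate_sub_rpow_le {n : ℕ} {p : ℝ} (hp : 1 ≤ p) {f : En n → ℝ}
    (hf : ContDiff ℝ (⊤ : ℕ∞) f) (h : En n) :
    ∫⁻ x, ‖f (x + h) - f x‖ₑ ^ p ≤ ‖h‖ₑ ^ p * ∫⁻ x, ‖gradient f x‖ₑ ^ p := by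
  have hg := continuous_gradient hf
  calc _ ≤ ∫⁻ x, ‖h‖ₑ ^ p * ∫⁻ t in Ioc (0 : ℝ) 1, ‖gradient f (x + t • h)‖ₑ ^ p := by
        refine lintegral_mono fun x => ?_
        simpa using enorm_sub_rpow_le_lintegral_segment hp hf x (x + h)
    _ = ‖h‖ₑ ^ p * ∫⁻ t in Ioc (0 : ℝ) 1, ∫⁻ x, ‖gradient f (x + t • h)‖ₑ ^ p := by
        rw [lintegral_const_mul', lintegral_lintegral_swap]
        · exact (by fun_prop : Continuous fun z : En n × ℝ =>
            ‖gradient f (z.1 + z.2 • h)‖ₑ).measurable.pow_const p |>.aemeasurable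
        · exact ENNReal.rpow_ne_top_of_nonneg (by linarith) enorm_ne_top
    _ = ‖h‖ₑ ^ p * ∫⁻ t in Ioc (0 : ℝ) 1, ∫⁻ x, ‖gradient f x‖ₑ ^ p := by
        congr 1
        refine lintegral_congr fun t => ?_
        exact lintegral_add_right_eq_self (fun x => ‖gradient f x‖ₑ ^ p) (t • h)
    _ = _ := by simp

theorem lintegral_translate_sub_rpow_le' {n : ℕ} {p : ℝ} (hp : 1 ≤ p) {f : En n → ℝ}
    (hf : Measurable f) (h : En n) :
    ∫⁻ x, ‖f (x + h) - f x‖ₑ ^ p ≤ 2 ^ p * ∫⁻ x, ‖f x‖ₑ ^ p := by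
  calc _ ≤ ∫⁻ x, 2 ^ (p - 1) * (‖f (x + h)‖ₑ ^ p + ‖f x‖ₑ ^ p) := by
        refine lintegral_mono fun x => ?_
        refine le_trans (ENNReal.rpow_le_rpow (enorm_sub_le) (by linarith)) ?_
        exact ENNReal.rpow_add_le_mul_rpow_add_rpow _ _ hp
    _ = 2 ^ (p - 1) * ((∫⁻ x, ‖f x‖ₑ ^ p) + ∫⁻ x, ‖f x‖ₑ ^ p) := by
        rw [lintegral_const_mul' _ _ (ENNReal.rpow_ne_top_of_nonneg (by linarith) (by simp)),
          lintegral_add_right _ (hf.enorm.pow_const p),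
          lintegral_add_right_eq_self (fun x => ‖f x‖ₑ ^ p) h]
    _ = _ := by
        rw [← two_mul, ← mul_assoc, ENNReal.rpow_sub _ _ (by simp) (by simp), ENNReal.rpow_one,
          ENNReal.div_mul_cancel (by simp) (by simp)]

/-- The truncated fractional kernel. -/
def truncKer (n : ℕ) (p s c : ℝ) (h : En n) : ℝ :=
  min 1 ((c * ‖h‖) ^ p) * ‖h‖ ^ (-((n : ℝ) + p * s))

theorem truncKer_nonneg {n : ℕ} {p s c : ℝ} (hc : 0 ≤ c) (h : En n) : 0 ≤ truncKer n p s c h := by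
  unfold truncKer; positivity

theorem integrable_truncKer {n : ℕ} {p s c : ℝ} (hn : 0 < n) (hp : 0 < p) (hs0 : 0 < s)
    (hs1 : s < 1) (hc : 0 ≤ c) : Integrable (truncKer n p s c) volume := by
  have : Nonempty (Fin n) := ⟨⟨0, hn⟩⟩
  have hps : 0 < p * (1 - s) := mul_pos hp (by linarith)
  have hps' : 0 < p * s := mul_pos hp hs0
  let f : ℝ → ℝ := fun y => min 1 ((c * y) ^ p) * y ^ (-((n : ℝ) + p * s))
  change Integrable (fun h : En n => f ‖h‖) volume
  rw [integrable_fun_norm_addHaar, finrank_euclideanSpace_fin]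
  have hm : Measurable fun y : ℝ => y ^ (n - 1) • f y := by
    simp only [f]
    fun_prop
  have hpow : ∀ y : ℝ, 0 < y → ∀ a : ℝ,
      y ^ (n - 1) * y ^ (a - (n : ℝ)) = y ^ (a - 1) := by
    intro y hy a
    rw [← Real.rpow_natCast, ← Real.rpow_add hy]
    congr 1
    have : ((n - 1 : ℕ) : ℝ) = (n : ℝ) - 1 := by
      rw [Nat.cast_sub hn]; simp
    rw [this]; ring
  rw [← Ioc_union_Ioi_eq_Ioi (zero_le_one' ℝ)]
  refine IntegrableOn.union ?_ ?_
  · have h1 : IntegrableOn (fun y : ℝ => c ^ p * y ^ (p * (1 - s) - 1)) (Ioc 0 1) := by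
      refine Integrable.const_mul ?_ _
      have := intervalIntegral.intervalIntegrable_rpow' (a := 0) (b := 1)
        (r := p * (1 - s) - 1) (by linarith)
      rwa [intervalIntegrable_iff_integrableOn_Ioc_of_le zero_le_one] at this
    refine Integrable.mono' h1 hm.aestronglyMeasurable ?_
    filter_upwards [ae_restrict_mem measurableSet_Ioc] with y hy
    have hy0 : 0 < y := hy.1
    have hf0 : 0 ≤ f y := by simp only [f]; positivity
    rw [smul_eq_mul, Real.norm_of_nonneg (by positivity)]
    have : f y ≤ c ^ p * y ^ (p * (1 - s) - n) := by
      have e : c ^ p * y ^ (p * (1 - s) - n) = (c * y) ^ p * y ^ (-((n : ℝ) + p * s)) := by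
        rw [Real.mul_rpow hc hy0.le, mul_assoc, ← Real.rpow_add hy0]
        congr 2; ring
      rw [e]
      exact mul_le_mul_of_nonneg_right (min_le_right _ _) (by positivity)
    calc y ^ (n - 1) * f y ≤ y ^ (n - 1) * (c ^ p * y ^ (p * (1 - s) - n)) := by gcongr
      _ = _ := by rw [mul_left_comm, hpow y hy0]
  · have h1 : IntegrableOn (fun y : ℝ => y ^ (-(p * s) - 1)) (Ioi 1) :=
      integrableOn_Ioi_rpow_of_lt (by linarith) one_pos
    refine Integrable.mono' h1 hm.aestronglyMeasurable ?_
    filter_upwards [ae_restrict_mem measurableSet_Ioi] with y hy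
    have hy0 : 0 < y := lt_trans one_pos hy
    have hf0 : 0 ≤ f y := by simp only [f]; positivity
    rw [smul_eq_mul, Real.norm_of_nonneg (by positivity)]
    have : f y ≤ y ^ (-(p * s) - n) := by
      have e : (-(p * s) - n) = -((n : ℝ) + p * s) := by ring
      rw [e]
      calc f y ≤ 1 * y ^ (-((n : ℝ) + p * s)) :=
            mul_le_mul_of_nonneg_right (min_le_left _ _) (by positivity)
        _ = _ := one_mul _
    calc y ^ (n - 1) * f y ≤ y ^ (n - 1) * y ^ (-(p * s) - n) := by gcongr
      _ = _ := hpow y hy0 _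

theorem integral_truncKer_div {n : ℕ} {p s c r : ℝ} (hr : 0 < r) :
    ∫ h, truncKer n p s (c / r) h = r ^ (-(p * s)) * ∫ h, truncKer n p s c h := by
  have e : ∀ h : En n, truncKer n p s (c / r) h =
      r ^ (-((n : ℝ) + p * s)) * truncKer n p s c (r⁻¹ • h) := by
    intro h
    simp only [truncKer, norm_smul, norm_inv, Real.norm_of_nonneg hr.le]
    have h1 : c / r * ‖h‖ = c * (r⁻¹ * ‖h‖) := by field_simp
    rw [Real.mul_rpow (by positivity : (0 : ℝ) ≤ r⁻¹) (norm_nonneg h), Real.inv_rpow hr.le,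
      Real.rpow_neg hr.le, inv_inv, h1]
    have : r ^ ((n : ℝ) + p * s) ≠ 0 := (Real.rpow_pos_of_pos hr _).ne'
    field_simp
  simp only [e]
  rw [integral_const_mul, Measure.integral_comp_smul, finrank_euclideanSpace_fin, smul_eq_mul,
    ← mul_assoc]
  congr 1
  rw [inv_pow, inv_inv, abs_of_pos (by positivity), ← Real.rpow_natCast, ← Real.rpow_add hr]
  congr 1; ring

theorem lintegral_gagliardo_eq {n : ℕ} {p s : ℝ} {f : En n → ℝ} (hf : AEMeasurable f volume) :
    ∫⁻ z : En n × En n, ‖f z.1 - f z.2‖ₑ ^ p * ENNReal.ofReal (‖z.1 - z.2‖ ^ (-((n : ℝ) + p * s)))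
      = ∫⁻ h : En n, (∫⁻ x, ‖f (x + h) - f x‖ₑ ^ p) *
          ENNReal.ofReal (‖h‖ ^ (-((n : ℝ) + p * s))) := by
  have hF : AEMeasurable (fun z : En n × En n =>
      ‖f z.1 - f z.2‖ₑ ^ p * ENNReal.ofReal (‖z.1 - z.2‖ ^ (-((n : ℝ) + p * s))))
      (volume.prod volume) := by
    refine AEMeasurable.mul ?_ (by fun_prop)
    exact ((hf.comp_fst.sub hf.comp_snd).enorm).pow_const p
  have hmp := measurePreserving_add_prod (volume : Measure (En n)) (volume : Measure (En n))
  have hsw : MeasurePreserving (fun z : En n × En n => (z.1 + z.2, z.1))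
      (volume.prod volume) (volume.prod volume) := by
    have h2 := hmp.comp (Measure.measurePreserving_swap (μ := (volume : Measure (En n)))
      (ν := (volume : Measure (En n))))
    convert h2 using 1
    ext1 z
    simp [add_comm]
  rw [Measure.volume_eq_prod]
  have := hsw.map_eq
  rw [← this] at hF
  have hF2 := hF.comp_measurable hsw.measurable
  rw [← this, lintegral_map' hF hsw.aemeasurable]
  refine (lintegral_prod_symm _ hF2).trans (lintegral_congr fun h => ?_)
  simp only [Function.comp_apply]
  simp only [add_sub_cancel_left]
  rw [lintegral_mul_const' _ _ ENNReal.ofReal_ne_top]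

/-- Embedding of `W^{1,p}` into `W^{s,p}` for smooth functions. -/
theorem lintegral_gagliardo_le {n : ℕ} {p s : ℝ} (hp : 1 ≤ p) {f : En n → ℝ}
    (hf : ContDiff ℝ (⊤ : ℕ∞) f) :
    ∫⁻ z : En n × En n, ‖f z.1 - f z.2‖ₑ ^ p * ENNReal.ofReal (‖z.1 - z.2‖ ^ (-((n : ℝ) + p * s)))
      ≤ (∫⁻ h : En n, ENNReal.ofReal (truncKer n p s 1 h)) *
        ((∫⁻ x, ‖gradient f x‖ₑ ^ p) + 2 ^ p * ∫⁻ x, ‖f x‖ₑ ^ p) := by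
  have hp0 : 0 < p := by linarith
  rw [lintegral_gagliardo_eq hf.continuous.aemeasurable,
    ← lintegral_mul_const _ (by unfold truncKer; fun_prop)]
  refine lintegral_mono fun h => ?_
  unfold truncKer
  rw [ENNReal.ofReal_mul (by positivity), mul_comm (ENNReal.ofReal (min _ _)), mul_assoc,
    mul_comm (∫⁻ x, _)]
  refine mul_le_mul_right ?_ _
  rcases le_total ((1 * ‖h‖) ^ p) 1 with h1 | h1
  · rw [min_eq_right h1]
    refine (lintegral_translate_sub_rpow_le hp hf h).trans ?_
    rw [one_mul, ← ENNReal.ofReal_rpow_of_nonneg (norm_nonneg _) hp0.le, ofReal_norm]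
    gcongr
    exact le_self_add
  · rw [min_eq_left h1, ENNReal.ofReal_one, one_mul]
    exact (lintegral_translate_sub_rpow_le' hp hf.continuous.measurable h).trans le_add_self

theorem lintegral_gagliardo_le_of_tendsto {n : ℕ} {p s : ℝ} (hp : 1 ≤ p) {W : ℕ → En n → ℝ}
    {W' : En n → ℝ} (hW : ∀ m, ContDiff ℝ (⊤ : ℕ∞) (W m))
    (hae : ∀ᵐ x, Tendsto (fun m => W m x) atTop (𝓝 (W' x))) {a b : ℕ → ℝ≥0∞} {α β : ℝ≥0∞}
    (ha : ∀ m, eLpNorm (W m) (ENNReal.ofReal p) volume ≤ α + a m)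
    (hb : ∀ m, eLpNorm (gradient (W m)) (ENNReal.ofReal p) volume ≤ β + b m)
    (ha0 : Tendsto a atTop (𝓝 0)) (hb0 : Tendsto b atTop (𝓝 0))
    (hker : ∫⁻ h : En n, ENNReal.ofReal (truncKer n p s 1 h) ≠ ∞) :
    ∫⁻ z : En n × En n, ‖W' z.1 - W' z.2‖ₑ ^ p *
        ENNReal.ofReal (‖z.1 - z.2‖ ^ (-((n : ℝ) + p * s)))
      ≤ (∫⁻ h : En n, ENNReal.ofReal (truncKer n p s 1 h)) * (β ^ p + 2 ^ p * α ^ p) := by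
  have hp0 : 0 < p := by linarith
  have eq : ∀ {F : Type} [NormedAddCommGroup F] (f : En n → F),
      (∫⁻ x, ‖f x‖ₑ ^ p) = eLpNorm f (ENNReal.ofReal p) volume ^ p := by
    intro F _ f
    rw [eLpNorm_eq_lintegral_rpow_enorm_toReal (by simpa using hp0) ENNReal.ofReal_ne_top,
      ENNReal.toReal_ofReal hp0.le, ← ENNReal.rpow_mul, one_div, inv_mul_cancel₀ hp0.ne',
      ENNReal.rpow_one]
  set I : ℝ≥0∞ := ∫⁻ h : En n, ENNReal.ofReal (truncKer n p s 1 h) with hI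
  let F : ℕ → En n × En n → ℝ≥0∞ := fun m z => ‖W m z.1 - W m z.2‖ₑ ^ p *
        ENNReal.ofReal (‖z.1 - z.2‖ ^ (-((n : ℝ) + p * s)))
  have hFm : ∀ m, Measurable (F m) := fun m => by
    have : Measurable fun z : En n × En n => W m z.1 - W m z.2 :=
      ((hW m).continuous.comp continuous_fst |>.sub ((hW m).continuous.comp continuous_snd)).measurable
    simp only [F]
    fun_prop
  have hlim : ∀ᵐ z : En n × En n, ‖W' z.1 - W' z.2‖ₑ ^ p *
        ENNReal.ofReal (‖z.1 - z.2‖ ^ (-((n : ℝ) + p * s))) ≤ liminf (fun m => F m z) atTop := by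
    have h1 := (Measure.quasiMeasurePreserving_fst (μ := (volume : Measure (En n)))
      (ν := (volume : Measure (En n)))).ae hae
    have h2 := (Measure.quasiMeasurePreserving_snd (μ := (volume : Measure (En n)))
      (ν := (volume : Measure (En n)))).ae hae
    rw [Measure.volume_eq_prod]
    filter_upwards [h1, h2] with z h1 h2
    refine le_of_eq (Tendsto.liminf_eq ?_).symm
    refine ENNReal.Tendsto.mul_const ?_ (Or.inr ENNReal.ofReal_ne_top)
    exact (ENNReal.continuous_rpow_const.tendsto _).comp
      ((continuous_enorm.tendsto _).comp (h1.sub h2))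
  have hbd : ∀ m, ∫⁻ z, F m z ≤ I * ((β + b m) ^ p + 2 ^ p * (α + a m) ^ p) := by
    intro m
    refine (lintegral_gagliardo_le hp (hW m)).trans ?_
    rw [eq, eq]
    gcongr
    · exact hb m
    · exact ha m
  calc _ ≤ ∫⁻ z, liminf (fun m => F m z) atTop := lintegral_mono_ae hlim
      _ ≤ liminf (fun m => ∫⁻ z, F m z) atTop := lintegral_liminf_le hFm
      _ ≤ liminf (fun m => I * ((β + b m) ^ p + 2 ^ p * (α + a m) ^ p)) atTop :=
        liminf_le_liminf (Eventually.of_forall hbd)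
      _ = _ := by
        refine Tendsto.liminf_eq ?_
        refine ENNReal.Tendsto.const_mul ?_ (Or.inr hker)
        have hβ : Tendsto (fun m => (β + b m) ^ p) atTop (𝓝 (β ^ p)) := by
          refine (ENNReal.continuous_rpow_const.tendsto _).comp ?_
          simpa using tendsto_const_nhds.add hb0
        have hα : Tendsto (fun m => (α + a m) ^ p) atTop (𝓝 (α ^ p)) := by
          refine (ENNReal.continuous_rpow_const.tendsto _).comp ?_
          simpa using tendsto_const_nhds.add ha0
        exact hβ.add (ENNReal.Tendsto.const_mul hα
          (Or.inr (ENNReal.rpow_ne_top_of_nonneg hp0.le (by simp))))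

end Gagliardo

section Poincare

theorem lintegral_comp_add_smul_le {n : ℕ} {g : En n → ℝ≥0∞} (hg : Measurable g) (c : En n) {t : ℝ}
    (ht : 1 / 2 ≤ t) : ∫⁻ y, g (c + t • y) ≤ 2 ^ n * ∫⁻ y, g y := by
  have ht0 : 0 < t := by linarith
  have h1 : ∫⁻ y, g (c + t • y) = ∫⁻ y, g (c + y) ∂(Measure.map (t • ·) volume) := by
    rw [lintegral_map (by fun_prop) (by fun_prop)]
  rw [h1, Measure.map_addHaar_smul _ ht0.ne', lintegral_smul_measure, lintegral_add_left_eq_self,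
    finrank_euclideanSpace_fin, smul_eq_mul]
  gcongr
  rw [abs_of_pos (by positivity), ← inv_pow]
  have h2 : t⁻¹ ≤ 2 := by rw [inv_le_comm₀ ht0 two_pos]; linarith
  calc ENNReal.ofReal (t⁻¹ ^ n) ≤ ENNReal.ofReal (2 ^ n) :=
        ENNReal.ofReal_le_ofReal (pow_le_pow_left₀ (by positivity) h2 n)
    _ = 2 ^ n := by rw [ENNReal.ofReal_pow (by norm_num)]; simp

/-- Poincaré inequality on balls, in double-integral form. -/
theorem lintegral_lintegral_sub_rpow_le {n : ℕ} {p : ℝ} (hp : 1 ≤ p) {f : En n → ℝ}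
    (hf : ContDiff ℝ (⊤ : ℕ∞) f) (x₀ : En n) (ρ : ℝ) :
    ∫⁻ x in ball x₀ ρ, ∫⁻ y in ball x₀ ρ, ‖f y - f x‖ₑ ^ p ≤
      ENNReal.ofReal (2 * ρ) ^ p * (2 ^ n * volume (ball x₀ ρ) *
        ∫⁻ x in ball x₀ ρ, ‖gradient f x‖ₑ ^ p) := by
  have hp0 : 0 < p := by linarith
  have hgc := continuous_gradient hf
  set B := ball x₀ ρ with hB
  have hBm : MeasurableSet B := measurableSet_ball
  set g : En n → ℝ≥0∞ := B.indicator fun x => ‖gradient f x‖ₑ ^ p with hg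
  have hgm : Measurable g := (hgc.enorm.measurable.pow_const p).indicator hBm
  have hgi : ∫⁻ x, g x = ∫⁻ x in B, ‖gradient f x‖ₑ ^ p := lintegral_indicator hBm _
  have hconv : Convex ℝ B := convex_ball x₀ ρ
  have hmeas3 : Measurable fun z : (En n × En n) × ℝ => g (z.1.1 + z.2 • (z.1.2 - z.1.1)) :=
    hgm.comp (by fun_prop)
  have step1 : ∀ x ∈ B, ∀ y ∈ B, ‖f y - f x‖ₑ ^ p ≤
      ENNReal.ofReal (2 * ρ) ^ p * ∫⁻ t in Ioc (0 : ℝ) 1, g (x + t • (y - x)) := by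
    intro x hx y hy
    refine (enorm_sub_rpow_le_lintegral_segment hp hf x y).trans ?_
    refine mul_le_mul' ?_ ?_
    · refine ENNReal.rpow_le_rpow ?_ hp0.le
      rw [← ofReal_norm]
      refine ENNReal.ofReal_le_ofReal ?_
      rw [← dist_eq_norm]
      have h1 := dist_triangle_right y x x₀
      have h2 : dist y x₀ < ρ := hy
      have h3 : dist x x₀ < ρ := hx
      linarith
    · refine setLIntegral_mono' measurableSet_Ioc fun t ht => ?_
      have : x + t • (y - x) ∈ B := hconv.add_smul_sub_mem hx hy ⟨ht.1.le, ht.2⟩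
      rw [hg, indicator_of_mem this]
  have step2 : ∀ t ∈ Ioc (0 : ℝ) 1, ∫⁻ x in B, ∫⁻ y in B, g (x + t • (y - x)) ≤
      2 ^ n * volume B * ∫⁻ x, g x := by
    intro t ht
    rcases le_total (1 / 2) t with h | h
    · calc _ ≤ ∫⁻ x in B, 2 ^ n * ∫⁻ x, g x := by
            refine lintegral_mono fun x => ?_
            refine (setLIntegral_le_lintegral _ _).trans ?_
            have := lintegral_comp_add_smul_le hgm (x - t • x) h
            refine le_trans (le_of_eq (lintegral_congr fun y => ?_)) this
            congr 1
            rw [smul_sub]; abel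
        _ = _ := by rw [setLIntegral_const]; ring
    · rw [lintegral_lintegral_swap]
      · calc _ ≤ ∫⁻ x in B, 2 ^ n * ∫⁻ x, g x := by
              refine lintegral_mono fun y => ?_
              refine (setLIntegral_le_lintegral _ _).trans ?_
              have := lintegral_comp_add_smul_le hgm (t • y) (t := 1 - t) (by linarith)
              refine le_trans (le_of_eq (lintegral_congr fun x => ?_)) this
              congr 1
              rw [smul_sub, sub_smul, one_smul]; abel
          _ = _ := by rw [setLIntegral_const]; ring
      · exact (hmeas3.comp (f := fun z : En n × En n => (z, t)) (by fun_prop)).aemeasurable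
  calc _ ≤ ∫⁻ x in B, ∫⁻ y in B, ENNReal.ofReal (2 * ρ) ^ p *
          ∫⁻ t in Ioc (0 : ℝ) 1, g (x + t • (y - x)) :=
        setLIntegral_mono' hBm fun x hx => setLIntegral_mono' hBm fun y hy => step1 x hx y hy
    _ = ENNReal.ofReal (2 * ρ) ^ p * ∫⁻ x in B, ∫⁻ y in B,
          ∫⁻ t in Ioc (0 : ℝ) 1, g (x + t • (y - x)) := by
        have hne : ENNReal.ofReal (2 * ρ) ^ p ≠ ∞ := ENNReal.rpow_ne_top_of_nonneg hp0.le ENNReal.ofReal_ne_top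
        rw [← lintegral_const_mul' _ _ hne]
        exact lintegral_congr fun x => lintegral_const_mul' _ _ hne
    _ = ENNReal.ofReal (2 * ρ) ^ p * ∫⁻ t in Ioc (0 : ℝ) 1, ∫⁻ x in B, ∫⁻ y in B,
          g (x + t • (y - x)) := by
        congr 1
        refine (lintegral_congr fun x => lintegral_lintegral_swap ?_).trans
          (lintegral_lintegral_swap ?_)
        · exact (hmeas3.comp (f := fun z : En n × ℝ => ((x, z.1), z.2)) (by fun_prop)).aemeasurable
        · refine Measurable.aemeasurable ?_
          exact (hmeas3.comp (f := fun z : (En n × ℝ) × En n => ((z.1.1, z.2), z.1.2))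
            (by fun_prop)).lintegral_prod_right'
    _ ≤ ENNReal.ofReal (2 * ρ) ^ p * ∫⁻ _ in Ioc (0 : ℝ) 1, 2 ^ n * volume B * ∫⁻ x, g x := by
        exact mul_le_mul_right (setLIntegral_mono' measurableSet_Ioc step2) _
    _ = _ := by simp [hgi]

end Poincare

section Pointwise

theorem Jp_of_pos {p t : ℝ} (ht : 0 < t) : Jp p t = t ^ (p - 1) := by
  rw [Jp, abs_of_pos ht, ← rpow_add_one ht.ne']
  ring_nf

theorem Jp_neg (p t : ℝ) : Jp p (-t) = -Jp p t := by simp [Jp]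

theorem Jp_zero (p : ℝ) : Jp p 0 = 0 := by simp [Jp]

theorem abs_Jp {p : ℝ} (hp : 1 < p) (t : ℝ) : |Jp p t| = |t| ^ (p - 1) := by
  rcases lt_trichotomy t 0 with h | rfl | h
  · rw [← neg_neg t, Jp_neg, Jp_of_pos (neg_pos.2 h), abs_neg, abs_neg,
      abs_of_pos (neg_pos.2 h), abs_of_nonneg (rpow_nonneg (neg_pos.2 h).le _)]
  · rw [Jp_zero, abs_zero, zero_rpow (by linarith)]
  · rw [Jp_of_pos h, abs_of_pos h, abs_of_nonneg (rpow_nonneg h.le _)]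

theorem measurable_Jp (p : ℝ) : Measurable (Jp p) := by
  unfold Jp
  fun_prop

theorem strictMono_Jp {p : ℝ} (hp : 1 < p) : StrictMono (Jp p) := by
  have hp' : 0 < p - 1 := by linarith
  intro a b hab
  rcases lt_trichotomy a 0 with ha | rfl | ha
  · rcases lt_trichotomy b 0 with hb | rfl | hb
    · rw [← neg_neg a, ← neg_neg b, Jp_neg, Jp_neg p (-b), Jp_of_pos (neg_pos.2 ha),
        Jp_of_pos (neg_pos.2 hb), neg_lt_neg_iff]
      exact rpow_lt_rpow (neg_pos.2 hb).le (by linarith) hp'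
    · rw [← neg_neg a, Jp_neg, Jp_of_pos (neg_pos.2 ha), Jp_zero, neg_lt_zero]
      exact rpow_pos_of_pos (neg_pos.2 ha) _
    · rw [← neg_neg a, Jp_neg, Jp_of_pos (neg_pos.2 ha), Jp_of_pos hb]
      linarith [rpow_pos_of_pos (neg_pos.2 ha) (p - 1), rpow_pos_of_pos hb (p - 1)]
  · rw [Jp_zero, Jp_of_pos hab]
    exact rpow_pos_of_pos hab _
  · rw [Jp_of_pos ha, Jp_of_pos (ha.trans hab)]
    exact rpow_lt_rpow ha.le hab hp'

theorem picone_of_lt {p a b α β : ℝ} (hp : 1 < p) (hb : 0 < b) (hab : b < a)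
    (hα : 0 ≤ α) (hβ : 0 ≤ β) :
    Jp p (a - b) * (α ^ p * a ^ (1 - p) - β ^ p * b ^ (1 - p)) ≤ |α - β| ^ p := by
  have ha : 0 < a := hb.trans hab
  rw [Jp_of_pos (sub_pos.2 hab)]
  rcases le_or_gt α β with h | h
  · refine le_trans ?_ (by positivity : (0 : ℝ) ≤ |α - β| ^ p)
    refine mul_nonpos_of_nonneg_of_nonpos (rpow_nonneg (sub_pos.2 hab).le _) ?_
    rw [sub_nonpos]
    have h1 : α ^ p ≤ β ^ p := rpow_le_rpow hα h (by linarith)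
    have h2 : a ^ (1 - p) ≤ b ^ (1 - p) := rpow_le_rpow_of_nonpos hb hab.le (by linarith)
    gcongr
  · set τ := (a - b) / a with hτ
    have hτ0 : 0 < τ := div_pos (sub_pos.2 hab) ha
    have hτ1 : 0 < 1 - τ := by
      have : 1 - τ = b / a := by rw [hτ]; field_simp; ring
      rw [this]; positivity
    have hα' : α = (1 - τ) * (β / (1 - τ)) + τ * ((α - β) / τ) := by
      field_simp; ring
    have hconv := (convexOn_rpow hp.le).2 (x := β / (1 - τ)) (y := (α - β) / τ)
      (div_nonneg hβ hτ1.le) (div_nonneg (by linarith) hτ0.le) hτ1.le hτ0.le (by ring)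
    simp only [smul_eq_mul] at hconv
    rw [← hα', div_rpow hβ hτ1.le, div_rpow (by linarith) hτ0.le] at hconv
    have e1 : (a - b) ^ (p - 1) * a ^ (1 - p) = τ ^ (p - 1) := by
      rw [hτ, div_rpow (sub_pos.2 hab).le ha.le, ← neg_sub p 1, rpow_neg ha.le, div_eq_mul_inv]
    have e2 : (a - b) ^ (p - 1) * b ^ (1 - p) = τ ^ (p - 1) * ((1 - τ) * ((1 - τ) ^ p)⁻¹) := by
      have : 1 - τ = b / a := by rw [hτ]; field_simp; ring
      have e3 : (1 - τ) * ((1 - τ) ^ p)⁻¹ = (1 - τ) ^ (1 - p) := by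
        rw [rpow_sub hτ1, rpow_one, div_eq_mul_inv]
      rw [e3, ← e1, this, div_rpow hb.le ha.le]
      have : a ^ (1 - p) ≠ 0 := (rpow_pos_of_pos ha _).ne'
      field_simp
    have e4 : τ ^ (p - 1) * (τ * (τ ^ p)⁻¹) = 1 := by
      rw [rpow_sub hτ0, rpow_one]
      have : τ ^ p ≠ 0 := (rpow_pos_of_pos hτ0 _).ne'
      field_simp
    rw [abs_of_pos (sub_pos.2 h)]
    have hm := mul_le_mul_of_nonneg_left hconv (rpow_nonneg hτ0.le (p - 1))
    calc _ = τ ^ (p - 1) * α ^ p - β ^ p * (τ ^ (p - 1) * ((1 - τ) * ((1 - τ) ^ p)⁻¹)) := by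
          rw [← e2, ← e1]; ring
      _ ≤ (τ ^ (p - 1) * (τ * (τ ^ p)⁻¹)) * (α - β) ^ p := by
          rw [div_eq_mul_inv, div_eq_mul_inv] at hm
          linarith
      _ = _ := by rw [e4, one_mul]

/-- Discrete Picone inequality. -/
theorem picone {p a b α β : ℝ} (hp : 1 < p) (ha : 0 < a) (hb : 0 < b) (hα : 0 ≤ α) (hβ : 0 ≤ β) :
    Jp p (a - b) * (α ^ p * a ^ (1 - p) - β ^ p * b ^ (1 - p)) ≤ |α - β| ^ p := by
  rcases lt_trichotomy a b with h | rfl | h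
  · have := picone_of_lt hp ha h hβ hα
    rw [← neg_sub b a, Jp_neg, abs_sub_comm]
    linarith
  · rw [sub_self, Jp_zero, zero_mul]; positivity
  · exact picone_of_lt hp hb h hα hβ

theorem add_rpow_le_two_rpow {m a b : ℝ} (hm : 0 ≤ m) (ha : 0 ≤ a) (hb : 0 ≤ b) :
    (a + b) ^ m ≤ 2 ^ m * (a ^ m + b ^ m) := by
  have h1 : (a + b) ^ m ≤ (2 * max a b) ^ m := by
    refine rpow_le_rpow (by positivity) ?_ hm
    linarith [le_max_left a b, le_max_right a b]
  refine h1.trans ?_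
  rw [mul_rpow (by norm_num) (le_max_of_le_left ha)]
  gcongr
  rcases max_cases a b with h | h <;> rw [h.1]
  · linarith [rpow_nonneg hb m]
  · linarith [rpow_nonneg ha m]

theorem Jp_mul_le_of_nonneg_of_neg {p d a b α : ℝ} (hp : 1 < p) (hd : 0 < d) (hb : b < 0)
    (hα : 0 ≤ α) (ha : a < 0 → α = 0) :
    Jp p (a - b) * (α ^ p * (a + d) ^ (1 - p)) ≤
      2 ^ p * (α ^ p + α ^ p * d ^ (1 - p) * (max (-b) 0) ^ (p - 1)) := by
  have hp' : 0 < p - 1 := by linarith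
  rcases lt_or_ge a 0 with h | h
  · rw [ha h, zero_rpow (by linarith)]; simp
  · rw [Jp_of_pos (by linarith), max_eq_left (by linarith), sub_eq_add_neg]
    have h1 := add_rpow_le_two_rpow hp'.le h (neg_pos.2 hb).le
    have h2 : (2 : ℝ) ^ (p - 1) ≤ 2 ^ p := rpow_le_rpow_of_exponent_le (by norm_num) (by linarith)
    have hv : (a + d) ^ (1 - p) ≤ d ^ (1 - p) :=
      rpow_le_rpow_of_nonpos hd (by linarith) (by linarith)
    have h3 : a ^ (p - 1) * (a + d) ^ (1 - p) ≤ 1 := by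
      calc _ ≤ (a + d) ^ (p - 1) * (a + d) ^ (1 - p) := by gcongr; linarith
        _ = 1 := by rw [← rpow_add (by linarith)]; simp
    have h4 : 0 ≤ (-b) ^ (p - 1) := rpow_nonneg (neg_pos.2 hb).le _
    have h5 : 0 ≤ (a + d) ^ (1 - p) := rpow_nonneg (by linarith) _
    calc (a + -b) ^ (p - 1) * (α ^ p * (a + d) ^ (1 - p))
        ≤ (2 ^ p * (a ^ (p - 1) + (-b) ^ (p - 1))) * (α ^ p * (a + d) ^ (1 - p)) := by
          gcongr
          exact h1.trans (by gcongr)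
      _ = 2 ^ p * (α ^ p * (a ^ (p - 1) * (a + d) ^ (1 - p)) +
            α ^ p * (a + d) ^ (1 - p) * (-b) ^ (p - 1)) := by ring
      _ ≤ 2 ^ p * (α ^ p * 1 + α ^ p * d ^ (1 - p) * (-b) ^ (p - 1)) := by gcongr
      _ = _ := by ring

/-- Picone-type upper bound for the nonlocal integrand tested with `ω^p (u+d)^{1-p}`,
allowing `u` to be negative off the support of `ω`. -/
theorem Jp_mul_sub_le {p d a b α β : ℝ} (hp : 1 < p) (hd : 0 < d) (hα : 0 ≤ α) (hβ : 0 ≤ β)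
    (ha : a < 0 → α = 0) (hb : b < 0 → β = 0) :
    Jp p (a - b) * (α ^ p * (a + d) ^ (1 - p) - β ^ p * (b + d) ^ (1 - p)) ≤
      2 ^ p * (|α - β| ^ p + α ^ p * d ^ (1 - p) * (max (-b) 0) ^ (p - 1) +
        β ^ p * d ^ (1 - p) * (max (-a) 0) ^ (p - 1)) := by
  have hp0 : p ≠ 0 := by linarith
  have hA : 0 ≤ α ^ p * d ^ (1 - p) * (max (-b) 0) ^ (p - 1) := by positivity
  have hB : 0 ≤ β ^ p * d ^ (1 - p) * (max (-a) 0) ^ (p - 1) := by positivity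
  have h2 : (1 : ℝ) ≤ 2 ^ p := one_le_rpow (by norm_num) (by linarith)
  rcases lt_or_ge b 0 with hb0 | hb0
  · rw [hb hb0, zero_rpow hp0]
    have := Jp_mul_le_of_nonneg_of_neg hp hd hb0 hα ha
    simpa [abs_of_nonneg hα] using this
  rcases lt_or_ge a 0 with ha0 | ha0
  · rw [ha ha0, zero_rpow hp0]
    have := Jp_mul_le_of_nonneg_of_neg hp hd ha0 hβ hb
    rw [← neg_sub b a, Jp_neg]
    simpa [abs_of_nonneg hβ] using this
  have h := picone hp (a := a + d) (b := b + d) (by linarith) (by linarith) hα hβ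
  rw [add_sub_add_right_eq_sub] at h
  have h3 : 0 ≤ |α - β| ^ p := by positivity
  nlinarith

theorem rpow_sub_one_mul_le {p ε X Y : ℝ} (hp : 1 < p) (hε : 0 < ε) (hX : 0 ≤ X) (hY : 0 ≤ Y) :
    X ^ (p - 1) * Y ≤ ε * X ^ p + ε ^ (1 - p) * Y ^ p := by
  have key : ∀ {Z : ℝ}, 0 ≤ Z → Z ^ (p - 1) * Z = Z ^ p := by
    intro Z hZ
    rw [← rpow_add_one' hZ (by linarith)]; ring_nf
  rcases le_total Y (ε * X) with h | h
  · calc X ^ (p - 1) * Y ≤ X ^ (p - 1) * (ε * X) := by gcongr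
      _ = ε * X ^ p := by rw [← key hX]; ring
      _ ≤ _ := le_add_of_nonneg_right (by positivity)
  · have h1 : X ≤ Y / ε := by rw [le_div_iff₀ hε]; linarith
    calc X ^ (p - 1) * Y ≤ (Y / ε) ^ (p - 1) * Y := by gcongr
      _ = ε ^ (1 - p) * Y ^ p := by
          rw [div_rpow hY hε.le, ← key hY, ← neg_sub p 1, rpow_neg hε.le]; ring
      _ ≤ _ := le_add_of_nonneg_left (by positivity)

theorem abs_rpow_one_sub_sub_le {p d a b : ℝ} (hp : 1 < p) (hd : 0 < d) (ha : 0 ≤ a) (hb : 0 ≤ b) :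
    |(a + d) ^ (1 - p) - (b + d) ^ (1 - p)| ≤ (p - 1) * d ^ (-p) * |a - b| := by
  have := Convex.norm_image_sub_le_of_norm_hasDerivWithin_le (𝕜 := ℝ) (s := Ici (0 : ℝ))
    (f := fun t => (t + d) ^ (1 - p)) (f' := fun t => (1 - p) * (t + d) ^ (1 - p - 1))
    (C := (p - 1) * d ^ (-p)) (x := b) (y := a) ?_ ?_ (convex_Ici 0) hb ha
  · simpa [Real.norm_eq_abs] using this
  · intro t (ht : 0 ≤ t)
    have h1 : HasDerivAt (fun t : ℝ => t + d) 1 t := (hasDerivAt_id t).add_const d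
    have := h1.rpow_const (p := 1 - p) (Or.inl (by positivity))
    exact (this.congr_deriv (by ring)).hasDerivWithinAt
  · intro t (ht : 0 ≤ t)
    rw [norm_mul, Real.norm_eq_abs, Real.norm_eq_abs, abs_of_neg (by linarith : 1 - p < 0),
      abs_of_nonneg (by positivity), neg_sub]
    rw [show 1 - p - 1 = -p by ring]
    refine mul_le_mul_of_nonneg_left ?_ (by linarith)
    exact rpow_le_rpow_of_nonpos hd (by linarith) (by linarith)

theorem abs_mul_rpow_sub_le {p d a b α β : ℝ} (hp : 1 < p) (hd : 0 < d) (ha : 0 ≤ a) (hb : 0 ≤ b)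
    (hα : 0 ≤ α) (hα1 : α ≤ 1) :
    |α * (a + d) ^ (1 - p) - β * (b + d) ^ (1 - p)| ≤
      (p - 1) * d ^ (-p) * |a - b| + d ^ (1 - p) * |α - β| := by
  have h1 := abs_rpow_one_sub_sub_le hp hd ha hb
  have h2 : (b + d) ^ (1 - p) ≤ d ^ (1 - p) :=
    rpow_le_rpow_of_nonpos hd (by linarith) (by linarith)
  have h3 : 0 ≤ (b + d) ^ (1 - p) := by positivity
  calc _ = |α * ((a + d) ^ (1 - p) - (b + d) ^ (1 - p)) + (b + d) ^ (1 - p) * (α - β)| := by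
        congr 1; ring
    _ ≤ α * |(a + d) ^ (1 - p) - (b + d) ^ (1 - p)| + (b + d) ^ (1 - p) * |α - β| := by
        refine (abs_add_le _ _).trans ?_
        rw [abs_mul, abs_mul, abs_of_nonneg hα, abs_of_nonneg h3]
    _ ≤ 1 * ((p - 1) * d ^ (-p) * |a - b|) + d ^ (1 - p) * |α - β| := by gcongr
    _ = _ := by ring

end Pointwise

section Convergence

open Filter

theorem abs_clip_sub_le {t g G : ℝ} (h : |t| ≤ g) : |t - max (-|G|) (min t |G|)| ≤ |g - G| := by
  have h1 := abs_le.1 h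
  have h2 := le_abs_self (g - G)
  have h3 := le_abs_self G
  rw [abs_le]
  constructor <;> rcases max_cases (-|G|) (min t |G|) with h | h <;>
    rcases min_cases t |G| with h' | h' <;> rw [h.1] at * <;>
    linarith [abs_nonneg G, abs_nonneg (g - G)]

theorem abs_clip_le (t G : ℝ) : |max (-|G|) (min t |G|)| ≤ |G| :=
  abs_le.2 ⟨le_max_left _ _, max_le (by linarith [abs_nonneg G]) (min_le_right _ _)⟩

theorem clip_eq_self {t G : ℝ} (h : |t| ≤ |G|) : max (-|G|) (min t |G|) = t := by
  rw [min_eq_left (abs_le.1 h).2, max_eq_right (abs_le.1 h).1]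

/-- Generalized dominated convergence theorem, with dominating functions converging in `L¹`. -/
theorem tendsto_integral_of_dominated_tendsto {α : Type*} [MeasurableSpace α] {μ : Measure α}
    {f : ℕ → α → ℝ} {f₀ : α → ℝ} {g : ℕ → α → ℝ} {g₀ : α → ℝ}
    (hf : ∀ k, AEStronglyMeasurable (f k) μ) (hg : ∀ k, Integrable (g k) μ)
    (hfg : ∀ k, ∀ᵐ x ∂μ, |f k x| ≤ g k x) (hg₀ : Integrable g₀ μ)
    (hgL : Tendsto (fun k => ∫⁻ x, ‖g k x - g₀ x‖ₑ ∂μ) atTop (𝓝 0))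
    (hgae : ∀ᵐ x ∂μ, Tendsto (fun k => g k x) atTop (𝓝 (g₀ x)))
    (hfae : ∀ᵐ x ∂μ, Tendsto (fun k => f k x) atTop (𝓝 (f₀ x))) :
    (∀ k, Integrable (f k) μ) ∧
      Tendsto (fun k => ∫ x, f k x ∂μ) atTop (𝓝 (∫ x, f₀ x ∂μ)) := by
  have hInt : ∀ k, Integrable (f k) μ := fun k => (hg k).mono' (hf k) (hfg k)
  refine ⟨hInt, tendsto_integral_of_L1 f₀ (aestronglyMeasurable_of_tendsto_ae _ hf hfae)
    (Eventually.of_forall hInt) ?_⟩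
  set h : ℕ → α → ℝ := fun k x => max (-|g₀ x|) (min (f k x) |g₀ x|) with hh
  have hhm : ∀ k, AEStronglyMeasurable (h k) μ := fun k =>
    (hg₀.1.norm.neg.sup ((hf k).inf hg₀.1.norm))
  have hdom : ∀ᵐ x ∂μ, |f₀ x| ≤ |g₀ x| := by
    filter_upwards [hgae, hfae, ae_all_iff.2 hfg] with x h1 h2 h3
    exact (le_of_tendsto_of_tendsto' h2.abs h1 h3).trans (le_abs_self _)
  have hconv := tendsto_lintegral_norm_of_dominated_convergence (F := h) (f := f₀)
    (bound := fun x => |g₀ x|) (μ := μ) hhm hg₀.abs.2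
    (fun k => Eventually.of_forall fun x => abs_clip_le _ _) (by
      filter_upwards [hfae, hdom] with x h1 h2
      have := (tendsto_const_nhds (x := -|g₀ x|)).max
        (h1.min (tendsto_const_nhds (x := |g₀ x|)))
      rwa [clip_eq_self h2] at this)
  have hsum := hgL.add hconv
  rw [zero_add] at hsum
  refine tendsto_of_tendsto_of_tendsto_of_le_of_le tendsto_const_nhds hsum
    (fun _ => zero_le) fun k => ?_
  refine le_trans ?_ (le_of_eq
    (lintegral_add_left' ((hg k).1.sub hg₀.1).enorm _))
  refine lintegral_mono_ae ?_
  filter_upwards [hfg k] with x hx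
  calc ‖f k x - f₀ x‖ₑ = ‖(f k x - h k x) + (h k x - f₀ x)‖ₑ := by congr 1; ring
    _ ≤ ‖f k x - h k x‖ₑ + ‖h k x - f₀ x‖ₑ := enorm_add_le _ _
    _ ≤ _ := by
      rw [ofReal_norm]
      gcongr
      exact enorm_le_iff_norm_le.2 (abs_clip_sub_le hx)

theorem tendsto_integral_of_holder_dominated {α : Type*} [MeasurableSpace α] {μ : Measure α}
    {p p' : ℝ} (hpp : p'.HolderConjugate p) {f : ℕ → α → ℝ} {f₀ : α → ℝ} {b : ℕ → α → ℝ}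
    {b₀ a e : α → ℝ} (hf : ∀ k, AEStronglyMeasurable (f k) μ)
    (ha : MemLp a (ENNReal.ofReal p') μ) (hb : ∀ k, MemLp (b k) (ENNReal.ofReal p) μ)
    (hb₀ : MemLp b₀ (ENNReal.ofReal p) μ) (he : Integrable e μ)
    (hfg : ∀ k, ∀ᵐ x ∂μ, |f k x| ≤ a x * b k x + e x)
    (hbL : Tendsto (fun k => eLpNorm (fun x => b k x - b₀ x) (ENNReal.ofReal p) μ) atTop (𝓝 0))
    (hbae : ∀ᵐ x ∂μ, Tendsto (fun k => b k x) atTop (𝓝 (b₀ x)))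
    (hfae : ∀ᵐ x ∂μ, Tendsto (fun k => f k x) atTop (𝓝 (f₀ x))) :
    (∀ k, Integrable (f k) μ) ∧
      Tendsto (fun k => ∫ x, f k x ∂μ) atTop (𝓝 (∫ x, f₀ x ∂μ)) := by
  have := hpp.ennrealOfReal
  have hm : ∀ {c : α → ℝ}, MemLp c (ENNReal.ofReal p) μ → Integrable (fun x => a x * c x) μ :=
    fun hc => memLp_one_iff_integrable.1 (hc.smul ha)
  refine tendsto_integral_of_dominated_tendsto (g := fun k x => a x * b k x + e x)
    (g₀ := fun x => a x * b₀ x + e x) hf (fun k => (hm (hb k)).add he) hfg ((hm hb₀).add he)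
    ?_ ?_ hfae
  · have h2 : Tendsto (fun k => eLpNorm a (ENNReal.ofReal p') μ *
        eLpNorm (fun x => b k x - b₀ x) (ENNReal.ofReal p) μ) atTop (𝓝 0) := by
      have := ENNReal.Tendsto.const_mul hbL (Or.inr ha.2.ne)
      rwa [mul_zero] at this
    refine tendsto_of_tendsto_of_tendsto_of_le_of_le tendsto_const_nhds h2
      (fun _ => zero_le) fun k => ?_
    refine le_trans (le_of_eq ?_) (eLpNorm_smul_le_mul_eLpNorm (r := 1)
      ((hb k).1.sub hb₀.1) ha.1)
    rw [eLpNorm_one_eq_lintegral_enorm]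
    refine lintegral_congr fun x => ?_
    congr 1
    simp only [Pi.smul_apply', smul_eq_mul, Pi.sub_apply]
    ring
  · filter_upwards [hbae] with x hx
    exact (hx.const_mul _).add_const _

end Convergence

section Cutoff

theorem abs_rpow_sub_rpow_le {m a b : ℝ} (hm : 1 ≤ m) (ha : 0 ≤ a) (ha1 : a ≤ 1) (hb : 0 ≤ b)
    (hb1 : b ≤ 1) : |a ^ m - b ^ m| ≤ m * |a - b| := by
  have := Convex.norm_image_sub_le_of_norm_hasDerivWithin_le (𝕜 := ℝ) (s := Icc (0 : ℝ) 1)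
    (f := fun t => t ^ m) (f' := fun t => m * t ^ (m - 1))
    (C := m) (x := b) (y := a) ?_ ?_ (convex_Icc 0 1) ⟨hb, hb1⟩ ⟨ha, ha1⟩
  · simpa [Real.norm_eq_abs] using this
  · intro t ht
    exact (Real.hasDerivAt_rpow_const (Or.inr hm)).hasDerivWithinAt
  · intro t ht
    rw [norm_mul, Real.norm_eq_abs, Real.norm_eq_abs, abs_of_nonneg (by linarith : 0 ≤ m),
      abs_of_nonneg (rpow_nonneg ht.1 _)]
    exact mul_le_of_le_one_right (by linarith) (rpow_le_one ht.1 ht.2 (by linarith))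

theorem exists_smooth_cutoff (n : ℕ) {a b : ℝ} (ha : 0 < a) (hab : a < b) :
    ∃ C : ℝ, 0 < C ∧ ∀ (x₀ : En n) (r : ℝ), 0 < r → ∃ η : En n → ℝ,
      ContDiff ℝ (⊤ : ℕ∞) η ∧ (∀ x, 0 ≤ η x ∧ η x ≤ 1) ∧ (∀ x ∈ closedBall x₀ (a * r), η x = 1) ∧
      (∀ x ∉ ball x₀ (b * r), η x = 0) ∧ (∀ x y, |η x - η y| ≤ C / r * ‖x - y‖) ∧
      ∀ x, ‖gradient η x‖ ≤ C / r := by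
  let β : ContDiffBump (0 : En n) := ⟨a, b, ha, hab⟩
  have hβ : ContDiff ℝ (⊤ : ℕ∞) β := β.contDiff
  have hβ1 : ContDiff ℝ 1 β := β.contDiff
  obtain ⟨C, hC⟩ := hβ1.lipschitzWith_of_hasCompactSupport β.hasCompactSupport one_ne_zero
  have hC1 : (0 : ℝ) < C + 1 := by positivity
  refine ⟨C + 1, hC1, fun x₀ r hr => ?_⟩
  set η : En n → ℝ := fun x => β (r⁻¹ • (x - x₀)) with hη
  have hnorm : ∀ x, dist (r⁻¹ • (x - x₀)) 0 = r⁻¹ * dist x x₀ := fun x => by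
    rw [dist_zero_right, norm_smul, norm_inv, Real.norm_of_nonneg hr.le, dist_eq_norm]
  have hηs : ContDiff ℝ (⊤ : ℕ∞) η := hβ.comp (by fun_prop)
  have hlip : ∀ x y, |η x - η y| ≤ (C + 1) / r * ‖x - y‖ := fun x y => by
    have h := hC.dist_le_mul (r⁻¹ • (x - x₀)) (r⁻¹ • (y - x₀))
    rw [Real.dist_eq, dist_smul₀, dist_sub_right, norm_inv, Real.norm_of_nonneg hr.le,
      dist_eq_norm] at h
    refine h.trans ?_
    rw [div_eq_mul_inv, mul_assoc]
    gcongr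
    linarith
  refine ⟨η, hηs, fun x => ⟨β.nonneg, β.le_one⟩, fun x hx => ?_, fun x hx => ?_, hlip, fun x => ?_⟩
  · refine β.one_of_mem_closedBall ?_
    rw [mem_closedBall, hnorm, inv_mul_le_iff₀ hr]
    rw [mem_closedBall] at hx
    change _ ≤ r * a
    linarith
  · refine β.zero_of_le_dist ?_
    rw [hnorm, le_inv_mul_iff₀ hr]
    rw [mem_ball, not_lt] at hx
    change r * b ≤ _
    linarith
  · rw [norm_gradient_eq]
    refine norm_fderiv_le_of_lip' ℝ (by positivity) (Filter.Eventually.of_forall fun y => ?_)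
    exact hlip y x

/-- Cutoff functions `ω` such that `ω ^ p` is smooth with gradient controlled by `ω ^ (p - 1)`. -/
theorem exists_rpow_cutoff (n : ℕ) {p a b : ℝ} (hp : 1 < p) (ha : 0 < a) (hab : a < b) :
    ∃ C : ℝ, 0 < C ∧ ∀ (x₀ : En n) (r : ℝ), 0 < r → ∃ ω : En n → ℝ,
      ContDiff ℝ (⊤ : ℕ∞) (fun x => ω x ^ p) ∧ (∀ x, 0 ≤ ω x ∧ ω x ≤ 1) ∧
      (∀ x ∈ closedBall x₀ (a * r), ω x = 1) ∧ (∀ x ∉ ball x₀ (b * r), ω x = 0) ∧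
      (∀ x y, |ω x - ω y| ≤ C / r * ‖x - y‖) ∧
      ∀ x, ‖gradient (fun x => ω x ^ p) x‖ ≤ C / r * ω x ^ (p - 1) := by
  obtain ⟨C, hC, H⟩ := exists_smooth_cutoff n ha hab
  set k := ⌈p⌉₊ with hk
  have hkp : p ≤ k := Nat.le_ceil p
  have hp0 : 0 < p := by linarith
  have hk1 : 1 ≤ (k : ℝ) / p := (one_le_div hp0).2 hkp
  have hk0 : 0 < (k : ℝ) := by linarith
  have hkC : C * (k / p) ≤ C * k := by
    gcongr
    rw [div_le_iff₀ hp0]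
    nlinarith
  refine ⟨C * k, by positivity, fun x₀ r hr => ?_⟩
  obtain ⟨η, hη, hη01, hη1, hη0, hlip, hgrad⟩ := H x₀ r hr
  have hpow : ∀ x, (η x ^ ((k : ℝ) / p)) ^ p = η x ^ k := fun x => by
    rw [← rpow_mul (hη01 x).1, div_mul_cancel₀ _ hp0.ne', rpow_natCast]
  refine ⟨fun x => η x ^ ((k : ℝ) / p), ?_, fun x => ⟨rpow_nonneg (hη01 x).1 _,
    rpow_le_one (hη01 x).1 (hη01 x).2 (by positivity)⟩, fun x hx => ?_, fun x hx => ?_,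
    fun x y => ?_, fun x => ?_⟩
  · simp only [hpow]
    exact hη.pow k
  · simp only [hη1 x hx, one_rpow]
  · simp only [hη0 x hx]
    exact zero_rpow (by positivity)
  · refine (abs_rpow_sub_rpow_le hk1 (hη01 x).1 (hη01 x).2 (hη01 y).1 (hη01 y).2).trans ?_
    calc (k : ℝ) / p * |η x - η y| ≤ k / p * (C / r * ‖x - y‖) := by gcongr; exact hlip x y
      _ = C * (k / p) / r * ‖x - y‖ := by ring
      _ ≤ _ := by gcongr
  · simp only [hpow]
    have hd : DifferentiableAt ℝ η x := hη.differentiable (by simp) x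
    rw [norm_gradient_eq, fderiv_fun_pow _ hd, norm_smul, ← norm_gradient_eq, nsmul_eq_mul,
      Real.norm_of_nonneg (mul_nonneg hk0.le (pow_nonneg (hη01 x).1 _))]
    have h1 : η x ^ (k - 1) ≤ (η x ^ ((k : ℝ) / p)) ^ (p - 1) := by
      rw [← rpow_mul (hη01 x).1, ← rpow_natCast]
      rcases (hη01 x).1.eq_or_lt with h0 | h0
      · rw [← h0]
        have : ((k - 1 : ℕ) : ℝ) ≠ 0 := by
          have : 1 < k := Nat.lt_ceil.2 (by simpa using hp)
          have : k - 1 ≠ 0 := by omega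
          exact_mod_cast this
        rw [zero_rpow this]
        exact rpow_nonneg le_rfl _
      · refine rpow_le_rpow_of_exponent_ge h0 (hη01 x).2 ?_
        rw [Nat.cast_pred (by exact_mod_cast hk0)]
        have : (k : ℝ) / p * (p - 1) = k - k / p := by field_simp
        rw [this]
        linarith
    calc _ ≤ (k : ℝ) * (η x ^ ((k : ℝ) / p)) ^ (p - 1) * (C / r) := by
          gcongr
          · exact mul_nonneg hk0.le (rpow_nonneg (rpow_nonneg (hη01 x).1 _) _)
          · exact hgrad x
      _ = _ := by ring

end Cutoff

section LevelSets

open Filter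

theorem lintegral_enorm_rpow_eq {α F : Type*} [MeasurableSpace α] [NormedAddCommGroup F]
    {μ : Measure α} {p : ℝ} (hp : 0 < p) (f : α → F) :
    ∫⁻ x, ‖f x‖ₑ ^ p ∂μ = eLpNorm f (ENNReal.ofReal p) μ ^ p := by
  rw [eLpNorm_eq_lintegral_rpow_enorm_toReal (by simpa using hp) ENNReal.ofReal_ne_top,
    ENNReal.toReal_ofReal hp.le, ← ENNReal.rpow_mul, one_div, inv_mul_cancel₀ hp.ne',
    ENNReal.rpow_one]

theorem lintegral_enorm_rpow_le_mul_measure_univ {α : Type*} [MeasurableSpace α]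
    {μ : Measure α} {p : ℝ} (hp : 1 ≤ p) {g : α → ℝ} (hg : AEStronglyMeasurable g μ) :
    (∫⁻ t, ‖g t‖ₑ ∂μ) ^ p ≤ μ univ ^ (p - 1) * ∫⁻ t, ‖g t‖ₑ ^ p ∂μ := by
  have hp0 : 0 < p := by linarith
  have h := eLpNorm_le_eLpNorm_mul_rpow_measure_univ (p := 1) (q := ENNReal.ofReal p)
    (by simpa using ENNReal.ofReal_le_ofReal hp) hg
  rw [eLpNorm_one_eq_lintegral_enorm, ENNReal.toReal_one, ENNReal.toReal_ofReal hp0.le] at h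
  rw [lintegral_enorm_rpow_eq hp0]
  refine (ENNReal.rpow_le_rpow h hp0.le).trans (le_of_eq ?_)
  rw [ENNReal.mul_rpow_of_nonneg _ _ hp0.le, ← ENNReal.rpow_mul, mul_comm]
  congr 2
  field_simp

theorem lintegral_sub_weighted_average_rpow_le {α : Type*} [MeasurableSpace α] {μ : Measure α}
    [IsFiniteMeasure μ] {p : ℝ} (hp : 1 ≤ p) {g ρ : α → ℝ} (hg : Integrable g μ)
    (hρ : AEStronglyMeasurable ρ μ) (hρ0 : ∀ x, 0 ≤ ρ x) (hρ1 : ∀ x, ρ x ≤ 1)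
    (hW : 0 < ∫ x, ρ x ∂μ) :
    ∫⁻ x, ‖g x - (∫ y, ρ y * g y ∂μ) / ∫ y, ρ y ∂μ‖ₑ ^ p ∂μ ≤
      (ENNReal.ofReal (∫ y, ρ y ∂μ))⁻¹ ^ p * μ univ ^ (p - 1) *
        ∫⁻ x, ∫⁻ y, ‖g y - g x‖ₑ ^ p ∂μ ∂μ := by
  have hp0 : 0 < p := by linarith
  set W := ∫ y, ρ y ∂μ with hWdef
  have hρn : ∀ x, ‖ρ x‖ ≤ 1 := fun x => by
    rw [Real.norm_of_nonneg (hρ0 x)]; exact hρ1 x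
  have hρi : Integrable ρ μ := (integrable_const (1 : ℝ)).mono' hρ (Eventually.of_forall hρn)
  have hρg : Integrable (fun y => ρ y * g y) μ := hg.bdd_mul hρ (Eventually.of_forall hρn)
  have hWne : ENNReal.ofReal W ≠ 0 := by simpa using hW
  have hpt : ∀ x, ‖g x - (∫ y, ρ y * g y ∂μ) / W‖ₑ ^ p ≤
      (ENNReal.ofReal W)⁻¹ ^ p * μ univ ^ (p - 1) * ∫⁻ y, ‖g y - g x‖ₑ ^ p ∂μ := by
    intro x
    have h1 : g x - (∫ y, ρ y * g y ∂μ) / W = W⁻¹ * ∫ y, ρ y * (g x - g y) ∂μ := by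
      have : ∫ y, ρ y * (g x - g y) ∂μ = W * g x - ∫ y, ρ y * g y ∂μ := by
        rw [hWdef, ← integral_mul_const, ← integral_sub (hρi.mul_const _) hρg]
        exact integral_congr_ae (Eventually.of_forall fun y => by ring)
      rw [this]
      field_simp
    have h2 : ‖g x - (∫ y, ρ y * g y ∂μ) / W‖ₑ ≤
        (ENNReal.ofReal W)⁻¹ * ∫⁻ y, ‖g y - g x‖ₑ ∂μ := by
      rw [h1, enorm_mul, ← ENNReal.ofReal_inv_of_pos hW, ← Real.enorm_of_nonneg (by positivity)]
      gcongr
      refine (enorm_integral_le_lintegral_enorm _).trans (lintegral_mono fun y => ?_)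
      rw [enorm_mul, ← enorm_neg (g x - g y), neg_sub]
      refine mul_le_of_le_one_left zero_le ?_
      rw [← enorm_one (G := ℝ)]
      exact enorm_le_iff_norm_le.2 (by simpa using hρn y)
    refine (ENNReal.rpow_le_rpow h2 hp0.le).trans ?_
    rw [ENNReal.mul_rpow_of_nonneg _ _ hp0.le, mul_assoc]
    gcongr
    exact lintegral_enorm_rpow_le_mul_measure_univ hp (hg.1.sub aestronglyMeasurable_const)
  refine (lintegral_mono hpt).trans (le_of_eq (lintegral_const_mul' _ _ ?_))
  refine ENNReal.mul_ne_top (ENNReal.rpow_ne_top_of_nonneg hp0.le (ENNReal.inv_ne_top.2 hWne))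
    (ENNReal.rpow_ne_top_of_nonneg (by linarith) (measure_ne_top _ _))

theorem gradient_log_add {n : ℕ} {V : En n → ℝ} {d : ℝ} {x : En n} (hV : DifferentiableAt ℝ V x)
    (hpos : 0 < V x + d) :
    gradient (fun x => Real.log (V x + d)) x = (V x + d)⁻¹ • gradient V x := by
  refine gradient_eq_of_hasFDerivAt (hV.hasFDerivAt.add_const d |>.log hpos.ne') fun v => ?_
  rw [inner_smul_left, inner_gradient_left]
  simp

theorem eLpNorm_gradient_log_le {n : ℕ} {P : ℝ≥0∞} {d : ℝ} (hP : 1 ≤ P) {V : En n → ℝ}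
    {H : En n → En n} {μ : Measure (En n)} (hV : ContDiff ℝ (⊤ : ℕ∞) V) (hV0 : ∀ x, 0 ≤ V x)
    (hd : 0 < d) (hH : AEStronglyMeasurable H μ) :
    eLpNorm (gradient fun x => Real.log (V x + d)) P μ ≤
      ENNReal.ofReal d⁻¹ * eLpNorm (fun x => gradient V x - H x) P μ +
        eLpNorm (fun x => (V x + d)⁻¹ • H x) P μ := by
  have hm1 : AEStronglyMeasurable (fun x => (V x + d)⁻¹) μ :=
    (hV.continuous.measurable.add_const d).inv.aestronglyMeasurable
  have hm2 : AEStronglyMeasurable (fun x => gradient V x - H x) μ :=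
    (continuous_gradient hV).aestronglyMeasurable.sub hH
  have e1 : gradient (fun x => Real.log (V x + d)) =
      (fun x => (V x + d)⁻¹ • (gradient V x - H x)) + fun x => (V x + d)⁻¹ • H x := by
    funext x
    rw [gradient_log_add (hV.differentiable (by simp) x) (by linarith [hV0 x]), Pi.add_apply,
      smul_sub, sub_add_cancel]
  rw [e1]
  refine (eLpNorm_add_le (hm1.smul hm2) (hm1.smul hH) hP).trans (add_le_add ?_ le_rfl)
  refine eLpNorm_le_mul_eLpNorm_of_ae_le_mul (Eventually.of_forall fun x => ?_) P
  simp only [Pi.smul_apply', norm_smul, norm_inv]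
  rw [Real.norm_of_nonneg (by linarith [hV0 x])]
  gcongr
  linarith [hV0 x]

theorem lintegral_lintegral_log_sub_rpow_le {n : ℕ} {p d : ℝ} (hp : 1 ≤ p) {U : En n → ℝ}
    {H : En n → En n} (hU : MemLp U (ENNReal.ofReal p) volume)
    (hH : MemLp H (ENNReal.ofReal p) volume)
    (hw : HasWeakGradOn U H univ) (h0 : ∀ x, 0 ≤ U x) (hd : 0 < d) (x₀ : En n) (ρ : ℝ) :
    ∫⁻ x in ball x₀ ρ, ∫⁻ y in ball x₀ ρ,
        ‖Real.log (U y + d) - Real.log (U x + d)‖ₑ ^ p ≤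
      ENNReal.ofReal (2 * ρ) ^ p * (2 ^ n * volume (ball x₀ ρ) *
        ∫⁻ x in ball x₀ ρ, ‖(U x + d)⁻¹ • H x‖ₑ ^ p) := by
  have hp0 : 0 < p := by linarith
  have hP : 1 ≤ ENNReal.ofReal p := by simpa using ENNReal.ofReal_le_ofReal hp
  obtain ⟨V, hV, hV0, -, hVg, hVae, hVgae⟩ := exists_smooth_approx hp hU hH hw h0
  set B := ball x₀ ρ with hB
  set μ := (volume : Measure (En n)).restrict B with hμ
  have hUd : ∀ x, 0 < U x + d := fun x => by linarith [h0 x]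
  have hVd : ∀ k x, 0 < V k x + d := fun k x => by linarith [hV0 k x]
  have hUm : AEMeasurable (fun x => Real.log (U x + d)) volume :=
    (hU.1.aemeasurable.add_const d).log
  have hlogV : ∀ k, ContDiff ℝ (⊤ : ℕ∞) fun x => Real.log (V k x + d) := fun k =>
    ((hV k).add contDiff_const).log fun x => (hVd k x).ne'
  -- convergence of the right-hand sides
  have hinv : ∀ {t : ℝ}, 0 ≤ t → ‖(t + d)⁻¹‖ ≤ d⁻¹ := fun {t} ht => by
    rw [norm_inv, Real.norm_of_nonneg (by linarith)]
    exact inv_anti₀ hd (by linarith)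
  have hdH : ∫⁻ x, (ENNReal.ofReal d⁻¹ * ‖H x‖ₑ) ^ p ∂μ ≠ ∞ := by
    have h1 : MemLp (fun x => d⁻¹ • H x) (ENNReal.ofReal p) μ := (hH.restrict B).const_smul d⁻¹
    have h2 := lintegral_enorm_rpow_eq (μ := μ) hp0 (fun x => d⁻¹ • H x)
    simp only [enorm_smul, Real.enorm_of_nonneg (inv_pos.2 hd).le] at h2
    rw [h2]
    exact ENNReal.rpow_ne_top_of_nonneg hp0.le h1.2.ne
  have hlim1 : Tendsto (fun k => ∫⁻ x, ‖(V k x + d)⁻¹ • H x‖ₑ ^ p ∂μ) atTop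
      (𝓝 (∫⁻ x, ‖(U x + d)⁻¹ • H x‖ₑ ^ p ∂μ)) := by
    refine tendsto_lintegral_of_dominated_convergence'
      (fun x => (ENNReal.ofReal d⁻¹ * ‖H x‖ₑ) ^ p) (fun k => ?_) (fun k => ?_) hdH ?_
    · have h1 : AEMeasurable (fun x => (V k x + d)⁻¹) μ :=
        ((hV k).continuous.measurable.add_const d).inv.aemeasurable
      exact (h1.smul (hH.1.aemeasurable.restrict)).enorm.pow_const p
    · refine Eventually.of_forall fun x => ENNReal.rpow_le_rpow ?_ hp0.le
      rw [enorm_smul, ← Real.enorm_of_nonneg (inv_pos.2 hd).le]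
      gcongr
      exact enorm_le_iff_norm_le.2 (by simpa [abs_of_pos hd] using hinv (hV0 k x))
    · filter_upwards [ae_restrict_of_ae hVae] with x hx
      exact (ENNReal.continuous_rpow_const.tendsto _).comp ((continuous_enorm.tendsto _).comp
        (((hx.add_const d).inv₀ (hUd x).ne').smul_const _))
  have hlim2 : Tendsto (fun k => (ENNReal.ofReal d⁻¹ *
        eLpNorm (fun x => gradient (V k) x - H x) (ENNReal.ofReal p) volume +
        eLpNorm (fun x => (V k x + d)⁻¹ • H x) (ENNReal.ofReal p) μ) ^ p) atTop
      (𝓝 (∫⁻ x, ‖(U x + d)⁻¹ • H x‖ₑ ^ p ∂μ)) := by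
    have h1 : Tendsto (fun k => eLpNorm (fun x => (V k x + d)⁻¹ • H x) (ENNReal.ofReal p) μ) atTop
        (𝓝 (eLpNorm (fun x => (U x + d)⁻¹ • H x) (ENNReal.ofReal p) μ)) := by
      have := (ENNReal.continuous_rpow_const (y := p⁻¹)).tendsto _ |>.comp hlim1
      simp only [Function.comp_def, lintegral_enorm_rpow_eq hp0, ← ENNReal.rpow_mul,
        mul_inv_cancel₀ hp0.ne', ENNReal.rpow_one] at this
      exact this
    have h2 := (ENNReal.Tendsto.const_mul hVg
      (Or.inr (ENNReal.ofReal_ne_top (r := d⁻¹)))).add h1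
    rw [mul_zero, zero_add] at h2
    rw [lintegral_enorm_rpow_eq hp0]
    exact (ENNReal.continuous_rpow_const.tendsto _).comp h2
  have hbd : ∀ k, ∫⁻ x, ‖gradient (fun x => Real.log (V k x + d)) x‖ₑ ^ p ∂μ ≤
      (ENNReal.ofReal d⁻¹ *
        eLpNorm (fun x => gradient (V k) x - H x) (ENNReal.ofReal p) volume +
        eLpNorm (fun x => (V k x + d)⁻¹ • H x) (ENNReal.ofReal p) μ) ^ p := by
    intro k
    rw [lintegral_enorm_rpow_eq hp0]
    gcongr
    refine (eLpNorm_gradient_log_le hP (hV k) (hV0 k) hd hH.1.restrict).trans ?_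
    gcongr
    exact Measure.restrict_le_self
  -- Fatou
  let F : ℕ → En n × En n → ℝ≥0∞ := fun k z =>
    ‖Real.log (V k z.2 + d) - Real.log (V k z.1 + d)‖ₑ ^ p
  have hFm : ∀ k, Measurable (F k) := fun k => by
    have : Continuous fun z : En n × En n => Real.log (V k z.2 + d) - Real.log (V k z.1 + d) :=
      ((hlogV k).continuous.comp continuous_snd).sub ((hlogV k).continuous.comp continuous_fst)
    exact this.enorm.measurable.pow_const p
  have hF0 : AEMeasurable (fun z : En n × En n =>
      ‖Real.log (U z.2 + d) - Real.log (U z.1 + d)‖ₑ ^ p) (μ.prod μ) :=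
    ((hUm.restrict.comp_snd).sub (hUm.restrict.comp_fst)).enorm.pow_const p
  have hlim : ∀ᵐ z ∂(μ.prod μ), ‖Real.log (U z.2 + d) - Real.log (U z.1 + d)‖ₑ ^ p ≤
      liminf (fun k => F k z) atTop := by
    have h1 := (Measure.quasiMeasurePreserving_fst (μ := μ) (ν := μ)).ae (ae_restrict_of_ae hVae)
    have h2 := (Measure.quasiMeasurePreserving_snd (μ := μ) (ν := μ)).ae (ae_restrict_of_ae hVae)
    filter_upwards [h1, h2] with z h1 h2
    refine le_of_eq (Tendsto.liminf_eq ?_).symm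
    exact (ENNReal.continuous_rpow_const.tendsto _).comp ((continuous_enorm.tendsto _).comp
      (((h2.add_const d).log (hUd _).ne').sub ((h1.add_const d).log (hUd _).ne')))
  calc _ = ∫⁻ z, ‖Real.log (U z.2 + d) - Real.log (U z.1 + d)‖ₑ ^ p ∂(μ.prod μ) :=
        (lintegral_prod _ hF0).symm
    _ ≤ ∫⁻ z, liminf (fun k => F k z) atTop ∂(μ.prod μ) := lintegral_mono_ae hlim
    _ ≤ liminf (fun k => ∫⁻ z, F k z ∂(μ.prod μ)) atTop := lintegral_liminf_le hFm
    _ ≤ liminf (fun k => ENNReal.ofReal (2 * ρ) ^ p * (2 ^ n * volume B * (ENNReal.ofReal d⁻¹ *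
        eLpNorm (fun x => gradient (V k) x - H x) (ENNReal.ofReal p) volume +
        eLpNorm (fun x => (V k x + d)⁻¹ • H x) (ENNReal.ofReal p) μ) ^ p)) atTop := by
        refine liminf_le_liminf (Eventually.of_forall fun k => ?_)
        rw [lintegral_prod _ (hFm k).aemeasurable]
        refine (lintegral_lintegral_sub_rpow_le hp (hlogV k) x₀ ρ).trans ?_
        gcongr
        exact hbd k
    _ = _ := by
        refine Tendsto.liminf_eq ?_
        refine ENNReal.Tendsto.const_mul (ENNReal.Tendsto.const_mul hlim2 (Or.inr ?_)) (Or.inr ?_)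
        · exact ENNReal.mul_ne_top (by simp) measure_ball_lt_top.ne
        · exact ENNReal.rpow_ne_top_of_nonneg hp0.le ENNReal.ofReal_ne_top

theorem volume_ball_eq_ofReal {n : ℕ} (x₀ : En n) {ρ : ℝ} (hρ : 0 < ρ) :
    volume (ball x₀ ρ) = ENNReal.ofReal (ρ ^ n * volume.real (ball (0 : En n) 1)) := by
  rw [Measure.addHaar_ball_of_pos _ _ hρ, finrank_euclideanSpace_fin,
    ENNReal.ofReal_mul (by positivity), ofReal_measureReal measure_ball_lt_top.ne]

theorem volume_real_ball_eq {n : ℕ} (x₀ : En n) {ρ : ℝ} (hρ : 0 < ρ) :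
    volume.real (ball x₀ ρ) = ρ ^ n * volume.real (ball (0 : En n) 1) := by
  rw [Measure.real, volume_ball_eq_ofReal x₀ hρ, ENNReal.toReal_ofReal (by positivity)]

theorem volume_real_unit_ball_pos (n : ℕ) : 0 < volume.real (ball (0 : En n) 1) :=
  ENNReal.toReal_pos (measure_ball_pos _ _ one_pos).ne' measure_ball_lt_top.ne

/-- Level-set estimates for `log (U + d)` from an energy bound for the logarithm. -/
theorem exists_level_set_log_le (n : ℕ) {p E : ℝ} (hp : 1 < p) (hE : 0 < E) :
    ∃ C : ℝ, 0 < C ∧ ∀ (U : En n → ℝ) (H : En n → En n) (x₀ : En n) (r d : ℝ) (ψ : En n → ℝ),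
      MemLp U (ENNReal.ofReal p) volume → MemLp H (ENNReal.ofReal p) volume →
      HasWeakGradOn U H univ → (∀ x, 0 ≤ U x) → 0 < d → 0 < r →
      ∫⁻ x in ball x₀ (3 * r / 2), ‖(U x + d)⁻¹ • H x‖ₑ ^ p ≤
        ENNReal.ofReal (E * r ^ ((n : ℝ) - p)) →
      Continuous ψ → (∀ x, 0 ≤ ψ x ∧ ψ x ≤ 1) → (∀ x ∈ ball x₀ r, ψ x = 1) →
      ∀ a : ℝ, 0 < a →
        volume (ball x₀ (3 * r / 2) ∩ {x | a ≤ |Real.log (U x + d) -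
            (∫ z in ball x₀ (3 * r / 2), ψ z ^ p * Real.log (U z + d)) /
              (∫ z in ball x₀ (3 * r / 2), ψ z ^ p)|}) ≤
          ENNReal.ofReal (C * (volume (ball x₀ (r / 2))).toReal / a ^ p) := by
  have hp0 : 0 < p := by linarith
  set β := volume.real (ball (0 : En n) 1) with hβ
  have hβ0 : 0 < β := volume_real_unit_ball_pos n
  refine ⟨(β⁻¹) ^ p * ((3 / 2) ^ n * β) ^ (p - 1) * (3 ^ p * (2 ^ n * ((3 / 2) ^ n * β) * E)) *
    2 ^ n / β, by positivity, ?_⟩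
  intro U H x₀ r d ψ hU hH hw h0 hd hr hen hψ hψ01 hψ1 a ha
  set B := ball x₀ (3 * r / 2) with hB
  set μ := (volume : Measure (En n)).restrict B with hμ
  have : IsFiniteMeasure μ := ⟨by rw [Measure.restrict_apply_univ]; exact measure_ball_lt_top⟩
  have hUi : Integrable U μ :=
    (hU.restrict B).integrable (by simpa using ENNReal.ofReal_le_ofReal hp.le)
  have hlogm : AEStronglyMeasurable (fun x => Real.log (U x + d)) μ :=
    ((hU.1.aemeasurable.restrict.add_const d).log).aestronglyMeasurable
  have hlog : Integrable (fun x => Real.log (U x + d)) μ := by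
    refine ((hUi.add (integrable_const (d + |Real.log d|)))).mono' hlogm
      (Eventually.of_forall fun x => ?_)
    have h1 : Real.log d ≤ Real.log (U x + d) := Real.log_le_log hd (by linarith [h0 x])
    have h2 : Real.log (U x + d) ≤ U x + d := (Real.log_le_self (by linarith [h0 x]))
    rw [Real.norm_eq_abs, abs_le, Pi.add_apply]
    constructor
    · linarith [neg_abs_le (Real.log d), h0 x]
    · linarith [abs_nonneg (Real.log d)]
  have hψp : Continuous fun x => ψ x ^ p := hψ.rpow_const fun _ => Or.inr hp0.le
  have hψp0 : ∀ x, 0 ≤ ψ x ^ p := fun x => rpow_nonneg (hψ01 x).1 _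
  have hψp1 : ∀ x, ψ x ^ p ≤ 1 := fun x => rpow_le_one (hψ01 x).1 (hψ01 x).2 hp0.le
  have hψi : Integrable (fun x => ψ x ^ p) μ := (integrable_const (1 : ℝ)).mono'
    hψp.aestronglyMeasurable (Eventually.of_forall fun x => by
      rw [Real.norm_of_nonneg (hψp0 x)]; exact hψp1 x)
  have hW : r ^ n * β ≤ ∫ z, ψ z ^ p ∂μ := by
    calc r ^ n * β = ∫ z in ball x₀ r, (1 : ℝ) := by
          rw [setIntegral_const, volume_real_ball_eq x₀ hr, smul_eq_mul, mul_one]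
      _ = ∫ z in ball x₀ r, ψ z ^ p := setIntegral_congr_fun measurableSet_ball fun z hz => by
          simp only [hψ1 z hz, one_rpow]
      _ ≤ _ := setIntegral_mono_set hψi (Eventually.of_forall hψp0)
          (LE.le.eventuallyLE (ball_subset_ball (by linarith)))
  have hW0 : 0 < ∫ z, ψ z ^ p ∂μ := lt_of_lt_of_le (by positivity) hW
  have key := lintegral_sub_weighted_average_rpow_le hp.le hlog hψp.aestronglyMeasurable hψp0 hψp1
    hW0
  set m := (∫ z, ψ z ^ p * Real.log (U z + d) ∂μ) / ∫ z, ψ z ^ p ∂μ with hm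
  have hμu : μ univ = ENNReal.ofReal ((3 * r / 2) ^ n * β) := by
    rw [Measure.restrict_apply_univ, volume_ball_eq_ofReal x₀ (by positivity)]
  have hvB : volume B = ENNReal.ofReal ((3 * r / 2) ^ n * β) :=
    volume_ball_eq_ofReal x₀ (by positivity)
  have hbd : ∫⁻ x, ‖Real.log (U x + d) - m‖ₑ ^ p ∂μ ≤
      ENNReal.ofReal (((r ^ n * β)⁻¹) ^ p * ((3 * r / 2) ^ n * β) ^ (p - 1) *
        ((2 * (3 * r / 2)) ^ p * (2 ^ n * ((3 * r / 2) ^ n * β) * (E * r ^ ((n : ℝ) - p))))) := by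
    refine key.trans ?_
    rw [ENNReal.ofReal_mul (by positivity), ENNReal.ofReal_mul (by positivity),
      ENNReal.ofReal_mul (by positivity), ENNReal.ofReal_mul (by positivity),
      ← ENNReal.ofReal_rpow_of_nonneg (by positivity) hp0.le,
      ← ENNReal.ofReal_rpow_of_nonneg (by positivity) (by linarith),
      ← ENNReal.ofReal_rpow_of_nonneg (by positivity) hp0.le,
      ENNReal.ofReal_inv_of_pos (by positivity), hμu]
    gcongr
    refine (lintegral_lintegral_log_sub_rpow_le hp.le hU hH hw h0 hd x₀ _).trans ?_
    gcongr
    rw [ENNReal.ofReal_mul (by positivity), hvB]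
    gcongr
    rw [ENNReal.ofReal_pow (by norm_num), ENNReal.ofReal_ofNat]
  have hap : ENNReal.ofReal (a ^ p) ≠ 0 := by simpa using rpow_pos_of_pos ha p
  have hmeas : AEMeasurable (fun x => ‖Real.log (U x + d) - m‖ₑ ^ p) μ :=
    ((hlogm.sub aestronglyMeasurable_const).enorm).pow_const p
  have hcheb := meas_ge_le_lintegral_div hmeas hap ENNReal.ofReal_ne_top
  calc _ = μ {x | a ≤ |Real.log (U x + d) - m|} := by
        rw [Measure.restrict_apply' measurableSet_ball, inter_comm]
    _ ≤ μ {x | ENNReal.ofReal (a ^ p) ≤ ‖Real.log (U x + d) - m‖ₑ ^ p} := by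
        refine measure_mono fun x hx => ?_
        rw [mem_ofPred_eq, ← ENNReal.ofReal_rpow_of_nonneg ha.le hp0.le]
        refine ENNReal.rpow_le_rpow ?_ hp0.le
        rw [← ofReal_norm]
        exact ENNReal.ofReal_le_ofReal hx
    _ ≤ _ := hcheb
    _ ≤ _ := ENNReal.div_le_div_right hbd _
    _ = _ := by
        rw [← ENNReal.ofReal_div_of_pos (by positivity)]
        congr 2
        change _ = _ * volume.real (ball x₀ (r / 2))
        rw [volume_real_ball_eq x₀ (by positivity), ← hβ]
        have e1 : (3 * r / 2) ^ n * β = (3 / 2) ^ n * β * r ^ n := by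
          rw [show 3 * r / 2 = 3 / 2 * r by ring, mul_pow]; ring
        have e2 : ((r ^ n * β)⁻¹) ^ p = (β⁻¹) ^ p * ((r ^ n) ^ p)⁻¹ := by
          rw [mul_inv, mul_rpow (by positivity) (by positivity), inv_rpow (by positivity), mul_comm]
        rw [e1, e2, mul_rpow (by positivity) (by positivity),
          show 2 * (3 * r / 2) = 3 * r by ring, mul_rpow (by norm_num) hr.le,
          rpow_sub hr, rpow_natCast, rpow_sub (by positivity : (0 : ℝ) < r ^ n), rpow_one, div_pow]
        have h1 : (r ^ n) ^ p ≠ 0 := (rpow_pos_of_pos (by positivity) _).ne'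
        have h2 : r ^ p ≠ 0 := (rpow_pos_of_pos hr _).ne'
        field_simp
        rw [div_pow]
        field_simp

end LevelSets

section SobolevCutoff

variable {n : ℕ} {p : ℝ} {u χ : En n → ℝ} {G : En n → En n} {B : Set (En n)}

theorem TestFun.mono {s t : Set (En n)} {φ : En n → ℝ} (hφ : TestFun s φ) (h : s ⊆ t) :
    TestFun t φ := ⟨hφ.1, hφ.2.1, hφ.2.2.trans h⟩

theorem MemW1pLoc.mono {s t : Set (En n)} (hu : MemW1pLoc p u G t) (h : s ⊆ t) :
    MemW1pLoc p u G s :=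
  ⟨fun φ hφ => hu.1 φ (hφ.mono h), fun k hk hks => hu.2 k hk (hks.trans h)⟩

theorem aestronglyMeasurable_of_rpow_abs {μ : Measure (En n)} (hp : 0 < p)
    (hu : AEStronglyMeasurable (fun x => |u x| ^ p) μ) (h0 : ∀ᵐ x ∂μ, 0 ≤ u x) :
    AEStronglyMeasurable u μ := by
  have h : AEStronglyMeasurable (fun x => (|u x| ^ p) ^ p⁻¹) μ :=
    (hu.aemeasurable.pow_const p⁻¹).aestronglyMeasurable
  refine h.congr ?_
  filter_upwards [h0] with x hx
  rw [abs_of_nonneg hx, rpow_rpow_inv hx hp.ne']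

theorem memLp_of_integrable_norm_rpow {F : Type*} [NormedAddCommGroup F] {μ : Measure (En n)}
    {f : En n → F} (hp : 0 < p) (hf : AEStronglyMeasurable f μ)
    (hi : Integrable (fun x => ‖f x‖ ^ p) μ) : MemLp f (ENNReal.ofReal p) μ := by
  rw [← integrable_norm_rpow_iff hf (by simpa using hp) ENNReal.ofReal_ne_top,
    ENNReal.toReal_ofReal hp.le]
  exact hi

theorem MemW1pLoc.memLp_restrict (hp : 0 < p) (hu : MemW1pLoc p u G B) (h0 : ∀ x ∈ B, 0 ≤ u x)
    {K : Set (En n)} (hK : IsCompact K) (hKB : K ⊆ B) :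
    MemLp u (ENNReal.ofReal p) (volume.restrict K) := by
  have h1 := (hu.2 K hK hKB).1
  have h2 : AEStronglyMeasurable u (volume.restrict K) := aestronglyMeasurable_of_rpow_abs hp h1.1
    ((ae_restrict_iff' hK.measurableSet).2 (Filter.Eventually.of_forall fun x hx => h0 x (hKB hx)))
  exact memLp_of_integrable_norm_rpow hp h2 h1

theorem memLp_of_restrict_of_norm_le {F E : Type*} [NormedAddCommGroup F] [NormedAddCommGroup E]
    {K : Set (En n)} {C : ℝ} {g : En n → F} {h : En n → E} {P : ℝ≥0∞} (hK : IsCompact K)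
    (hg : MemLp g P (volume.restrict K)) (hh : AEStronglyMeasurable h (volume.restrict K))
    (hle : ∀ x, ‖h x‖ ≤ C * ‖g x‖) (h0 : ∀ x ∉ K, h x = 0) : MemLp h P volume := by
  have h2 : K.indicator h = h := by
    refine indicator_eq_self.2 fun x hx => ?_
    by_contra hxK
    exact hx (h0 x hxK)
  rw [← h2]
  exact (memLp_indicator_iff_restrict hK.measurableSet).2
    (hg.of_le_mul hh (Filter.Eventually.of_forall hle))

theorem gradient_fun_mul {f g : En n → ℝ} {x : En n} (hf : DifferentiableAt ℝ f x)
    (hg : DifferentiableAt ℝ g x) :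
    gradient (fun x => f x * g x) x = f x • gradient g x + g x • gradient f x := by
  refine gradient_eq_of_hasFDerivAt (hf.hasFDerivAt.mul hg.hasFDerivAt) fun v => ?_
  simp [inner_add_left, inner_smul_left]

theorem gradient_fun_add {f g : En n → ℝ} {x : En n} (hf : DifferentiableAt ℝ f x)
    (hg : DifferentiableAt ℝ g x) :
    gradient (fun x => f x + g x) x = gradient f x + gradient g x := by
  refine gradient_eq_of_hasFDerivAt (hf.hasFDerivAt.add hg.hasFDerivAt) fun v => ?_
  simp [inner_add_left]

theorem gradient_eq_zero_of_notMem_tsupport {f : En n → ℝ} {x : En n} (hx : x ∉ tsupport f) :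
    gradient f x = 0 := by
  have h : f =ᶠ[𝓝 x] fun _ => 0 := by
    filter_upwards [(isClosed_tsupport f).isOpen_compl.mem_nhds hx] with y hy
    exact image_eq_zero_of_notMem_tsupport hy
  rw [← norm_eq_zero, norm_gradient_eq, h.fderiv_eq]
  simp

theorem TestFun.differentiableAt {φ : En n → ℝ} (hφ : TestFun B φ) (x : En n) :
    DifferentiableAt ℝ φ x := hφ.1.differentiable (by simp) x

theorem TestFun.exists_bound {φ : En n → ℝ} (hφ : TestFun B φ) :
    ∃ C, 0 ≤ C ∧ ∀ x, ‖φ x‖ ≤ C ∧ ‖gradient φ x‖ ≤ C := by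
  obtain ⟨C, hC⟩ := (hφ.2.1.isCompact_range hφ.1.continuous).isBounded.exists_norm_le
  have hg : HasCompactSupport (gradient φ) := HasCompactSupport.intro hφ.2.1.isCompact fun x hx =>
    gradient_eq_zero_of_notMem_tsupport hx
  obtain ⟨D, hD⟩ := (hg.isCompact_range (continuous_gradient hφ.1)).isBounded.exists_norm_le
  refine ⟨max C D, le_max_of_le_left ((norm_nonneg _).trans (hC _ ⟨0, rfl⟩)), fun x => ⟨?_, ?_⟩⟩
  · exact (hC _ ⟨x, rfl⟩).trans (le_max_left _ _)
  · exact (hD _ ⟨x, rfl⟩).trans (le_max_right _ _)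

theorem MemW1pLoc.memLp_smul_gradient (hp : 0 < p) (hu : MemW1pLoc p u G B)
    (h0 : ∀ x ∈ B, 0 ≤ u x) (hχ : TestFun B χ) :
    MemLp (fun x => u x • gradient χ x) (ENNReal.ofReal p) volume := by
  have hK : IsCompact (tsupport χ) := hχ.2.1
  have hL := hu.memLp_restrict hp h0 hK hχ.2.2
  obtain ⟨C, -, hC⟩ := hχ.exists_bound
  refine memLp_of_restrict_of_norm_le (C := C) hK hL
    (hL.1.smul (continuous_gradient hχ.1).aestronglyMeasurable) (fun x => ?_) fun x hx => ?_
  · rw [norm_smul, mul_comm]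
    gcongr
    exact (hC x).2
  · rw [gradient_eq_zero_of_notMem_tsupport hx, smul_zero]

theorem MemW1pLoc.memLp_mul (hp : 0 < p) (hu : MemW1pLoc p u G B)
    (h0 : ∀ x ∈ B, 0 ≤ u x) (hχ : TestFun B χ) :
    MemLp (fun x => χ x * u x) (ENNReal.ofReal p) volume := by
  have hK : IsCompact (tsupport χ) := hχ.2.1
  have hL := hu.memLp_restrict hp h0 hK hχ.2.2
  obtain ⟨C, -, hC⟩ := hχ.exists_bound
  refine memLp_of_restrict_of_norm_le (C := C) hK hL
    (hχ.1.continuous.aestronglyMeasurable.mul hL.1) (fun x => ?_) fun x hx => ?_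
  · rw [norm_mul]
    gcongr
    exact (hC x).1
  · rw [image_eq_zero_of_notMem_tsupport hx, zero_mul]

theorem MemW1pLoc.memLp_smul (hp : 0 < p) (hu : MemW1pLoc p u G B) (hχ : TestFun B χ)
    (hG : AEStronglyMeasurable (fun x => χ x • G x) volume) :
    MemLp (fun x => χ x • G x) (ENNReal.ofReal p) volume := by
  have hK : IsCompact (tsupport χ) := hχ.2.1
  obtain ⟨C, -, hC⟩ := hχ.exists_bound
  have hi : Integrable (fun x => (C * ‖G x‖) ^ p) (volume.restrict (tsupport χ)) := by
    have h1 := (hu.2 _ hK hχ.2.2).2.const_mul (C ^ p)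
    refine h1.congr (Filter.Eventually.of_forall fun x => ?_)
    simp only
    rw [mul_rpow ((norm_nonneg _).trans (hC x).1) (norm_nonneg _)]
  have h2 : MemLp (fun x => χ x • G x) (ENNReal.ofReal p) (volume.restrict (tsupport χ)) := by
    refine memLp_of_integrable_norm_rpow hp hG.restrict (hi.mono'
      (hG.restrict.norm.aemeasurable.pow_const p).aestronglyMeasurable
      (Filter.Eventually.of_forall fun x => ?_))
    rw [Real.norm_of_nonneg (by positivity), norm_smul]
    gcongr
    exact (hC x).1
  exact memLp_of_restrict_of_norm_le (C := 1) hK h2 hG.restrict (fun x => by rw [one_mul])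
    fun x hx => by rw [image_eq_zero_of_notMem_tsupport hx, zero_smul]

theorem integrable_smul_of_memLp {F : Type*} [NormedAddCommGroup F] [NormedSpace ℝ F]
    {f : En n → F} {φ : En n → ℝ} (hp : 1 ≤ p) (hf : MemLp f (ENNReal.ofReal p) volume)
    (hφ : Continuous φ) (hc : HasCompactSupport φ) : Integrable (fun x => φ x • f x) :=
  (hf.locallyIntegrable (by simpa using ENNReal.ofReal_le_ofReal hp)).integrable_smul_left_of_hasCompactSupport
    hφ hc

theorem MemW1pLoc.integrable_smul_gradient (hp : 1 ≤ p) (hu : MemW1pLoc p u G B)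
    (h0 : ∀ x ∈ B, 0 ≤ u x) (hχ : TestFun B χ) : Integrable (fun x => u x • gradient χ x) := by
  have h1 := hu.memLp_smul_gradient (by linarith) h0 hχ
  have h2 : IntegrableOn (fun x => u x • gradient χ x) (tsupport χ) :=
    (h1.locallyIntegrable (by simpa using ENNReal.ofReal_le_ofReal hp)).integrableOn_isCompact hχ.2.1
  refine (integrableOn_iff_integrable_of_support_subset fun x hx => ?_).1 h2
  by_contra hxK
  exact hx (by simp only [gradient_eq_zero_of_notMem_tsupport hxK, smul_zero])

/-- Multiplying by a cutoff function turns a local Sobolev function into a global one. -/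
theorem MemW1pLoc.hasWeakGradOn_mul (hp : 1 ≤ p) (hu : MemW1pLoc p u G B)
    (h0 : ∀ x ∈ B, 0 ≤ u x) (hχ : TestFun B χ)
    (hG : AEStronglyMeasurable (fun x => χ x • G x) volume) :
    HasWeakGradOn (fun x => χ x * u x) (fun x => χ x • G x + u x • gradient χ x) univ := by
  have hp0 : 0 < p := by linarith
  intro φ hφ
  have hχφ : TestFun B fun x => χ x * φ x :=
    ⟨hχ.1.mul hφ.1, hχ.2.1.mul_right, (tsupport_mul_subset_left).trans hχ.2.2⟩
  have hmain := hu.1 _ hχφ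
  have i2 : Integrable (fun x => φ x • u x • gradient χ x) :=
    integrable_smul_of_memLp hp (hu.memLp_smul_gradient hp0 h0 hχ) hφ.1.continuous hφ.2.1
  have i3 : Integrable (fun x => φ x • χ x • G x) :=
    integrable_smul_of_memLp hp (hu.memLp_smul hp0 hχ hG) hφ.1.continuous hφ.2.1
  have hgrad : ∀ x, u x • gradient (fun x => χ x * φ x) x
      = (χ x * u x) • gradient φ x + φ x • u x • gradient χ x := fun x => by
    rw [gradient_fun_mul (hχ.differentiableAt x) (hφ.differentiableAt x)]
    module
  have i1 : Integrable (fun x => (χ x * u x) • gradient φ x) := by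
    refine ((hu.integrable_smul_gradient hp h0 hχφ).sub i2).congr
      (Filter.Eventually.of_forall fun x => ?_)
    simp only [Pi.sub_apply, hgrad, add_sub_cancel_right]
  simp only [hgrad] at hmain
  rw [integral_add i1 i2] at hmain
  simp only [smul_add]
  rw [integral_add i3 i2, neg_add, eq_sub_of_add_eq hmain, sub_eq_add_neg]
  simp only [mul_smul, smul_comm (χ _) (φ _)]

/-- If a weak gradient is not measurable, then the Bochner integral convention makes the zero
field a weak gradient. -/
theorem MemW1pLoc.zero_of_not_aestronglyMeasurable (hp : 1 ≤ p) (hu : MemW1pLoc p u G B)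
    (h0 : ∀ x ∈ B, 0 ≤ u x) (hχ : TestFun B χ)
    (hG : ¬ AEStronglyMeasurable (fun x => χ x • G x) volume) : MemW1pLoc p u 0 B := by
  refine ⟨fun φ hφ => ?_, fun k hk hkB => ⟨(hu.2 k hk hkB).1, ?_⟩⟩
  · simp only [Pi.zero_apply, smul_zero, integral_zero, neg_zero]
    by_cases hφG : AEStronglyMeasurable (fun x => φ x • G x) volume
    · have hsum : TestFun B fun x => φ x + χ x :=
        ⟨hφ.1.add hχ.1, hφ.2.1.add hχ.2.1,
          (closure_mono (Function.support_add φ χ)).trans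
            (closure_union.le.trans (union_subset hφ.2.2 hχ.2.2))⟩
      have h1 := hu.1 _ hsum
      have h2 := hu.1 _ hχ
      rw [integral_non_aestronglyMeasurable hG] at h2
      have h3 : ¬ AEStronglyMeasurable (fun x => (φ x + χ x) • G x) volume :=
        fun h => hG ((h.sub hφG).congr (Filter.Eventually.of_forall fun x => by simp [add_smul]))
      rw [integral_non_aestronglyMeasurable h3] at h1
      simp only [gradient_fun_add (hφ.differentiableAt _) (hχ.differentiableAt _), smul_add] at h1
      rw [integral_add (hu.integrable_smul_gradient hp h0 hφ)
        (hu.integrable_smul_gradient hp h0 hχ), h2] at h1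
      simpa using h1
    · rw [hu.1 φ hφ, integral_non_aestronglyMeasurable hφG, neg_zero]
  · simp [zero_rpow (by linarith : p ≠ 0)]

end SobolevCutoff

section NonmeasurableTail

variable {n : ℕ} {p s C₁ C₂ Λ : ℝ} {u φ : En n → ℝ} {B : Set (En n)}

theorem continuous_one_add_norm_rpow (m : ℝ) : Continuous fun y : En n => (1 + ‖y‖) ^ m :=
  (continuous_const.add continuous_norm).rpow_const fun y =>
    Or.inl (show 1 + ‖y‖ ≠ 0 by positivity)

theorem MemTailSpace.aemeasurable_abs (hp : 1 < p) (hu : MemTailSpace p s u) :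
    AEMeasurable (fun x => |u x|) := by
  have h1 : AEMeasurable fun x => |u x| ^ (p - 1) :=
    (hu.aestronglyMeasurable.aemeasurable.mul
      (continuous_one_add_norm_rpow ((n : ℝ) + p * s)).measurable.aemeasurable).congr
      (Filter.Eventually.of_forall fun x => by
        have := norm_nonneg x
        simp only [Pi.mul_apply]
        rw [mul_assoc, ← rpow_add (by positivity), neg_add_cancel, rpow_zero, mul_one])
  refine (h1.pow_const (p - 1)⁻¹).congr (Filter.Eventually.of_forall fun x => ?_)
  simp only
  rw [rpow_rpow_inv (abs_nonneg _) (by linarith)]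

theorem MemTailSpace.integrable_mul (hu : MemTailSpace p s u) (hφ : Continuous φ)
    (hc : HasCompactSupport φ) : Integrable (fun y => φ y * |u y| ^ (p - 1)) := by
  refine (hu.locallyIntegrable.integrable_smul_left_of_hasCompactSupport
    (hφ.mul (continuous_one_add_norm_rpow ((n : ℝ) + p * s))) hc.mul_right).congr
    (Filter.Eventually.of_forall fun x => ?_)
  have := norm_nonneg x
  have h : (1 + ‖x‖) ^ ((n : ℝ) + p * s) * (1 + ‖x‖) ^ (-((n : ℝ) + p * s)) = 1 := by
    rw [← rpow_add (by positivity), add_neg_cancel, rpow_zero]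
  simp only [smul_eq_mul, Pi.mul_apply]
  linear_combination φ x * |u x| ^ (p - 1) * h

theorem abs_Jp_sub_le (hp : 1 < p) (a b : ℝ) :
    |Jp p (a - b)| ≤ 2 ^ (p - 1) * (|a| ^ (p - 1) + |b| ^ (p - 1)) := by
  rw [abs_Jp hp]
  exact (rpow_le_rpow (abs_nonneg _) (abs_sub a b) (by linarith)).trans
    (add_rpow_le_two_rpow (by linarith) (abs_nonneg _) (abs_nonneg _))

theorem Setting.measurable_kernel (S : Setting n p s C₁ C₂ Λ) (x : En n) : Measurable (S.K x) :=
  S.hKmeas.of_uncurry_left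

theorem integrable_Jp_sub_mul (S : Setting n p s C₁ C₂ Λ) (hp : 1 < p) (hs : 0 < s)
    (hu : MemTailSpace p s u) (hum : AEMeasurable u) (hφ : Continuous φ)
    (hc : HasCompactSupport φ) {x : En n} (hx : x ∉ tsupport φ)
    (hK : ∀ᵐ y, S.K x y ≤ Λ * ‖x - y‖ ^ (-((n : ℝ) + p * s))) (t : ℝ) :
    Integrable fun y => Jp p (t - u y) * φ y * S.K x y := by
  obtain ⟨ε, hε, hball⟩ := Metric.isOpen_iff.1 (isClosed_tsupport φ).isOpen_compl x hx
  have hm : 0 < (n : ℝ) + p * s := by positivity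
  have hΛ : 0 < Λ := zero_lt_one.trans_le S.hΛ
  have h1 : Integrable fun y => |φ y| * |u y| ^ (p - 1) :=
    hu.integrable_mul hφ.abs hc.abs
  have h2 : Integrable fun y => |φ y| := hφ.abs.integrable_of_hasCompactSupport hc.abs
  refine (((h2.mul_const (|t| ^ (p - 1))).add h1).const_mul
    (2 ^ (p - 1) * (Λ * ε ^ (-((n : ℝ) + p * s))))).mono' ?_ ?_
  · exact ((((measurable_Jp p).comp_aemeasurable (aemeasurable_const.sub hum)).mul
      hφ.measurable.aemeasurable).mul (S.measurable_kernel x).aemeasurable).aestronglyMeasurable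
  · filter_upwards [hK] with y hy
    simp only [Pi.add_apply, norm_mul, Real.norm_eq_abs]
    by_cases hφy : φ y = 0
    · simp [hφy]
    have hxy : ε ≤ ‖x - y‖ := by
      by_contra! h
      exact hball (mem_ball'.2 (by rwa [dist_eq_norm])) (subset_tsupport φ hφy)
    rw [abs_of_nonneg (S.hKnonneg x y)]
    have hK' : S.K x y ≤ Λ * ε ^ (-((n : ℝ) + p * s)) := hy.trans
      (mul_le_mul_of_nonneg_left (rpow_le_rpow_of_nonpos hε hxy (by linarith)) hΛ.le)
    calc |Jp p (t - u y)| * |φ y| * S.K x y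
        ≤ (2 ^ (p - 1) * (|t| ^ (p - 1) + |u y| ^ (p - 1))) * |φ y|
          * (Λ * ε ^ (-((n : ℝ) + p * s))) := by
          gcongr
          · exact S.hKnonneg x y
          · exact abs_Jp_sub_le hp _ _
      _ = _ := by ring

theorem integral_Jp_sub_mul_lt (S : Setting n p s C₁ C₂ Λ) (hp : 1 < p) (hs : 0 < s)
    (hu : MemTailSpace p s u) (hum : AEMeasurable u) (hφ : Continuous φ)
    (hc : HasCompactSupport φ) (hφ0 : ∀ y, 0 ≤ φ y) (hφne : φ ≠ 0) {x : En n}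
    (hx : x ∉ tsupport φ) (hK : ∀ᵐ y, S.K x y ≤ Λ * ‖x - y‖ ^ (-((n : ℝ) + p * s)))
    (hK' : ∀ᵐ y, Λ⁻¹ * ‖x - y‖ ^ (-((n : ℝ) + p * s)) ≤ S.K x y) {t₁ t₂ : ℝ} (ht : t₁ < t₂) :
    ∫ y, Jp p (t₁ - u y) * φ y * S.K x y < ∫ y, Jp p (t₂ - u y) * φ y * S.K x y := by
  have i1 := integrable_Jp_sub_mul S hp hs hu hum hφ hc hx hK t₁
  have i2 := integrable_Jp_sub_mul S hp hs hu hum hφ hc hx hK t₂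
  have hΛ : 0 < Λ := zero_lt_one.trans_le S.hΛ
  have hJ : ∀ y, 0 < Jp p (t₂ - u y) - Jp p (t₁ - u y) := fun y =>
    sub_pos.2 (strictMono_Jp hp (by linarith))
  rw [← sub_pos, ← integral_sub i2 i1]
  have heq : ∀ y, Jp p (t₂ - u y) * φ y * S.K x y - Jp p (t₁ - u y) * φ y * S.K x y
      = (Jp p (t₂ - u y) - Jp p (t₁ - u y)) * φ y * S.K x y := fun y => by ring
  refine (integral_pos_iff_support_of_nonneg (fun y => ?_) (i2.sub i1)).2 ?_
  rotate_left
  · have hsupp : 0 < volume (Function.support φ) :=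
      (hφ.isOpen_support).measure_pos _ (Function.support_nonempty_iff.2 hφne)
    refine hsupp.trans_le (measure_mono_ae ?_)
    filter_upwards [hK'] with y hy hφy
    have hxy : x - y ≠ 0 := fun h => hx ((sub_eq_zero.1 h) ▸ subset_tsupport φ hφy)
    have hKpos : 0 < S.K x y := by
      refine lt_of_lt_of_le ?_ hy
      have := norm_pos_iff.2 hxy
      positivity
    refine ne_of_gt ?_
    rw [Pi.sub_apply, heq]
    have h1 : 0 < φ y := lt_of_le_of_ne (hφ0 y) (Ne.symm hφy)
    exact mul_pos (mul_pos (hJ y) h1) hKpos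
  · simp only [Pi.zero_apply, Pi.sub_apply, heq]
    exact mul_nonneg (mul_nonneg (hJ y).le (hφ0 y)) (S.hKnonneg x y)

/-- If `u` fails to be measurable outside `B`, the nonlocal term vanishes by the Bochner integral
convention. -/
theorem integral_nonlocal_eq_zero_of_not_aemeasurable (S : Setting n p s C₁ C₂ Λ) (hp : 1 < p)
    (hs : 0 < s) (hu : MemTailSpace p s u) (hB : MeasurableSet B) (h0 : ∀ x ∈ B, 0 ≤ u x)
    (hum : ¬ AEMeasurable u) (hφ : TestFun B φ) (hφ0 : ∀ y, 0 ≤ φ y) :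
    ∫ x, ∫ y, Jp p (u x - u y) * (φ x - φ y) * S.K x y = 0 := by
  by_cases hφne : φ = 0
  · simp [hφne]
  refine integral_non_aestronglyMeasurable fun hI => hum ?_
  have habs := hu.aemeasurable_abs hp
  set w : En n → ℝ := B.indicator fun x => |u x| with hw
  have hwm : AEMeasurable w := habs.indicator hB
  have hwu : ∀ y, φ y ≠ 0 → w y = u y := fun y hy => by
    have hyB : y ∈ B := hφ.2.2 (subset_tsupport φ hy)
    rw [hw, indicator_of_mem hyB, abs_of_nonneg (h0 y hyB)]
  have hwt : MemTailSpace p s w := by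
    refine (Integrable.indicator hu hB).congr (Filter.Eventually.of_forall fun y => ?_)
    by_cases hy : y ∈ B <;> simp [hw, hy, zero_rpow (by linarith : p - 1 ≠ 0)]
  set h : En n → ℝ → ℝ := fun x t => ∫ y, Jp p (t - w y) * φ y * S.K x y with hh
  have hmeas : AEMeasurable fun x => h x |u x| := by
    have h1 : AEStronglyMeasurable
        (fun z : En n × En n => Jp p (|u z.1| - w z.2) * φ z.2 * S.K z.1 z.2)
        (volume.prod volume) :=
      ((((measurable_Jp p).comp_aemeasurable ((habs.comp_fst).sub (hwm.comp_snd))).mul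
        (hφ.1.continuous.measurable.comp measurable_snd).aemeasurable).mul
        S.hKmeas.aemeasurable).aestronglyMeasurable
    exact h1.integral_prod_right'.aemeasurable
  have hI' : AEMeasurable fun x => ∫ y, Jp p (u x - u y) * (φ x - φ y) * S.K x y := hI.aemeasurable
  have hIh : ∀ x ∉ B, ∫ y, Jp p (u x - u y) * (φ x - φ y) * S.K x y = - h x (u x) := by
    intro x hx
    rw [hh, ← integral_neg]
    refine integral_congr_ae (Filter.Eventually.of_forall fun y => ?_)
    have hφx : φ x = 0 := by
      by_contra h
      exact hx (hφ.2.2 (subset_tsupport φ h))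
    by_cases hφy : φ y = 0
    · simp [hφx, hφy]
    · simp only [hφx, hwu y hφy]
      ring
  have hlow := Measure.ae_ae_of_ae_prod S.hKlower
  have hupp := Measure.ae_ae_of_ae_prod S.hKupper
  have hN : NullMeasurableSet {x | u x < 0} := by
    have h1 : NullMeasurableSet ({x | - ∫ y, Jp p (u x - u y) * (φ x - φ y) * S.K x y < h x |u x|}
        ∩ Bᶜ) := (nullMeasurableSet_lt hI'.neg hmeas).inter hB.compl.nullMeasurableSet
    refine h1.congr ?_
    filter_upwards [hlow, hupp] with x hx1 hx2
    refine propext ⟨fun hx => ?_, fun hx => ?_⟩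
    · by_contra hux
      have hx3 : - ∫ y, Jp p (u x - u y) * (φ x - φ y) * S.K x y < h x |u x| := hx.1
      rw [hIh x hx.2, neg_neg, abs_of_nonneg (not_lt.1 hux)] at hx3
      exact lt_irrefl _ hx3
    · have hux : u x < 0 := hx
      have hxB : x ∉ B := fun hxB => (h0 x hxB).not_gt hux
      refine ⟨?_, hxB⟩
      change - ∫ y, Jp p (u x - u y) * (φ x - φ y) * S.K x y < h x |u x|
      rw [hIh x hxB, neg_neg]
      exact integral_Jp_sub_mul_lt S hp hs hwt hwm hφ.1.continuous hφ.2.1 hφ0 hφne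
        (fun hxs => hxB (hφ.2.2 hxs)) hx2 hx1 (by rw [abs_of_neg hux]; linarith)
  refine ((habs.const_mul (-2)).indicator₀ hN |>.add habs).congr
    (Filter.Eventually.of_forall fun x => ?_)
  simp only [Pi.add_apply]
  by_cases hx : u x < 0
  · rw [indicator_of_mem (show x ∈ {x | u x < 0} from hx), abs_of_neg hx]
    ring
  · rw [indicator_of_notMem (show x ∉ {x | u x < 0} from hx), abs_of_nonneg (not_lt.1 hx), zero_add]

end NonmeasurableTail

section GagliardoQuotient

open Filter

variable {n : ℕ} {p s : ℝ} {U : En n → ℝ} {H : En n → En n} {V : ℕ → En n → ℝ}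

/-- A sequence of nonnegative smooth functions converging to `U` in `W^{1,p}` and pointwise. -/
structure IsSmoothApprox (p : ℝ) (V : ℕ → En n → ℝ) (U : En n → ℝ) (H : En n → En n) : Prop where
  contDiff : ∀ k, ContDiff ℝ (⊤ : ℕ∞) (V k)
  nonneg : ∀ k x, 0 ≤ V k x
  memLp_limit : MemLp U (ENNReal.ofReal p) volume
  memLp_grad_limit : MemLp H (ENNReal.ofReal p) volume
  memLp : ∀ k, MemLp (V k) (ENNReal.ofReal p) volume
  memLp_gradient : ∀ k, MemLp (gradient (V k)) (ENNReal.ofReal p) volume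
  tendsto_eLpNorm : Tendsto (fun k => eLpNorm (fun x => V k x - U x) (ENNReal.ofReal p) volume)
    atTop (𝓝 0)
  tendsto_eLpNorm_gradient : Tendsto
    (fun k => eLpNorm (fun x => gradient (V k) x - H x) (ENNReal.ofReal p) volume) atTop (𝓝 0)
  ae_tendsto : ∀ᵐ x, Tendsto (fun k => V k x) atTop (𝓝 (U x))
  ae_tendsto_gradient : ∀ᵐ x, Tendsto (fun k => gradient (V k) x) atTop (𝓝 (H x))

theorem exists_isSmoothApprox (hp : 1 ≤ p) (hU : MemLp U (ENNReal.ofReal p) volume)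
    (hH : MemLp H (ENNReal.ofReal p) volume) (hw : HasWeakGradOn U H univ) (h0 : ∀ x, 0 ≤ U x) :
    ∃ V, IsSmoothApprox p V U H := by
  obtain ⟨V, hV, hV0, hVU, hVH, hae, haeH⟩ := exists_smooth_approx hp hU hH hw h0
  obtain ⟨N, hN⟩ := eventually_atTop.1
    ((hVU.eventually (gt_mem_nhds zero_lt_one)).and (hVH.eventually (gt_mem_nhds zero_lt_one)))
  have hshift : Tendsto (fun k => k + N) atTop atTop := tendsto_add_atTop_nat N
  refine ⟨fun k => V (k + N), fun k => hV _, fun k => hV0 _, hU, hH, fun k => ?_, fun k => ?_,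
    hVU.comp hshift, hVH.comp hshift, ?_, ?_⟩
  · have h1 : MemLp (fun x => V (k + N) x - U x) (ENNReal.ofReal p) volume :=
      ⟨(hV _).continuous.aestronglyMeasurable.sub hU.1,
        (hN _ (Nat.le_add_left N k)).1.trans ENNReal.one_lt_top⟩
    exact (h1.add hU).ae_eq (Eventually.of_forall fun x => by simp)
  · have h1 : MemLp (fun x => gradient (V (k + N)) x - H x) (ENNReal.ofReal p) volume :=
      ⟨(continuous_gradient (hV _)).aestronglyMeasurable.sub hH.1,
        (hN _ (Nat.le_add_left N k)).2.trans ENNReal.one_lt_top⟩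
    exact (h1.add hH).ae_eq (Eventually.of_forall fun x => by simp)
  · filter_upwards [hae] with x hx using hx.comp hshift
  · filter_upwards [haeH] with x hx using hx.comp hshift

/-- The difference quotient whose `L^p` norm is the Gagliardo seminorm. -/
def gaglQuot (n : ℕ) (p s : ℝ) (f : En n → ℝ) (z : En n × En n) : ℝ :=
  |f z.1 - f z.2| * (‖z.1 - z.2‖ ^ (-((n : ℝ) + p * s))) ^ (1 / p)

theorem gaglQuot_nonneg (f : En n → ℝ) (z : En n × En n) : 0 ≤ gaglQuot n p s f z := by
  unfold gaglQuot; positivity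

theorem gaglQuot_rpow (hp : 0 < p) (f : En n → ℝ) (z : En n × En n) :
    gaglQuot n p s f z ^ p = |f z.1 - f z.2| ^ p * ‖z.1 - z.2‖ ^ (-((n : ℝ) + p * s)) := by
  unfold gaglQuot
  rw [mul_rpow (abs_nonneg _) (by positivity), ← rpow_mul (by positivity), one_div,
    inv_mul_cancel₀ hp.ne', rpow_one]

theorem aemeasurable_gaglQuot {f : En n → ℝ} (hf : AEMeasurable f) :
    AEMeasurable (gaglQuot n p s f) (volume.prod volume) :=
  (continuous_abs.measurable.comp_aemeasurable (hf.comp_fst.sub hf.comp_snd)).mul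
    (by fun_prop)

theorem eLpNorm_gaglQuot_rpow (hp : 0 < p) (f : En n → ℝ) :
    eLpNorm (gaglQuot n p s f) (ENNReal.ofReal p) (volume.prod volume) ^ p =
      ∫⁻ z : En n × En n, ‖f z.1 - f z.2‖ₑ ^ p *
        ENNReal.ofReal (‖z.1 - z.2‖ ^ (-((n : ℝ) + p * s))) := by
  rw [← lintegral_enorm_rpow_eq hp, ← Measure.volume_eq_prod]
  refine lintegral_congr fun z => ?_
  rw [Real.enorm_eq_ofReal (gaglQuot_nonneg f z), ENNReal.ofReal_rpow_of_nonneg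
    (gaglQuot_nonneg f z) hp.le, gaglQuot_rpow hp, ENNReal.ofReal_mul (by positivity),
    ← ENNReal.ofReal_rpow_of_nonneg (abs_nonneg _) hp.le, Real.enorm_eq_ofReal_abs]

theorem memLp_gaglQuot (hp : 0 < p) {f : En n → ℝ} (hf : AEMeasurable f)
    (hfin : ∫⁻ z : En n × En n, ‖f z.1 - f z.2‖ₑ ^ p *
        ENNReal.ofReal (‖z.1 - z.2‖ ^ (-((n : ℝ) + p * s))) ≠ ∞) :
    MemLp (gaglQuot n p s f) (ENNReal.ofReal p) (volume.prod volume) := by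
  refine ⟨(aemeasurable_gaglQuot hf).aestronglyMeasurable, lt_top_iff_ne_top.2 fun h => hfin ?_⟩
  rw [← eLpNorm_gaglQuot_rpow hp, h, ENNReal.top_rpow_of_pos hp]

theorem lintegral_ofReal_truncKer {c : ℝ} (hn : 0 < n) (hp : 0 < p) (hs0 : 0 < s) (hs1 : s < 1)
    (hc : 0 ≤ c) : ∫⁻ h : En n, ENNReal.ofReal (truncKer n p s c h)
      = ENNReal.ofReal (∫ h : En n, truncKer n p s c h) :=
  (ofReal_integral_eq_lintegral_ofReal (integrable_truncKer hn hp hs0 hs1 hc)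
    (Eventually.of_forall fun h => truncKer_nonneg hc h)).symm

theorem lintegral_gagliardo_cutoff_le {ω : En n → ℝ} {x₀ : En n} {ρ L : ℝ} (hp : 0 < p)
    (hω0 : ∀ x, 0 ≤ ω x)
    (hω1 : ∀ x, ω x ≤ 1) (hω : ∀ x ∉ ball x₀ ρ, ω x = 0)
    (hLip : ∀ x y, |ω x - ω y| ≤ L * ‖x - y‖) :
    ∫⁻ z : En n × En n, ‖ω z.1 - ω z.2‖ₑ ^ p *
        ENNReal.ofReal (‖z.1 - z.2‖ ^ (-((n : ℝ) + p * s))) ≤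
      2 * volume (ball x₀ ρ) * ∫⁻ h : En n, ENNReal.ofReal (truncKer n p s L h) := by
  have hk : Measurable fun h : En n => ENNReal.ofReal (truncKer n p s L h) := by
    unfold truncKer; fun_prop
  have hk2 : ∀ h : En n, truncKer n p s L (-h) = truncKer n p s L h := fun h => by
    simp [truncKer]
  have hk1 : Measurable fun z : En n × En n => ENNReal.ofReal (truncKer n p s L (z.1 - z.2)) :=
    hk.comp (measurable_fst.sub measurable_snd)
  have hind : Measurable ((ball x₀ ρ).indicator (1 : En n → ℝ≥0∞)) :=
    measurable_one.indicator measurableSet_ball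
  have hF : Measurable fun z : En n × En n => (ball x₀ ρ).indicator (1 : En n → ℝ≥0∞) z.1 *
      ENNReal.ofReal (truncKer n p s L (z.1 - z.2)) := (hind.comp measurable_fst).mul hk1
  have hpt : ∀ z : En n × En n, ‖ω z.1 - ω z.2‖ₑ ^ p *
        ENNReal.ofReal (‖z.1 - z.2‖ ^ (-((n : ℝ) + p * s))) ≤
      (ball x₀ ρ).indicator 1 z.1 * ENNReal.ofReal (truncKer n p s L (z.1 - z.2)) +
      (ball x₀ ρ).indicator 1 z.2 * ENNReal.ofReal (truncKer n p s L (z.1 - z.2)) := by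
    intro z
    have h1 : ‖ω z.1 - ω z.2‖ₑ ^ p * ENNReal.ofReal (‖z.1 - z.2‖ ^ (-((n : ℝ) + p * s)))
        ≤ ENNReal.ofReal (truncKer n p s L (z.1 - z.2)) := by
      rw [Real.enorm_eq_ofReal_abs, ENNReal.ofReal_rpow_of_nonneg (abs_nonneg _) hp.le,
        ← ENNReal.ofReal_mul (by positivity)]
      refine ENNReal.ofReal_le_ofReal ?_
      unfold truncKer
      gcongr
      refine le_min (rpow_le_one (abs_nonneg _) ?_ hp.le)
        (rpow_le_rpow (abs_nonneg _) (hLip _ _) hp.le)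
      exact abs_le.2 ⟨by linarith [hω0 z.1, hω1 z.2], by linarith [hω0 z.2, hω1 z.1]⟩
    by_cases hz1 : z.1 ∈ ball x₀ ρ
    · refine h1.trans (le_self_add.trans' ?_)
      simp [hz1]
    by_cases hz2 : z.2 ∈ ball x₀ ρ
    · refine h1.trans (le_add_self.trans' ?_)
      simp [hz2]
    · simp [hω _ hz1, hω _ hz2, hp]
  have hI1 : ∫⁻ z : En n × En n, (ball x₀ ρ).indicator 1 z.1 *
      ENNReal.ofReal (truncKer n p s L (z.1 - z.2)) ∂(volume.prod volume) =
      volume (ball x₀ ρ) * ∫⁻ h : En n, ENNReal.ofReal (truncKer n p s L h) := by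
    rw [lintegral_prod _ hF.aemeasurable]
    have : ∀ x : En n, ∫⁻ y, (ball x₀ ρ).indicator 1 x *
        ENNReal.ofReal (truncKer n p s L (x - y)) =
        (ball x₀ ρ).indicator 1 x * ∫⁻ h : En n, ENNReal.ofReal (truncKer n p s L h) := fun x => by
      have hkx : Measurable fun y : En n => ENNReal.ofReal (truncKer n p s L (x - y)) :=
        hk.comp (by fun_prop)
      rw [lintegral_const_mul _ hkx,
        lintegral_sub_left_eq_self (fun h => ENNReal.ofReal (truncKer n p s L h)) x]
    simp only [this]
    rw [lintegral_mul_const _ hind, lintegral_indicator_one measurableSet_ball]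
  have hI2 : ∫⁻ z : En n × En n, (ball x₀ ρ).indicator 1 z.2 *
      ENNReal.ofReal (truncKer n p s L (z.1 - z.2)) ∂(volume.prod volume) =
      volume (ball x₀ ρ) * ∫⁻ h : En n, ENNReal.ofReal (truncKer n p s L h) := by
    rw [← hI1, ← lintegral_prod_swap]
    refine lintegral_congr fun z => ?_
    rw [Prod.fst_swap, Prod.snd_swap, ← neg_sub, hk2]
  refine (lintegral_mono hpt).trans (le_of_eq ?_)
  rw [Measure.volume_eq_prod, lintegral_add_left hF, hI1, hI2]
  ring

theorem IsSmoothApprox.memLp_gaglQuot_approx (hV : IsSmoothApprox p V U H)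
    (hn : 0 < n) (hp : 1 ≤ p) (hs0 : 0 < s) (hs1 : s < 1) (k : ℕ) :
    MemLp (gaglQuot n p s (V k)) (ENNReal.ofReal p) (volume.prod volume) := by
  have hp0 : 0 < p := by linarith
  refine memLp_gaglQuot hp0 (hV.contDiff k).continuous.aemeasurable
    (ne_top_of_le_ne_top ?_ (lintegral_gagliardo_le hp (hV.contDiff k)))
  rw [lintegral_ofReal_truncKer hn hp0 hs0 hs1 zero_le_one, lintegral_enorm_rpow_eq hp0,
    lintegral_enorm_rpow_eq hp0]
  have h1 := (hV.memLp k).2.ne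
  have h2 := (hV.memLp_gradient k).2.ne
  finiteness

theorem IsSmoothApprox.lintegral_gagliardo_sub_le (hV : IsSmoothApprox p V U H)
    (hn : 0 < n) (hp : 1 ≤ p) (hs0 : 0 < s) (hs1 : s < 1) (k : ℕ) :
    ∫⁻ z : En n × En n, ‖(V k z.1 - U z.1) - (V k z.2 - U z.2)‖ₑ ^ p *
        ENNReal.ofReal (‖z.1 - z.2‖ ^ (-((n : ℝ) + p * s)))
      ≤ (∫⁻ h : En n, ENNReal.ofReal (truncKer n p s 1 h)) *
        (eLpNorm (fun x => gradient (V k) x - H x) (ENNReal.ofReal p) volume ^ p +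
          2 ^ p * eLpNorm (fun x => V k x - U x) (ENNReal.ofReal p) volume ^ p) := by
  have hp0 : 0 < p := by linarith
  have hP : 1 ≤ ENNReal.ofReal p := by simpa using ENNReal.ofReal_le_ofReal hp
  have htri : ∀ {F : Type} [NormedAddCommGroup F] (f g h : En n → F),
      AEStronglyMeasurable f volume → AEStronglyMeasurable g volume →
      AEStronglyMeasurable h volume → eLpNorm (fun x => f x - g x) (ENNReal.ofReal p) volume ≤
      eLpNorm (fun x => f x - h x) (ENNReal.ofReal p) volume +
        eLpNorm (fun x => g x - h x) (ENNReal.ofReal p) volume := fun f g h hf hg hh => by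
    refine le_trans (le_of_eq ?_) (eLpNorm_sub_le (hf.sub hh) (hg.sub hh) hP)
    congr 1
    ext x
    simp
  refine lintegral_gagliardo_le_of_tendsto hp (W := fun m x => V k x - V m x)
    (W' := fun x => V k x - U x) (fun m => (hV.contDiff k).sub (hV.contDiff m)) ?_
    (fun m => ?_) (fun m => ?_) hV.tendsto_eLpNorm hV.tendsto_eLpNorm_gradient ?_
  · filter_upwards [hV.ae_tendsto] with x hx using hx.const_sub _
  · exact htri _ _ _ (hV.memLp k).1 (hV.memLp m).1 hV.memLp_limit.1
  · have hg : gradient (fun x => V k x - V m x) = fun x => gradient (V k) x - gradient (V m) x := by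
      ext1 x
      refine gradient_eq_of_hasFDerivAt
        (((hV.contDiff k).differentiable (by simp) x).hasFDerivAt.sub
          ((hV.contDiff m).differentiable (by simp) x).hasFDerivAt) fun v => ?_
      simp [inner_sub_left]
    rw [hg]
    exact htri _ _ _ (hV.memLp_gradient k).1 (hV.memLp_gradient m).1 hV.memLp_grad_limit.1
  · rw [lintegral_ofReal_truncKer hn hp0 hs0 hs1 zero_le_one]
    exact ENNReal.ofReal_ne_top

theorem IsSmoothApprox.memLp_gaglQuot_sub (hV : IsSmoothApprox p V U H)
    (hn : 0 < n) (hp : 1 ≤ p) (hs0 : 0 < s) (hs1 : s < 1) (k : ℕ) :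
    MemLp (gaglQuot n p s fun x => V k x - U x) (ENNReal.ofReal p) (volume.prod volume) := by
  have hp0 : 0 < p := by linarith
  have hm := (hV.memLp k).1.aemeasurable.sub hV.memLp_limit.1.aemeasurable
  refine memLp_gaglQuot hp0 hm
    (ne_top_of_le_ne_top ?_ (hV.lintegral_gagliardo_sub_le hn hp hs0 hs1 k))
  rw [lintegral_ofReal_truncKer hn hp0 hs0 hs1 zero_le_one]
  have h1 := ((hV.memLp k).sub hV.memLp_limit).2.ne
  have h2 := ((hV.memLp_gradient k).sub hV.memLp_grad_limit).2.ne
  change eLpNorm (fun x => V k x - U x) _ _ ≠ ∞ at h1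
  change eLpNorm (fun x => gradient (V k) x - H x) _ _ ≠ ∞ at h2
  finiteness

theorem IsSmoothApprox.memLp_gaglQuot_limit (hV : IsSmoothApprox p V U H)
    (hn : 0 < n) (hp : 1 ≤ p) (hs0 : 0 < s) (hs1 : s < 1) :
    MemLp (gaglQuot n p s U) (ENNReal.ofReal p) (volume.prod volume) := by
  refine ((hV.memLp_gaglQuot_approx hn hp hs0 hs1 0).add
    (hV.memLp_gaglQuot_sub hn hp hs0 hs1 0)).mono
    (aemeasurable_gaglQuot hV.memLp_limit.1.aemeasurable).aestronglyMeasurable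
    (Eventually.of_forall fun z => ?_)
  have h1 := gaglQuot_nonneg (p := p) (s := s) U z
  rw [Real.norm_of_nonneg h1, Pi.add_apply, Real.norm_of_nonneg (add_nonneg (gaglQuot_nonneg _ z)
    (gaglQuot_nonneg _ z))]
  unfold gaglQuot
  rw [← add_mul]
  gcongr
  refine (abs_sub _ _).trans' (le_of_eq ?_)
  congr 1
  ring

theorem IsSmoothApprox.tendsto_eLpNorm_gaglQuot (hV : IsSmoothApprox p V U H)
    (hn : 0 < n) (hp : 1 ≤ p) (hs0 : 0 < s) (hs1 : s < 1) :
    Tendsto (fun k => eLpNorm (fun z => gaglQuot n p s (V k) z - gaglQuot n p s U z)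
      (ENNReal.ofReal p) (volume.prod volume)) atTop (𝓝 0) := by
  have hp0 : 0 < p := by linarith
  have hbound : ∀ k, eLpNorm (fun z => gaglQuot n p s (V k) z - gaglQuot n p s U z)
      (ENNReal.ofReal p) (volume.prod volume) ≤
      ((∫⁻ h : En n, ENNReal.ofReal (truncKer n p s 1 h)) *
        (eLpNorm (fun x => gradient (V k) x - H x) (ENNReal.ofReal p) volume ^ p +
          2 ^ p * eLpNorm (fun x => V k x - U x) (ENNReal.ofReal p) volume ^ p)) ^ p⁻¹ := by
    intro k
    refine (eLpNorm_mono fun z => ?_).trans ((ENNReal.le_rpow_inv_iff hp0).2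
      ((eLpNorm_gaglQuot_rpow hp0 fun x => V k x - U x).le.trans
        (hV.lintegral_gagliardo_sub_le hn hp hs0 hs1 k)))
    rw [Real.norm_of_nonneg (gaglQuot_nonneg _ z)]
    unfold gaglQuot
    rw [← sub_mul, norm_mul, Real.norm_of_nonneg (by positivity :
      0 ≤ (‖z.1 - z.2‖ ^ (-((n : ℝ) + p * s))) ^ (1 / p))]
    gcongr
    refine (abs_abs_sub_abs_le _ _).trans (le_of_eq ?_)
    congr 1
    ring
  refine tendsto_of_tendsto_of_tendsto_of_le_of_le tendsto_const_nhds ?_ (fun _ => zero_le) hbound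
  have h0 : ∀ {a : ℕ → ℝ≥0∞} {m : ℝ}, 0 < m → Tendsto a atTop (𝓝 0) →
      Tendsto (fun k => a k ^ m) atTop (𝓝 0) := fun {a m} hm ha => by
    have := ha.ennrpow_const m
    rwa [ENNReal.zero_rpow_of_pos hm] at this
  refine h0 (inv_pos.2 hp0) ?_
  have h1 := (h0 hp0 hV.tendsto_eLpNorm_gradient).add
    (ENNReal.Tendsto.const_mul (a := (2 : ℝ≥0∞) ^ p) (h0 hp0 hV.tendsto_eLpNorm)
      (Or.inr (by finiteness)))
  rw [mul_zero, add_zero] at h1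
  have h2 := ENNReal.Tendsto.const_mul (a := ∫⁻ h : En n, ENNReal.ofReal (truncKer n p s 1 h)) h1
    (Or.inr (by rw [lintegral_ofReal_truncKer hn hp0 hs0 hs1 zero_le_one]
                exact ENNReal.ofReal_ne_top))
  rwa [mul_zero] at h2

end GagliardoQuotient

section NonlocalLimit

open Filter

variable {n : ℕ} {p s C₁ C₂ Λ : ℝ} {u U w : En n → ℝ} {H : En n → En n} {V : ℕ → En n → ℝ}

theorem exists_far_kernel_le (hps : 0 ≤ p * s) (u : En n → ℝ) (x₀ : En n) {ρ₁ ρ₂ : ℝ}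
    (hρ₁ : 0 ≤ ρ₁) (hρ : ρ₁ < ρ₂) :
    ∃ D, 0 ≤ D ∧ ∀ x ∈ ball x₀ ρ₁, ∀ y ∉ ball x₀ ρ₂,
      (|u x| ^ (p - 1) + |u y| ^ (p - 1)) * ‖x - y‖ ^ (-((n : ℝ) + p * s)) ≤
        D * ((|u x| ^ (p - 1) * (1 + ‖x‖) ^ (-((n : ℝ) + p * s))) *
            (1 + ‖y‖) ^ (-((n : ℝ) + p * s)) +
          (1 + ‖x‖) ^ (-((n : ℝ) + p * s)) *
            (|u y| ^ (p - 1) * (1 + ‖y‖) ^ (-((n : ℝ) + p * s)))) := by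
  set m := (n : ℝ) + p * s
  have hm : 0 ≤ m := by positivity
  set A := 1 + ‖x₀‖ + ρ₁ with hA
  have hA0 : 0 < A := by positivity
  set M := A / (ρ₂ - ρ₁) + 1 with hM
  have hM0 : 0 < M := by have := sub_pos.2 hρ; positivity
  refine ⟨A ^ m * M ^ m, by positivity, fun x hx y hy => ?_⟩
  rw [mem_ball, dist_eq_norm] at hx
  rw [mem_ball, dist_eq_norm, not_lt] at hy
  have hxy : ρ₂ - ρ₁ ≤ ‖x - y‖ := by
    have : ‖y - x₀‖ ≤ ‖x - x₀‖ + ‖x - y‖ := by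
      rw [show y - x₀ = (x - x₀) - (x - y) by abel]
      exact norm_sub_le _ _
    linarith
  have hx1 : 1 + ‖x‖ ≤ A := by
    have : ‖x‖ ≤ ‖x - x₀‖ + ‖x₀‖ := by simpa using norm_add_le (x - x₀) x₀
    linarith
  have hy1 : 1 + ‖y‖ ≤ M * ‖x - y‖ := by
    have h1 : ‖y‖ ≤ ‖x‖ + ‖x - y‖ := by
      rw [show y = x - (x - y) by abel]
      simpa using norm_sub_le x (x - y)
    have h2 : A ≤ A / (ρ₂ - ρ₁) * ‖x - y‖ := by
      rw [div_mul_eq_mul_div, le_div_iff₀ (sub_pos.2 hρ)]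
      gcongr
    linarith
  have hxy0 : 0 < ‖x - y‖ := (sub_pos.2 hρ).trans_le hxy
  have hk : ‖x - y‖ ^ (-m) ≤ M ^ m * (1 + ‖y‖) ^ (-m) := by
    have h1 : (M * ‖x - y‖) ^ (-m) ≤ (1 + ‖y‖) ^ (-m) :=
      rpow_le_rpow_of_nonpos (by positivity) hy1 (by linarith)
    rw [mul_rpow hM0.le hxy0.le, rpow_neg hM0.le] at h1
    rwa [inv_mul_le_iff₀ (by positivity)] at h1
  have hAx : 1 ≤ A ^ m * (1 + ‖x‖) ^ (-m) := by
    rw [rpow_neg (by positivity), ← div_eq_mul_inv, le_div_iff₀ (by positivity), one_mul]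
    exact rpow_le_rpow (by positivity) hx1 hm
  calc (|u x| ^ (p - 1) + |u y| ^ (p - 1)) * ‖x - y‖ ^ (-m)
      ≤ (|u x| ^ (p - 1) + |u y| ^ (p - 1)) * (M ^ m * (1 + ‖y‖) ^ (-m)) := by gcongr
    _ = 1 * ((|u x| ^ (p - 1) + |u y| ^ (p - 1)) * (M ^ m * (1 + ‖y‖) ^ (-m))) := (one_mul _).symm
    _ ≤ (A ^ m * (1 + ‖x‖) ^ (-m)) *
        ((|u x| ^ (p - 1) + |u y| ^ (p - 1)) * (M ^ m * (1 + ‖y‖) ^ (-m))) := by gcongr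
    _ = _ := by ring

/-- Passage to the limit in the nonlocal term along smooth approximations. -/
theorem tendsto_integral_nonlocal (S : Setting n p s C₁ C₂ Λ) (hn : 0 < n) (hp : 1 < p)
    (hs0 : 0 < s) (hs1 : s < 1) (hu : MemTailSpace p s u) (hum : AEMeasurable u)
    (hV : IsSmoothApprox p V U H) (hU0 : ∀ x, 0 ≤ U x) {d : ℝ} (hd : 0 < d) {x₀ : En n}
    {ρ₁ ρ₂ L : ℝ} (hρ₁ : 0 ≤ ρ₁) (hρ : ρ₁ < ρ₂) (hUu : ∀ x ∈ ball x₀ ρ₂, U x = u x)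
    (hw : Continuous w) (hw0 : ∀ x, 0 ≤ w x) (hw1 : ∀ x, w x ≤ 1)
    (hwz : ∀ x ∉ ball x₀ ρ₁, w x = 0) (hL : 0 ≤ L) (hLip : ∀ x y, |w x - w y| ≤ L * ‖x - y‖) :
    (∀ k, Integrable (fun z : En n × En n => Jp p (u z.1 - u z.2) *
      (w z.1 * (V k z.1 + d) ^ (1 - p) - w z.2 * (V k z.2 + d) ^ (1 - p)) * S.K z.1 z.2)
      (volume.prod volume)) ∧
    Tendsto (fun k => ∫ z : En n × En n, Jp p (u z.1 - u z.2) *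
      (w z.1 * (V k z.1 + d) ^ (1 - p) - w z.2 * (V k z.2 + d) ^ (1 - p)) * S.K z.1 z.2
      ∂(volume.prod volume)) atTop
      (𝓝 (∫ z : En n × En n, Jp p (u z.1 - u z.2) *
      (w z.1 * (U z.1 + d) ^ (1 - p) - w z.2 * (U z.2 + d) ^ (1 - p)) * S.K z.1 z.2
      ∂(volume.prod volume))) := by
  have hp0 : 0 < p := by linarith
  have hΛ : 0 < Λ := zero_lt_one.trans_le S.hΛ
  have hconj : (p / (p - 1)).HolderConjugate p := (HolderConjugate.conjExponent hp).symm
  obtain ⟨D, hD, hfar⟩ := exists_far_kernel_le (n := n) (p := p) (s := s) (by positivity) u x₀ hρ₁ hρ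
  set m := (n : ℝ) + p * s with hm
  set β : En n → ℝ := fun x => (1 + ‖x‖) ^ (-m) with hβ
  set δ : En n → ℝ := fun x => |u x| ^ (p - 1) * (1 + ‖x‖) ^ (-m) with hδ
  have hβi : Integrable β := by
    refine integrable_one_add_norm ?_
    rw [finrank_euclideanSpace_fin]
    have : 0 < p * s := by positivity
    linarith
  have hβ0 : ∀ x, 0 ≤ β x := fun x => by positivity
  have hδ0 : ∀ x, 0 ≤ δ x := fun x => by positivity
  set E := 2 ^ (p - 1) * d ^ (1 - p) * Λ * D with hE
  have hE0 : 0 ≤ E := by positivity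
  have hdp : ∀ t : ℝ, 0 ≤ t → (t + d) ^ (1 - p) ≤ d ^ (1 - p) := fun t ht =>
    rpow_le_rpow_of_nonpos hd (by linarith) (by linarith)
  have hfar' : ∀ x ∈ ball x₀ ρ₁, ∀ y ∉ ball x₀ ρ₂, ∀ t κ : ℝ, 0 ≤ t → 0 ≤ κ →
      κ ≤ Λ * ‖x - y‖ ^ (-m) →
      |Jp p (u x - u y)| * (w x * (t + d) ^ (1 - p)) * κ ≤ E * (δ x * β y + β x * δ y) := by
    intro x hx y hy t κ ht hκ0 hκ
    have h1 : w x * (t + d) ^ (1 - p) ≤ 1 * d ^ (1 - p) :=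
      mul_le_mul (hw1 x) (hdp t ht) (by positivity) zero_le_one
    calc |Jp p (u x - u y)| * (w x * (t + d) ^ (1 - p)) * κ
        ≤ (2 ^ (p - 1) * (|u x| ^ (p - 1) + |u y| ^ (p - 1))) * (1 * d ^ (1 - p)) *
          (Λ * ‖x - y‖ ^ (-m)) := by
          have := hw0 x
          gcongr
          exact abs_Jp_sub_le hp _ _
      _ = 2 ^ (p - 1) * d ^ (1 - p) * Λ *
          ((|u x| ^ (p - 1) + |u y| ^ (p - 1)) * ‖x - y‖ ^ (-m)) := by ring
      _ ≤ 2 ^ (p - 1) * d ^ (1 - p) * Λ * (D * (δ x * β y + β x * δ y)) := by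
          exact mul_le_mul_of_nonneg_left (hfar x hx y hy) (by positivity)
      _ = _ := by rw [hE]; ring
  have hwg : MemLp (gaglQuot n p s w) (ENNReal.ofReal p) (volume.prod volume) := by
    refine memLp_gaglQuot hp0 hw.aemeasurable (ne_top_of_le_ne_top ?_
      (lintegral_gagliardo_cutoff_le hp0 hw0 hw1 hwz hLip))
    rw [lintegral_ofReal_truncKer hn hp0 hs0 hs1 hL]
    have := measure_ball_lt_top (μ := volume) (x := x₀) (r := ρ₁)
    finiteness
  have hupp : ∀ᵐ z : En n × En n ∂(volume.prod volume), S.K z.1 z.2 ≤ Λ * ‖z.1 - z.2‖ ^ (-m) := by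
    rw [← Measure.volume_eq_prod]
    exact S.hKupper
  have hbmem : ∀ f : En n → ℝ, MemLp (gaglQuot n p s f) (ENNReal.ofReal p) (volume.prod volume) →
      MemLp (fun z => Λ * ((p - 1) * d ^ (-p) * gaglQuot n p s f z +
        d ^ (1 - p) * gaglQuot n p s w z)) (ENNReal.ofReal p) (volume.prod volume) := fun f hf =>
    ((hf.const_mul _).add (hwg.const_mul _)).const_mul _
  have hlim1 := (Measure.quasiMeasurePreserving_fst (μ := (volume : Measure (En n)))
      (ν := (volume : Measure (En n)))).ae hV.ae_tendsto
  have hlim2 := (Measure.quasiMeasurePreserving_snd (μ := (volume : Measure (En n)))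
      (ν := (volume : Measure (En n)))).ae hV.ae_tendsto
  refine tendsto_integral_of_holder_dominated hconj
    (a := fun z => gaglQuot n p s U z ^ (p - 1))
    (b := fun k z => Λ * ((p - 1) * d ^ (-p) * gaglQuot n p s (V k) z +
      d ^ (1 - p) * gaglQuot n p s w z))
    (b₀ := fun z => Λ * ((p - 1) * d ^ (-p) * gaglQuot n p s U z +
      d ^ (1 - p) * gaglQuot n p s w z))
    (e := fun z => E * (δ z.1 * β z.2 + β z.1 * δ z.2)) (fun k => ?_) ?_
    (fun k => hbmem _ (hV.memLp_gaglQuot_approx hn hp.le hs0 hs1 k))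
    (hbmem _ (hV.memLp_gaglQuot_limit hn hp.le hs0 hs1))
    (((hu.mul_prod hβi).add (hβi.mul_prod hu)).const_mul E) (fun k => ?_) ?_ ?_ ?_
  · have hg : Measurable fun x => w x * (V k x + d) ^ (1 - p) :=
      hw.measurable.mul (((hV.contDiff k).continuous.measurable.add_const d).pow_const _)
    exact ((((measurable_Jp p).comp_aemeasurable (hum.comp_fst.sub hum.comp_snd)).mul
      ((hg.comp measurable_fst).sub (hg.comp measurable_snd)).aemeasurable).mul
      S.hKmeas.aemeasurable).aestronglyMeasurable
  · have h1 := (hV.memLp_gaglQuot_limit hn hp.le hs0 hs1).norm_rpow_div (ENNReal.ofReal (p - 1))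
    rw [ENNReal.toReal_ofReal (by linarith), ← ENNReal.ofReal_div_of_pos (by linarith)] at h1
    refine h1.ae_eq (Eventually.of_forall fun z => ?_)
    simp only [Real.norm_of_nonneg (gaglQuot_nonneg U z)]
  · filter_upwards [hupp] with z hz
    obtain ⟨x, y⟩ := z
    simp only at hz ⊢
    have hK0 := S.hKnonneg x y
    have hab : 0 ≤ gaglQuot n p s U (x, y) ^ (p - 1) * (Λ * ((p - 1) * d ^ (-p) *
        gaglQuot n p s (V k) (x, y) + d ^ (1 - p) * gaglQuot n p s w (x, y))) := by
      have h1 := gaglQuot_nonneg (p := p) (s := s) U (x, y)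
      have h2 := gaglQuot_nonneg (p := p) (s := s) (V k) (x, y)
      have h3 := gaglQuot_nonneg (p := p) (s := s) w (x, y)
      have h4 : 0 ≤ p - 1 := by linarith
      positivity
    have he : 0 ≤ E * (δ x * β y + β x * δ y) :=
      mul_nonneg hE0 (add_nonneg (mul_nonneg (hδ0 x) (hβ0 y)) (mul_nonneg (hβ0 x) (hδ0 y)))
    rw [abs_mul, abs_mul, abs_of_nonneg hK0]
    have hsub : ∀ x, x ∉ ball x₀ ρ₂ → w x = 0 := fun x hx =>
      hwz x fun h => hx (ball_subset_ball hρ.le h)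
    have hnn : ∀ x, 0 ≤ w x * (V k x + d) ^ (1 - p) := fun x =>
      mul_nonneg (hw0 x) (rpow_nonneg (by linarith [hV.nonneg k x]) _)
    by_cases hx2 : x ∈ ball x₀ ρ₂
    · by_cases hy2 : y ∈ ball x₀ ρ₂
      · refine le_add_of_le_of_nonneg ?_ he
        rw [abs_Jp hp, ← hUu x hx2, ← hUu y hy2]
        set κ := ‖x - y‖ ^ (-m) with hκ
        have hκ0 : 0 ≤ κ := by positivity
        have hκp : (κ ^ (1 / p)) ^ (p - 1) * κ ^ (1 / p) = κ := by
          rw [← rpow_mul hκ0, ← rpow_add' hκ0]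
          · rw [show 1 / p * (p - 1) + 1 / p = 1 by field_simp; ring, rpow_one]
          · rw [show 1 / p * (p - 1) + 1 / p = 1 by field_simp; ring]
            exact one_ne_zero
        have hdiff := abs_mul_rpow_sub_le hp hd (hV.nonneg k x) (hV.nonneg k y) (hw0 x) (hw1 x)
          (β := w y)
        calc |U x - U y| ^ (p - 1) * |w x * (V k x + d) ^ (1 - p) - w y * (V k y + d) ^ (1 - p)|
              * S.K x y
            ≤ |U x - U y| ^ (p - 1) * ((p - 1) * d ^ (-p) * |V k x - V k y|
              + d ^ (1 - p) * |w x - w y|) * (Λ * κ) := by gcongr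
          _ = |U x - U y| ^ (p - 1) * ((p - 1) * d ^ (-p) * |V k x - V k y|
              + d ^ (1 - p) * |w x - w y|) * (Λ * ((κ ^ (1 / p)) ^ (p - 1) * κ ^ (1 / p))) := by
              rw [hκp]
          _ = _ := by
              unfold gaglQuot
              rw [mul_rpow (abs_nonneg _) (by positivity)]
              simp only [← hm, ← hκ]
              ring
      · refine le_add_of_nonneg_of_le hab ?_
        rw [hsub y hy2, zero_mul, sub_zero, abs_of_nonneg (hnn x)]
        by_cases hx1 : x ∈ ball x₀ ρ₁
        · exact hfar' x hx1 y hy2 _ _ (hV.nonneg k x) hK0 hz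
        · simpa [hwz x hx1] using he
    · refine le_add_of_nonneg_of_le hab ?_
      rw [hsub x hx2, zero_mul, zero_sub, abs_neg, abs_of_nonneg (hnn y)]
      by_cases hy1 : y ∈ ball x₀ ρ₁
      · rw [norm_sub_rev] at hz
        have h1 := hfar' y hy1 x hx2 _ _ (hV.nonneg k y) hK0 hz
        rw [← neg_sub, Jp_neg, abs_neg]
        refine h1.trans (le_of_eq ?_)
        ring
      · simpa [hwz y hy1] using he
  · have h1 := hV.tendsto_eLpNorm_gaglQuot hn hp.le hs0 hs1
    have h2 := ENNReal.Tendsto.const_mul (a := ‖Λ * ((p - 1) * d ^ (-p))‖ₑ) h1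
      (Or.inr enorm_ne_top)
    rw [mul_zero] at h2
    refine h2.congr fun k => ?_
    rw [← eLpNorm_const_smul]
    congr 1
    ext z
    simp only [Pi.smul_apply, smul_eq_mul]
    ring
  · filter_upwards [hlim1, hlim2] with z h1 h2
    exact ((((h1.sub h2).abs.mul_const _).const_mul _).add_const _).const_mul _
  · filter_upwards [hlim1, hlim2] with z h1 h2
    have hpow : ∀ {x : En n}, Tendsto (fun k => V k x) atTop (𝓝 (U x)) →
        Tendsto (fun k => w x * (V k x + d) ^ (1 - p)) atTop (𝓝 (w x * (U x + d) ^ (1 - p))) :=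
      fun {x} hx => ((hx.add_const d).rpow_const (Or.inl (by linarith [hU0 x]))).const_mul _
    exact (((hpow h1).sub (hpow h2)).const_mul _).mul_const _

end NonlocalLimit

section NonlocalBound

open Filter

variable {n : ℕ} {p s C₁ C₂ Λ : ℝ} {u : En n → ℝ}

theorem MemTailSpace.integrable_indicator_nneg (hp : 1 < p) (hs0 : 0 < s)
    (hu : MemTailSpace p s u) (hum : AEMeasurable u) (x₀ : En n) {R : ℝ} (hR : 0 < R) :
    Integrable ((ball x₀ R)ᶜ.indicator fun y =>
      nneg u y ^ (p - 1) * ‖y - x₀‖ ^ (-((n : ℝ) + p * s))) := by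
  set m := (n : ℝ) + p * s with hm
  have hm0 : 0 ≤ m := by positivity
  set M := (1 + ‖x₀‖) / R + 1 with hM
  have hM0 : 0 < M := by positivity
  have hmeas : AEMeasurable (fun y => nneg u y ^ (p - 1) * ‖y - x₀‖ ^ (-m)) := by
    have : AEMeasurable (nneg u) := hum.neg.max aemeasurable_const
    exact (this.pow_const _).mul (by fun_prop)
  refine Integrable.mono' (hu.const_mul (M ^ m))
    (hmeas.indicator measurableSet_ball.compl).aestronglyMeasurable (Eventually.of_forall fun y => ?_)
  by_cases hy : y ∈ ball x₀ R
  · rw [indicator_of_notMem (by simpa using hy), norm_zero]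
    positivity
  rw [indicator_of_mem (by simpa using hy)]
  have hyR : R ≤ ‖y - x₀‖ := by simpa [dist_eq_norm] using hy
  have hn0 : 0 ≤ nneg u y := le_max_right _ _
  rw [Real.norm_of_nonneg (by positivity)]
  have h1 : nneg u y ≤ |u y| := max_le (neg_le_abs _) (abs_nonneg _)
  have h2 : 1 + ‖y‖ ≤ M * ‖y - x₀‖ := by
    have h3 : ‖y‖ ≤ ‖y - x₀‖ + ‖x₀‖ := by simpa using norm_add_le (y - x₀) x₀
    have h4 : 1 + ‖x₀‖ ≤ (1 + ‖x₀‖) / R * ‖y - x₀‖ := by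
      rw [div_mul_eq_mul_div, le_div_iff₀ hR]
      gcongr
    rw [hM]
    linarith
  have h5 : ‖y - x₀‖ ^ (-m) ≤ M ^ m * (1 + ‖y‖) ^ (-m) := by
    have h6 : (M * ‖y - x₀‖) ^ (-m) ≤ (1 + ‖y‖) ^ (-m) :=
      rpow_le_rpow_of_nonpos (by positivity) h2 (by linarith)
    calc ‖y - x₀‖ ^ (-m) = M ^ m * (M * ‖y - x₀‖) ^ (-m) := by
          rw [mul_rpow hM0.le (norm_nonneg _), ← mul_assoc, ← rpow_add hM0, add_neg_cancel,
            rpow_zero, one_mul]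
      _ ≤ _ := by gcongr
  calc nneg u y ^ (p - 1) * ‖y - x₀‖ ^ (-m)
      ≤ |u y| ^ (p - 1) * (M ^ m * (1 + ‖y‖) ^ (-m)) :=
        mul_le_mul (rpow_le_rpow hn0 h1 (by linarith)) h5 (by positivity) (by positivity)
    _ = _ := by ring

/-- Upper bound for the nonlocal term tested against `ω ^ p * (U + d) ^ (1 - p)`. -/
theorem integral_nonlocal_le (S : Setting n p s C₁ C₂ Λ) (hn : 0 < n) (hp : 1 < p)
    (hs0 : 0 < s) (hs1 : s < 1) (hu : MemTailSpace p s u) (hum : AEMeasurable u)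
    {U ω : En n → ℝ} {d r R c : ℝ} {x₀ : En n} (hd : 0 < d) (hr : 0 < r) (hr1 : r ≤ 1)
    (hrR : r < R / 2) (hu0 : ∀ x ∈ ball x₀ R, 0 ≤ u x)
    (hUu : ∀ x ∈ ball x₀ (7 / 4 * r), U x = u x) (hc : 0 ≤ c) (hωc : Continuous ω)
    (hω0 : ∀ x, 0 ≤ ω x) (hω1 : ∀ x, ω x ≤ 1) (hωz : ∀ x ∉ ball x₀ (7 / 4 * r), ω x = 0)
    (hLip : ∀ x y, |ω x - ω y| ≤ c / r * ‖x - y‖)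
    (htail : d ^ (1 - p) * ∫ y in (ball x₀ R)ᶜ,
      nneg u y ^ (p - 1) * ‖y - x₀‖ ^ (-((n : ℝ) + p * s)) ≤ r ^ (-p)) :
    ∫ z : En n × En n, Jp p (u z.1 - u z.2) *
      (ω z.1 ^ p * (U z.1 + d) ^ (1 - p) - ω z.2 ^ p * (U z.2 + d) ^ (1 - p)) * S.K z.1 z.2
      ∂(volume.prod volume) ≤
    Λ * (2 ^ p * (2 * ((7 / 4) ^ n * volume.real (ball (0 : En n) 1)) *
      ((∫ h : En n, truncKer n p s c h) + 8 ^ ((n : ℝ) + p * s)))) * r ^ ((n : ℝ) - p) := by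
  have hp0 : 0 < p := by linarith
  have hΛ : 0 < Λ := zero_lt_one.trans_le S.hΛ
  have hR : 0 < R := by linarith
  have hInt := hu.integrable_indicator_nneg hp hs0 hum x₀ hR
  rw [← integral_indicator measurableSet_ball.compl] at htail
  set m := (n : ℝ) + p * s with hm
  have hm0 : 0 ≤ m := by positivity
  set τ : En n → ℝ := (ball x₀ R)ᶜ.indicator fun y => nneg u y ^ (p - 1) * ‖y - x₀‖ ^ (-m) with hτ
  have hτ0 : ∀ y, 0 ≤ τ y := fun y => indicator_nonneg (fun y _ =>
    mul_nonneg (rpow_nonneg (le_max_right _ _) _) (by positivity)) y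
  set B := ball x₀ (7 / 4 * r) with hB
  set ι : En n → ℝ := B.indicator 1 with hι
  have hι0 : ∀ x, 0 ≤ ι x := fun x => indicator_nonneg (fun _ _ => zero_le_one) x
  have hιi : Integrable ι := (integrable_indicator_iff measurableSet_ball).2
    (integrableOn_const measure_ball_lt_top.ne)
  have hιI : ∫ x, ι x = (7 / 4) ^ n * volume.real (ball (0 : En n) 1) * r ^ (n : ℝ) := by
    rw [hι, integral_indicator_one measurableSet_ball, volume_real_ball_eq x₀ (by positivity),
      mul_pow, rpow_natCast]
    ring
  set b := (7 / 4) ^ n * volume.real (ball (0 : En n) 1) with hb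
  have hb0 : 0 ≤ b := by positivity
  set I := ∫ h : En n, truncKer n p s c h with hI
  have hI0 : 0 ≤ I := integral_nonneg fun h => truncKer_nonneg hc h
  have hrp : r ^ (n : ℝ) * r ^ (-p) = r ^ ((n : ℝ) - p) := by
    rw [← rpow_add hr, sub_eq_add_neg]
  have hlint := lintegral_gagliardo_cutoff_le (s := s) hp0 hω0 hω1 hωz hLip
  rw [lintegral_ofReal_truncKer hn hp0 hs0 hs1 (by positivity), integral_truncKer_div hr,
    volume_ball_eq_ofReal x₀ (by positivity)] at hlint
  have hgI : Integrable (fun z => gaglQuot n p s ω z ^ p) (volume.prod volume) := by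
    have h1 := (memLp_gaglQuot hp0 hωc.aemeasurable
      (ne_top_of_le_ne_top (by finiteness) hlint)).integrable_norm_rpow
      (by simpa using hp0) ENNReal.ofReal_ne_top
    rw [ENNReal.toReal_ofReal hp0.le] at h1
    refine h1.congr (Eventually.of_forall fun z => ?_)
    simp only [Real.norm_of_nonneg (gaglQuot_nonneg ω z)]
  have hgle : ∫ z, gaglQuot n p s ω z ^ p ∂(volume.prod volume) ≤
      2 * b * I * r ^ ((n : ℝ) - p) := by
    have h1 : ENNReal.ofReal (∫ z, gaglQuot n p s ω z ^ p ∂(volume.prod volume)) ≤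
        ENNReal.ofReal (2 * b * r ^ (n : ℝ) * (r ^ (-(p * s)) * I)) := by
      rw [ofReal_integral_eq_lintegral_ofReal hgI
        (Eventually.of_forall fun z => rpow_nonneg (gaglQuot_nonneg ω z) p)]
      refine le_trans (le_of_eq ?_) (hlint.trans (le_of_eq ?_))
      · rw [← Measure.volume_eq_prod]
        refine lintegral_congr fun z => ?_
        rw [gaglQuot_rpow hp0, ENNReal.ofReal_mul (by positivity),
          ← ENNReal.ofReal_rpow_of_nonneg (abs_nonneg _) hp0.le, ← ofReal_norm,
          Real.norm_eq_abs]
      · rw [show 2 * b * r ^ (n : ℝ) = 2 * ((7 / 4 * r) ^ n * volume.real (ball (0 : En n) 1)) by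
            rw [mul_pow, rpow_natCast, hb]; ring,
          ENNReal.ofReal_mul (q := r ^ (-(p * s)) * I) (by positivity),
          ENNReal.ofReal_mul zero_le_two, ENNReal.ofReal_ofNat]
    rw [ENNReal.ofReal_le_ofReal_iff (by positivity)] at h1
    have h2 : r ^ (-(p * s)) ≤ r ^ (-p) :=
      rpow_le_rpow_of_exponent_ge hr hr1 (by nlinarith)
    calc _ ≤ 2 * b * r ^ (n : ℝ) * (r ^ (-(p * s)) * I) := h1
      _ ≤ 2 * b * r ^ (n : ℝ) * (r ^ (-p) * I) := by gcongr
      _ = 2 * b * I * (r ^ (n : ℝ) * r ^ (-p)) := by ring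
      _ = _ := by rw [hrp]
  set g : En n × En n → ℝ := fun z => Λ * (2 ^ p * (gaglQuot n p s ω z ^ p +
    8 ^ m * d ^ (1 - p) * (ι z.1 * τ z.2 + τ z.1 * ι z.2))) with hg
  have hTi : Integrable (fun z : En n × En n => ι z.1 * τ z.2 + τ z.1 * ι z.2)
      (volume.prod volume) := (hιi.mul_prod hInt).add (hInt.mul_prod hιi)
  have hgi : Integrable g (volume.prod volume) :=
    ((hgI.add (hTi.const_mul _)).const_mul _).const_mul _
  have hg0 : ∀ z, 0 ≤ g z := fun z => by
    have h1 := rpow_nonneg (gaglQuot_nonneg (n := n) (p := p) (s := s) ω z) p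
    have h2 := mul_nonneg (hι0 z.1) (hτ0 z.2)
    have h3 := mul_nonneg (hτ0 z.1) (hι0 z.2)
    positivity
  have hgint : ∫ z, g z ∂(volume.prod volume) ≤
      Λ * (2 ^ p * (2 * b * (I + 8 ^ m))) * r ^ ((n : ℝ) - p) := by
    rw [hg, integral_const_mul, integral_const_mul, integral_add hgI (hTi.const_mul _),
      integral_const_mul, integral_add (hιi.mul_prod hInt) (hInt.mul_prod hιi),
      integral_prod_mul, integral_prod_mul, hιI]
    calc _ ≤ Λ * (2 ^ p * (2 * b * I * r ^ ((n : ℝ) - p) +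
          2 * 8 ^ m * b * r ^ (n : ℝ) * r ^ (-p))) := by
          have : 8 ^ m * d ^ (1 - p) * (b * r ^ (n : ℝ) * (∫ y, τ y) +
              (∫ y, τ y) * (b * r ^ (n : ℝ))) =
              2 * 8 ^ m * b * r ^ (n : ℝ) * (d ^ (1 - p) * ∫ y, τ y) := by ring
          rw [this]
          gcongr
      _ = Λ * (2 ^ p * (2 * b * I * r ^ ((n : ℝ) - p) +
          2 * 8 ^ m * b * (r ^ (n : ℝ) * r ^ (-p)))) := by ring
      _ = _ := by rw [hrp]; ring
  refine le_trans ?_ hgint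
  have hBR : B ⊆ ball x₀ R := ball_subset_ball (by linarith)
  have hker : ∀ x ∈ B, ∀ y, (max (-(u y)) 0) ^ (p - 1) * ‖x - y‖ ^ (-m) ≤ 8 ^ m * τ y := by
    intro x hx y
    by_cases hy : y ∈ ball x₀ R
    · rw [max_eq_right (by linarith [hu0 y hy]), zero_rpow (by linarith), zero_mul]
      exact mul_nonneg (by positivity) (hτ0 y)
    · rw [hτ, indicator_of_mem (by simpa using hy)]
      have hyR : R ≤ ‖y - x₀‖ := by simpa [dist_eq_norm] using hy
      have hxr : ‖x - x₀‖ < 7 / 4 * r := by simpa [hB, dist_eq_norm] using hx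
      have h1 : ‖y - x₀‖ ≤ ‖x - y‖ + ‖x - x₀‖ := by
        rw [norm_sub_rev x y]; simpa using norm_add_le (y - x) (x - x₀)
      have h2 : ‖y - x₀‖ / 8 ≤ ‖x - y‖ := by linarith
      have h3 : ‖x - y‖ ^ (-m) ≤ (‖y - x₀‖ / 8) ^ (-m) :=
        rpow_le_rpow_of_nonpos (by linarith) h2 (by linarith)
      have h4 : (‖y - x₀‖ / 8) ^ (-m) = 8 ^ m * ‖y - x₀‖ ^ (-m) := by
        rw [div_rpow (norm_nonneg _) (by norm_num), rpow_neg (by norm_num : (0 : ℝ) ≤ 8),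
          div_inv_eq_mul, mul_comm]
      rw [h4] at h3
      have h5 : 0 ≤ (max (-(u y)) 0) ^ (p - 1) := rpow_nonneg (le_max_right _ _) _
      calc _ ≤ (max (-(u y)) 0) ^ (p - 1) * (8 ^ m * ‖y - x₀‖ ^ (-m)) := by gcongr
        _ = _ := by rw [nneg]; ring
  have hker' : ∀ x y, ω x ^ p * (max (-(u y)) 0) ^ (p - 1) * ‖x - y‖ ^ (-m) ≤
      8 ^ m * (ι x * τ y) := by
    intro x y
    by_cases hx : x ∈ B
    · have h1 := hker x hx y
      have h2 : ω x ^ p ≤ 1 := rpow_le_one (hω0 x) (hω1 x) hp0.le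
      have h5 : 0 ≤ (max (-(u y)) 0) ^ (p - 1) := rpow_nonneg (le_max_right _ _) _
      rw [hι, indicator_of_mem hx, Pi.one_apply, one_mul, mul_assoc]
      refine (mul_le_mul_of_nonneg_right h2 (by positivity)).trans ?_
      rwa [one_mul]
    · rw [hωz x hx, zero_rpow hp0.ne', zero_mul, zero_mul]
      exact mul_nonneg (by positivity) (mul_nonneg (hι0 x) (hτ0 y))
  have hneg : ∀ x, u x < 0 → ω x = 0 := fun x hx => by
    by_contra h
    have hxB : x ∈ B := by
      by_contra h'
      exact h (hωz x h')
    linarith [hu0 x (hBR hxB)]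
  have hωU : ∀ x, ω x ^ p * (U x + d) ^ (1 - p) = ω x ^ p * (u x + d) ^ (1 - p) := fun x => by
    by_cases hx : x ∈ B
    · rw [hUu x hx]
    · rw [hωz x hx, zero_rpow hp0.ne', zero_mul, zero_mul]
  by_cases hFi : Integrable (fun z : En n × En n => Jp p (u z.1 - u z.2) *
      (ω z.1 ^ p * (U z.1 + d) ^ (1 - p) - ω z.2 ^ p * (U z.2 + d) ^ (1 - p)) * S.K z.1 z.2)
      (volume.prod volume)
  · refine integral_mono_ae hFi hgi ?_
    have hupp : ∀ᵐ z : En n × En n ∂(volume.prod volume),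
        S.K z.1 z.2 ≤ Λ * ‖z.1 - z.2‖ ^ (-m) := by
      rw [← Measure.volume_eq_prod]
      exact S.hKupper
    filter_upwards [hupp] with z hz
    obtain ⟨x, y⟩ := z
    simp only [hg, gaglQuot_rpow hp0, hωU, ← hm] at hz ⊢
    have hJ := Jp_mul_sub_le hp hd (hω0 x) (hω0 y) (hneg x) (hneg y)
    have hx0 : 0 ≤ (max (-(u x)) 0) ^ (p - 1) := rpow_nonneg (le_max_right _ _) _
    have hy0 : 0 ≤ (max (-(u y)) 0) ^ (p - 1) := rpow_nonneg (le_max_right _ _) _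
    have hωx := rpow_nonneg (hω0 x) p
    have hωy := rpow_nonneg (hω0 y) p
    have h1 := hker' x y
    have h2 := hker' y x
    rw [norm_sub_rev y x] at h2
    calc _ ≤ 2 ^ p * (|ω x - ω y| ^ p + ω x ^ p * d ^ (1 - p) * (max (-(u y)) 0) ^ (p - 1) +
          ω y ^ p * d ^ (1 - p) * (max (-(u x)) 0) ^ (p - 1)) * (Λ * ‖x - y‖ ^ (-m)) :=
          mul_le_mul hJ hz (S.hKnonneg x y) (by positivity)
      _ = Λ * (2 ^ p * (|ω x - ω y| ^ p * ‖x - y‖ ^ (-m) + d ^ (1 - p) *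
          (ω x ^ p * (max (-(u y)) 0) ^ (p - 1) * ‖x - y‖ ^ (-m) +
          ω y ^ p * (max (-(u x)) 0) ^ (p - 1) * ‖x - y‖ ^ (-m)))) := by ring
      _ ≤ Λ * (2 ^ p * (|ω x - ω y| ^ p * ‖x - y‖ ^ (-m) + d ^ (1 - p) *
          (8 ^ m * (ι x * τ y) + 8 ^ m * (ι y * τ x)))) := by gcongr
      _ = _ := by ring
  · rw [integral_undef hFi]
    exact integral_nonneg hg0

end NonlocalBound

section LocalTerm

open Filter

variable {n : ℕ} {p s C₁ C₂ Λ d ρ₁ ρ₂ : ℝ} {U w : En n → ℝ} {G H : En n → En n}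
  {V : ℕ → En n → ℝ} {x₀ : En n}

theorem testFun_mul_rpow {v : En n → ℝ} {B : Set (En n)} (hw : ContDiff ℝ (⊤ : ℕ∞) w)
    (hwz : ∀ x ∉ ball x₀ ρ₁, w x = 0) (hB : closedBall x₀ ρ₁ ⊆ B)
    (hv : ContDiff ℝ (⊤ : ℕ∞) v) (hv0 : ∀ x, 0 ≤ v x) (hd : 0 < d) (t : ℝ) :
    TestFun B fun x => w x * (v x + d) ^ t := by
  have hz : ∀ x ∉ closedBall x₀ ρ₁, w x * (v x + d) ^ t = 0 := fun x hx => by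
    rw [hwz x fun h => hx (ball_subset_closedBall h), zero_mul]
  refine ⟨hw.mul ((hv.add contDiff_const).rpow_const_of_ne fun x => ?_),
    HasCompactSupport.intro (isCompact_closedBall x₀ ρ₁) hz, Subset.trans ?_ hB⟩
  · linarith [hv0 x]
  · refine closure_minimal (fun x hx => ?_) isClosed_closedBall
    by_contra h
    exact hx (hz x h)

theorem gradient_mul_rpow {v : En n → ℝ} {x : En n} (hw : DifferentiableAt ℝ w x)
    (hv : DifferentiableAt ℝ v x) (hv0 : 0 ≤ v x) (hd : 0 < d) :
    gradient (fun x => w x * (v x + d) ^ (1 - p)) x =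
      (w x * ((1 - p) * (v x + d) ^ (-p))) • gradient v x + (v x + d) ^ (1 - p) • gradient w x := by
  have h1 : HasFDerivAt (fun x => (v x + d) ^ (1 - p))
      (((1 - p) * (v x + d) ^ (1 - p - 1)) • fderiv ℝ v x) x :=
    (hv.hasFDerivAt.add_const d).rpow_const (Or.inl (by linarith))
  refine gradient_eq_of_hasFDerivAt (hw.hasFDerivAt.mul h1) fun y => ?_
  rw [show 1 - p - 1 = -p by ring]
  simp [inner_add_left, inner_smul_left]
  ring

/-- A Carathéodory function composed with a measurable map is measurable. -/
theorem Setting.aestronglyMeasurable_comp (S : Setting n p s C₁ C₂ Λ)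
    (hH : AEStronglyMeasurable H volume) :
    AEStronglyMeasurable (fun x => S.A x (H x)) volume := by
  have h1 : StronglyMeasurable (Function.uncurry fun ξ x => S.A x ξ) :=
    stronglyMeasurable_uncurry_of_continuous_of_stronglyMeasurable S.hAcont
      fun ξ => (S.hAmeas ξ).stronglyMeasurable
  have h2 : Measurable fun x => (hH.mk H x, x) := hH.stronglyMeasurable_mk.measurable.prodMk
    measurable_id
  refine ⟨_, h1.comp_measurable h2, ?_⟩
  filter_upwards [hH.ae_eq_mk] with x hx
  simp [Function.uncurry, ← hx]

theorem Setting.memLp_indicator_comp (S : Setting n p s C₁ C₂ Λ) (hp : 1 < p)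
    (hH : MemLp H (ENNReal.ofReal p) volume) {B : Set (En n)} (hB : MeasurableSet B)
    (hBΩ : B ⊆ S.Ω) :
    MemLp (fun x => ‖B.indicator (fun x => S.A x (H x)) x‖) (ENNReal.ofReal (p / (p - 1)))
      volume := by
  have h1 := (hH.norm_rpow_div (ENNReal.ofReal (p - 1))).const_mul C₂
  rw [ENNReal.toReal_ofReal (by linarith), ← ENNReal.ofReal_div_of_pos (by linarith)] at h1
  refine h1.mono' ((S.aestronglyMeasurable_comp hH.1).indicator hB).norm ?_
  filter_upwards [S.hAgrowth] with x hx
  rw [norm_norm]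
  by_cases hxB : x ∈ B
  · rw [indicator_of_mem hxB]
    exact hx (hBΩ hxB) _
  · rw [indicator_of_notMem hxB, norm_zero]
    have := S.hC₂
    positivity

theorem abs_inner_test_le {ζ η γ : En n} {a t : ℝ} (hp : 1 < p) (hd : 0 < d) (ha0 : 0 ≤ a)
    (ha1 : a ≤ 1) (ht : 0 ≤ t) :
    |⟪ζ, (a * ((1 - p) * (t + d) ^ (-p))) • η + (t + d) ^ (1 - p) • γ⟫| ≤
      ‖ζ‖ * ((p - 1) * d ^ (-p) * ‖η‖ + d ^ (1 - p) * ‖γ‖) := by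
  refine (abs_real_inner_le_norm _ _).trans (mul_le_mul_of_nonneg_left ?_ (norm_nonneg _))
  have h1 : (t + d) ^ (-p) ≤ d ^ (-p) := rpow_le_rpow_of_nonpos hd (by linarith) (by linarith)
  have h2 : (t + d) ^ (1 - p) ≤ d ^ (1 - p) :=
    rpow_le_rpow_of_nonpos hd (by linarith) (by linarith)
  have h3 : 0 ≤ p - 1 := by linarith
  refine (norm_add_le _ _).trans (add_le_add ?_ ?_)
  · rw [norm_smul, Real.norm_eq_abs, abs_mul, abs_mul, abs_of_nonneg ha0, abs_sub_comm,
      abs_of_nonneg h3, abs_of_nonneg (by positivity)]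
    refine mul_le_mul_of_nonneg_right ?_ (norm_nonneg _)
    calc a * ((p - 1) * (t + d) ^ (-p)) ≤ 1 * ((p - 1) * d ^ (-p)) := by gcongr
      _ = _ := one_mul _
  · rw [norm_smul, Real.norm_of_nonneg (by positivity)]
    gcongr

/-- Passage to the limit in the local term along smooth approximations. -/
theorem tendsto_integral_local (S : Setting n p s C₁ C₂ Λ) (hp : 1 < p)
    (hV : IsSmoothApprox p V U H) (hU0 : ∀ x, 0 ≤ U x) (hd : 0 < d)
    (hρΩ : closedBall x₀ ρ₁ ⊆ S.Ω) (hHG : ∀ x ∈ closedBall x₀ ρ₁, H x = G x)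
    (hw : ContDiff ℝ (⊤ : ℕ∞) w) (hw0 : ∀ x, 0 ≤ w x) (hw1 : ∀ x, w x ≤ 1)
    (hwz : ∀ x ∉ ball x₀ ρ₁, w x = 0) :
    Integrable (fun x => ⟪(closedBall x₀ ρ₁).indicator (fun x => S.A x (H x)) x,
      (w x * ((1 - p) * (U x + d) ^ (-p))) • H x + (U x + d) ^ (1 - p) • gradient w x⟫) ∧
    Tendsto (fun k => ∫ x, ⟪S.A x (G x), gradient (fun x => w x * (V k x + d) ^ (1 - p)) x⟫)
      atTop (𝓝 (∫ x, ⟪(closedBall x₀ ρ₁).indicator (fun x => S.A x (H x)) x,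
        (w x * ((1 - p) * (U x + d) ^ (-p))) • H x + (U x + d) ^ (1 - p) • gradient w x⟫)) := by
  have hp1 : 1 ≤ ENNReal.ofReal p := by simpa using ENNReal.ofReal_le_ofReal hp.le
  have hconj : (p / (p - 1)).HolderConjugate p := (HolderConjugate.conjExponent hp).symm
  set 𝒜 := (closedBall x₀ ρ₁).indicator fun x => S.A x (H x) with h𝒜
  have hwT : TestFun univ w := by
    simpa using testFun_mul_rpow hw hwz (subset_univ _) (contDiff_const (c := (0 : ℝ)))
      (fun _ => le_rfl) one_pos 0
  have hgc : HasCompactSupport (gradient w) := HasCompactSupport.intro hwT.2.1.isCompact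
    fun x hx => gradient_eq_zero_of_notMem_tsupport hx
  have hgw : MemLp (fun x => ‖gradient w x‖) (ENNReal.ofReal p) volume :=
    ((continuous_gradient hw).memLp_of_hasCompactSupport hgc).norm
  have ha := S.memLp_indicator_comp hp hV.memLp_grad_limit measurableSet_closedBall hρΩ
  have h𝒜m : AEStronglyMeasurable 𝒜 volume :=
    (S.aestronglyMeasurable_comp hV.memLp_grad_limit.1).indicator measurableSet_closedBall
  have hbm : ∀ g : En n → En n, MemLp g (ENNReal.ofReal p) volume →
      MemLp (fun x => (p - 1) * d ^ (-p) * ‖g x‖ + d ^ (1 - p) * ‖gradient w x‖)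
        (ENNReal.ofReal p) volume := fun g hg => (hg.norm.const_mul _).add (hgw.const_mul _)
  have hfm : ∀ (v : En n → ℝ) (g : En n → En n), AEStronglyMeasurable v volume →
      AEStronglyMeasurable g volume → AEStronglyMeasurable (fun x => ⟪𝒜 x,
        (w x * ((1 - p) * (v x + d) ^ (-p))) • g x + (v x + d) ^ (1 - p) • gradient w x⟫)
        volume := by
    intro v g hv hg
    have h1 : ∀ t : ℝ, AEStronglyMeasurable (fun x => (v x + d) ^ t) volume := fun t =>
      ((hv.aemeasurable.add_const d).pow_const t).aestronglyMeasurable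
    exact h𝒜m.inner (((hw.continuous.aestronglyMeasurable.mul
      ((h1 (-p)).const_mul (1 - p))).smul hg).add
      ((h1 (1 - p)).smul (continuous_gradient hw).aestronglyMeasurable))
  have hgrad : ∀ k x, ⟪S.A x (G x), gradient (fun x => w x * (V k x + d) ^ (1 - p)) x⟫ =
      ⟪𝒜 x, (w x * ((1 - p) * (V k x + d) ^ (-p))) • gradient (V k) x +
        (V k x + d) ^ (1 - p) • gradient w x⟫ := by
    intro k x
    by_cases hx : x ∈ closedBall x₀ ρ₁
    · rw [h𝒜, indicator_of_mem hx, hHG x hx, gradient_mul_rpow (hwT.differentiableAt x)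
        ((hV.contDiff k).differentiable (by simp) x) (hV.nonneg k x) hd]
    · have h1 := testFun_mul_rpow hw hwz subset_rfl (hV.contDiff k) (hV.nonneg k) hd (1 - p)
      rw [h𝒜, indicator_of_notMem hx, inner_zero_left,
        gradient_eq_zero_of_notMem_tsupport fun h => hx (h1.2.2 h), inner_zero_right]
  have hb₀ := hbm H hV.memLp_grad_limit
  have hbd : ∀ (v : En n → ℝ) (g : En n → En n), (∀ x, 0 ≤ v x) → ∀ x,
      |⟪𝒜 x, (w x * ((1 - p) * (v x + d) ^ (-p))) • g x + (v x + d) ^ (1 - p) • gradient w x⟫| ≤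
      ‖𝒜 x‖ * ((p - 1) * d ^ (-p) * ‖g x‖ + d ^ (1 - p) * ‖gradient w x‖) + 0 := by
    intro v g hv x
    rw [add_zero]
    exact abs_inner_test_le hp hd (hw0 x) (hw1 x) (hv x)
  refine ⟨?_, ?_⟩
  · have : ENNReal.HolderConjugate (ENNReal.ofReal (p / (p - 1))) (ENNReal.ofReal p) :=
      hconj.ennrealOfReal
    exact (ha.integrable_mul hb₀).mono' (hfm U H hV.memLp_limit.1 hV.memLp_grad_limit.1)
      (Eventually.of_forall fun x => (hbd U H hU0 x).trans_eq (add_zero _))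
  simp only [hgrad]
  refine (tendsto_integral_of_holder_dominated hconj (e := fun _ => 0)
    (fun k => hfm _ _ (hV.contDiff k).continuous.aestronglyMeasurable (hV.memLp_gradient k).1)
    ha (fun k => hbm _ (hV.memLp_gradient k)) hb₀ (integrable_zero _ _ _)
    (fun k => Eventually.of_forall (hbd _ _ (hV.nonneg k))) ?_ ?_ ?_).2
  · have h0 : Tendsto (fun k => ENNReal.ofReal ((p - 1) * d ^ (-p)) *
        eLpNorm (fun x => gradient (V k) x - H x) (ENNReal.ofReal p) volume) atTop (𝓝 0) := by
      simpa using ENNReal.Tendsto.const_mul hV.tendsto_eLpNorm_gradient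
        (Or.inr ENNReal.ofReal_ne_top)
    refine tendsto_of_tendsto_of_tendsto_of_le_of_le tendsto_const_nhds h0
      (fun _ => zero_le) fun k => ?_
    have h3 : 0 ≤ p - 1 := by linarith
    refine eLpNorm_le_mul_eLpNorm_of_ae_le_mul (Eventually.of_forall fun x => ?_) _
    rw [add_sub_add_right_eq_sub, ← mul_sub, norm_mul, Real.norm_of_nonneg (by positivity)]
    gcongr
    exact abs_norm_sub_norm_le _ _
  · filter_upwards [hV.ae_tendsto_gradient] with x hx
    exact (hx.norm.const_mul _).add_const _
  · filter_upwards [hV.ae_tendsto, hV.ae_tendsto_gradient] with x hx hx'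
    have hne : U x + d ≠ 0 := by linarith [hU0 x]
    have h1 : ∀ t : ℝ, Tendsto (fun k => (V k x + d) ^ t) atTop (𝓝 ((U x + d) ^ t)) := fun t =>
      (hx.add_const d).rpow_const (Or.inl hne)
    exact tendsto_const_nhds.inner ((((h1 (-p)).const_mul (1 - p)).const_mul (w x)).smul hx' |>.add
      ((h1 (1 - p)).smul_const _))

end LocalTerm

section Threshold

open Filter

variable {n : ℕ} {p s q d r R : ℝ} {u f : En n → ℝ} {x₀ : En n}

theorem normLp_nonneg (m : ℝ) (f : En n → ℝ) (B : Set (En n)) : 0 ≤ normLp m f B :=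
  rpow_nonneg (integral_nonneg fun _ => by positivity) _

theorem tail_base_nonneg (u : En n → ℝ) (x₀ : En n) (hR : 0 ≤ R) :
    0 ≤ R ^ p * ∫ y in (ball x₀ R)ᶜ, |u y| ^ (p - 1) * ‖y - x₀‖ ^ (-((n : ℝ) + p * s)) :=
  mul_nonneg (rpow_nonneg hR _) (integral_nonneg fun _ => by positivity)

theorem tail_nonneg (u : En n → ℝ) (x₀ : En n) (hR : 0 ≤ R) : 0 ≤ Tail n p s u x₀ R :=
  rpow_nonneg (tail_base_nonneg u x₀ hR) _

theorem dBound_nonneg (u f : En n → ℝ) (x₀ : En n) (hr : 0 < r) (hR : 0 < R) :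
    0 ≤ dBound n p s q u f x₀ r R := by
  have h1 := tail_nonneg (p := p) (s := s) (nneg u) x₀ hR.le
  have h2 := normLp_nonneg (q / p) f (ball x₀ R)
  unfold dBound
  positivity

theorem rpow_one_sub_mul_le_of_mul_rpow_le {a T : ℝ} (hp : 1 < p) (hd : 0 < d) (ha : 0 < a)
    (hT : 0 ≤ T) (h : a * T ^ (1 / (p - 1)) ≤ d) : d ^ (1 - p) * T ≤ a ^ (1 - p) := by
  have hp1 : 0 < p - 1 := by linarith
  have h1 : (a * T ^ (1 / (p - 1))) ^ (p - 1) ≤ d ^ (p - 1) :=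
    rpow_le_rpow (by positivity) h hp1.le
  rw [mul_rpow ha.le (by positivity), ← rpow_mul hT, one_div_mul_cancel hp1.ne', rpow_one] at h1
  rw [show 1 - p = -(p - 1) by ring, rpow_neg hd.le, rpow_neg ha.le, inv_mul_le_iff₀ (by positivity),
    ← div_eq_mul_inv, le_div_iff₀ (by positivity), mul_comm]
  exact h1

theorem rpow_one_sub_mul_tail_le (hp : 1 < p) (hr : 0 < r) (hR : 0 < R)
    (hd : dBound n p s q u f x₀ r R < d) :
    d ^ (1 - p) * ∫ y in (ball x₀ R)ᶜ, nneg u y ^ (p - 1) * ‖y - x₀‖ ^ (-((n : ℝ) + p * s)) ≤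
      r ^ (-p) := by
  have hd0 := (dBound_nonneg u f x₀ hr hR).trans_lt hd
  have hp1 : p - 1 ≠ 0 := by linarith
  have h2 := normLp_nonneg (q / p) f (ball x₀ R)
  have h3 : r ^ (p / (p - 1)) * R ^ (-(p / (p - 1))) * Tail n p s (nneg u) x₀ R ≤ d := by
    refine le_trans ?_ hd.le
    unfold dBound
    exact le_add_of_nonneg_right (by positivity)
  have h4 := rpow_one_sub_mul_le_of_mul_rpow_le hp hd0 (by positivity)
    (tail_base_nonneg (nneg u) x₀ hR.le) h3
  have h5 : ∀ y, |nneg u y| = nneg u y := fun y => abs_of_nonneg (le_max_right _ _)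
  simp only [h5] at h4
  have e1 : p / (p - 1) * (1 - p) = -p := by field_simp; ring
  have e2 : -(p / (p - 1)) * (1 - p) = p := by field_simp; ring
  rw [mul_rpow (by positivity) (by positivity), ← rpow_mul hr.le, ← rpow_mul hR.le, e1, e2,
    mul_left_comm, mul_comm (r ^ (-p))] at h4
  exact le_of_mul_le_mul_left h4 (by positivity)

theorem integrableOn_abs_of_rpow {m : ℝ} (hm : 1 < m) {B : Set (En n)} (hB : volume B ≠ ∞)
    (hf : IntegrableOn (fun x => |f x| ^ m) B) :
    IntegrableOn (fun x => |f x|) B ∧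
      ∫ x in B, |f x| ≤ normLp m f B * volume.real B ^ (1 - 1 / m) := by
  have hm0 : 0 < m := by linarith
  have : IsFiniteMeasure (volume.restrict B) := isFiniteMeasure_restrict.2 hB
  have hmeas : AEStronglyMeasurable (fun x => |f x|) (volume.restrict B) :=
    aestronglyMeasurable_of_rpow_abs hm0 (by simpa using hf.1)
      (Eventually.of_forall fun x => abs_nonneg _)
  have hLp : MemLp (fun x => |f x|) (ENNReal.ofReal m) (volume.restrict B) :=
    memLp_of_integrable_norm_rpow hm0 hmeas (by simpa [IntegrableOn] using hf)
  refine ⟨hLp.integrable (by simpa using ENNReal.ofReal_le_ofReal hm.le), ?_⟩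
  have hH := integral_mul_le_Lp_mul_Lq_of_nonneg (HolderConjugate.conjExponent hm)
    (μ := volume.restrict B) (g := fun _ => (1 : ℝ))
    (Eventually.of_forall fun x => abs_nonneg (f x)) (Eventually.of_forall fun _ => zero_le_one)
    hLp (memLp_const _)
  simp only [mul_one, one_rpow, integral_const, smul_eq_mul, measureReal_restrict_apply_univ] at hH
  refine hH.trans_eq ?_
  rw [normLp]
  congr 2
  unfold conjExponent
  field_simp

theorem abs_integral_mul_le (hp : 1 < p) (hq : p < q) (hr : 0 < r) (hR : 0 < R)
    (hd : dBound n p s q u f x₀ r R < d)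
    (hf : IntegrableOn (fun x => |f x| ^ (q / p)) (ball x₀ R)) {φ : En n → ℝ}
    (hφ0 : ∀ x, 0 ≤ φ x) (hφ : ∀ x, φ x ≤ d ^ (1 - p)) (hφz : ∀ x ∉ ball x₀ R, φ x = 0) :
    |∫ x, f x * φ x| ≤
      volume.real (ball (0 : En n) 1) ^ (1 - 1 / (q / p)) * r ^ ((n : ℝ) - p) := by
  have hd0 := (dBound_nonneg u f x₀ hr hR).trans_lt hd
  have hp0 : 0 < p := by linarith
  have hq0 : 0 < q := by linarith
  have hp1 : p - 1 ≠ 0 := by linarith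
  have hT := normLp_nonneg (q / p) f (ball x₀ R)
  obtain ⟨hi, hle⟩ := integrableOn_abs_of_rpow ((one_lt_div hp0).2 hq) measure_ball_lt_top.ne hf
  set b := volume.real (ball (0 : En n) 1)
  have hI : |∫ x, f x * φ x| ≤ d ^ (1 - p) * ∫ x in ball x₀ R, |f x| := by
    rw [← integral_const_mul, ← integral_indicator measurableSet_ball]
    refine (norm_integral_le_integral_norm _).trans (integral_mono_of_nonneg
      (f := fun x => ‖f x * φ x‖) (Eventually.of_forall fun x => norm_nonneg (f x * φ x))
      ((integrable_indicator_iff measurableSet_ball).2 (hi.const_mul _))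
      (Eventually.of_forall fun x => ?_))
    simp only [norm_mul, Real.norm_eq_abs]
    by_cases hx : x ∈ ball x₀ R
    · rw [indicator_of_mem hx, abs_of_nonneg (hφ0 x), mul_comm]
      gcongr
      exact hφ x
    · simp [indicator_of_notMem hx, hφz x hx]
  have h2 : r ^ ((p - n) / (p - 1)) * R ^ (n * (q - p) / (q * (p - 1))) *
      (normLp (q / p) f (ball x₀ R)) ^ (1 / (p - 1)) ≤ d := by
    refine le_trans ?_ hd.le
    have h1 := tail_nonneg (p := p) (s := s) (nneg u) x₀ hR.le
    unfold dBound
    exact le_add_of_nonneg_left (by positivity)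
  have h4 := rpow_one_sub_mul_le_of_mul_rpow_le hp hd0 (by positivity) hT h2
  have e1 : (p - n) / (p - 1) * (1 - p) = n - p := by field_simp; ring
  have e2 : n * (q - p) / (q * (p - 1)) * (1 - p) = -((n : ℝ) * (1 - 1 / (q / p))) := by
    field_simp; ring
  rw [mul_rpow (by positivity) (by positivity), ← rpow_mul hr.le, ← rpow_mul hR.le, e1, e2] at h4
  have hvol : volume.real (ball x₀ R) ^ (1 - 1 / (q / p)) =
      R ^ ((n : ℝ) * (1 - 1 / (q / p))) * b ^ (1 - 1 / (q / p)) := by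
    rw [volume_real_ball_eq x₀ hR, mul_rpow (by positivity) measureReal_nonneg, rpow_mul hR.le,
      rpow_natCast]
  have hb : 0 ≤ b ^ (1 - 1 / (q / p)) := rpow_nonneg measureReal_nonneg _
  set κ := (n : ℝ) * (1 - 1 / (q / p))
  calc |∫ x, f x * φ x| ≤ d ^ (1 - p) * (normLp (q / p) f (ball x₀ R) *
        (R ^ κ * b ^ (1 - 1 / (q / p)))) := by
        rw [← hvol]
        exact hI.trans (mul_le_mul_of_nonneg_left hle (by positivity))
    _ = (d ^ (1 - p) * normLp (q / p) f (ball x₀ R)) * (R ^ κ * b ^ (1 - 1 / (q / p))) := by ring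
    _ ≤ (r ^ ((n : ℝ) - p) * R ^ (-κ)) * (R ^ κ * b ^ (1 - 1 / (q / p))) := by gcongr
    _ = b ^ (1 - 1 / (q / p)) * r ^ ((n : ℝ) - p) * (R ^ (-κ) * R ^ κ) := by ring
    _ = _ := by rw [← rpow_add hR, neg_add_cancel, rpow_zero, mul_one]

end Threshold

section LocalBound

open Filter

variable {n : ℕ} {p s C₁ C₂ Λ d ρ r c : ℝ} {U ω : En n → ℝ} {H : En n → En n} {x₀ : En n}

/-- Pointwise bound for the limit of the local term, absorbing the energy density. -/
theorem Setting.ae_inner_test_le (S : Setting n p s C₁ C₂ Λ) (hp : 1 < p)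
    (hU0 : ∀ x, 0 ≤ U x) (hd : 0 < d) (hc : 0 ≤ c) (hr : 0 < r)
    (hρΩ : closedBall x₀ ρ ⊆ S.Ω) (hω0 : ∀ x, 0 ≤ ω x)
    (hωz : ∀ x ∉ ball x₀ ρ, ω x = 0)
    (hωg : ∀ x, ‖gradient (fun x => ω x ^ p) x‖ ≤ c / r * ω x ^ (p - 1)) :
    ∀ᵐ x, ⟪(closedBall x₀ ρ).indicator (fun x => S.A x (H x)) x,
        (ω x ^ p * ((1 - p) * (U x + d) ^ (-p))) • H x +
          (U x + d) ^ (1 - p) • gradient (fun x => ω x ^ p) x⟫ ≤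
      (closedBall x₀ ρ).indicator
        (fun _ => C₂ * ((p - 1) * C₁ / (2 * C₂)) ^ (1 - p) * (c / r) ^ p) x -
        (p - 1) * C₁ / 2 * (ω x * ‖H x‖ / (U x + d)) ^ p := by
  have hC₁ := S.hC₁
  have hC₂ := S.hC₂
  have hp0 : p ≠ 0 := by linarith
  have hp1 : 0 < p - 1 := by linarith
  filter_upwards [S.hAgrowth, S.hAcoerc] with x hg hco
  by_cases hx : x ∈ closedBall x₀ ρ
  · rw [indicator_of_mem hx, indicator_of_mem hx, inner_add_right, inner_smul_right,
      inner_smul_right]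
    specialize hg (hρΩ hx) (H x)
    specialize hco (hρΩ hx) (H x)
    have hv : 0 < U x + d := by linarith [hU0 x]
    have hω := hω0 x
    set X := ω x * ‖H x‖ / (U x + d) with hX
    have hX0 : 0 ≤ X := by positivity
    have hXp : X ^ p = ω x ^ p * (U x + d) ^ (-p) * ‖H x‖ ^ p := by
      rw [hX, div_rpow (by positivity) hv.le, mul_rpow hω (norm_nonneg _), rpow_neg hv.le]
      ring
    have hXp1 : X ^ (p - 1) = ω x ^ (p - 1) * (U x + d) ^ (1 - p) * ‖H x‖ ^ (p - 1) := by
      rw [hX, div_rpow (by positivity) hv.le, mul_rpow hω (norm_nonneg _),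
        show 1 - p = -(p - 1) by ring, rpow_neg hv.le]
      ring
    have h1 : ω x ^ p * ((1 - p) * (U x + d) ^ (-p)) * ⟪S.A x (H x), H x⟫ ≤
        -((p - 1) * C₁ * X ^ p) := by
      have : ω x ^ p * (U x + d) ^ (-p) * (C₁ * ‖H x‖ ^ p) ≤
          ω x ^ p * (U x + d) ^ (-p) * ⟪S.A x (H x), H x⟫ := by gcongr
      rw [hXp]
      nlinarith
    have h2 : (U x + d) ^ (1 - p) * ⟪S.A x (H x), gradient (fun x => ω x ^ p) x⟫ ≤
        C₂ * (X ^ (p - 1) * (c / r)) := by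
      calc _ ≤ (U x + d) ^ (1 - p) * ((C₂ * ‖H x‖ ^ (p - 1)) * (c / r * ω x ^ (p - 1))) := by
            gcongr
            exact (real_inner_le_norm _ _).trans
              (mul_le_mul hg (hωg x) (norm_nonneg _) (by positivity))
        _ = _ := by rw [hXp1]; ring
    have hε : 0 < (p - 1) * C₁ / (2 * C₂) := by positivity
    have h3 := rpow_sub_one_mul_le hp hε hX0 (div_nonneg hc hr.le)
    have h4 : C₂ * (X ^ (p - 1) * (c / r)) ≤ (p - 1) * C₁ / 2 * X ^ p +
        C₂ * ((p - 1) * C₁ / (2 * C₂)) ^ (1 - p) * (c / r) ^ p := by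
      refine (mul_le_mul_of_nonneg_left h3 hC₂.le).trans_eq ?_
      rw [mul_add, ← mul_assoc C₂, ← mul_assoc C₂]
      congr 2
      field_simp
    linarith
  · rw [indicator_of_notMem hx, indicator_of_notMem hx, inner_zero_left,
      hωz x fun h => hx (ball_subset_closedBall h)]
    simp [hp0]

end LocalBound

section Energy

open Filter

variable {n : ℕ} {p s C₁ C₂ Λ d r R c : ℝ} {u U ω : En n → ℝ} {G H : En n → En n}
  {V : ℕ → En n → ℝ} {x₀ : En n}

/-- The nonlocal energies along smooth approximations converge to a controlled limit. -/
theorem exists_tendsto_nonlocal_le (S : Setting n p s C₁ C₂ Λ) (hn : 0 < n) (hp : 1 < p)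
    (hs0 : 0 < s) (hs1 : s < 1) (hu : MemTailSpace p s u) (hV : IsSmoothApprox p V U H)
    (hU0 : ∀ x, 0 ≤ U x) (hd : 0 < d) (hr : 0 < r) (hr1 : r ≤ 1)
    (hrR : r < R / 2) (hu0 : ∀ x ∈ ball x₀ R, 0 ≤ u x)
    (hUu : ∀ x ∈ ball x₀ (15 / 8 * r), U x = u x) (hc : 0 ≤ c)
    (hω : ContDiff ℝ (⊤ : ℕ∞) fun x => ω x ^ p) (hω0 : ∀ x, 0 ≤ ω x) (hω1 : ∀ x, ω x ≤ 1)
    (hωz : ∀ x ∉ ball x₀ (7 / 4 * r), ω x = 0)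
    (hLip : ∀ x y, |ω x - ω y| ≤ c / r * ‖x - y‖)
    (htail : d ^ (1 - p) * ∫ y in (ball x₀ R)ᶜ,
      nneg u y ^ (p - 1) * ‖y - x₀‖ ^ (-((n : ℝ) + p * s)) ≤ r ^ (-p)) :
    ∃ N, N ≤ Λ * (2 ^ p * (2 * ((7 / 4) ^ n * volume.real (ball (0 : En n) 1)) *
        ((∫ h : En n, truncKer n p s c h) + 8 ^ ((n : ℝ) + p * s)))) * r ^ ((n : ℝ) - p) ∧
      Tendsto (fun k => ∫ x, ∫ y, Jp p (u x - u y) *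
        (ω x ^ p * (V k x + d) ^ (1 - p) - ω y ^ p * (V k y + d) ^ (1 - p)) * S.K x y)
        atTop (𝓝 N) := by
  have hp0 : 0 < p := by linarith
  have hwz : ∀ x ∉ ball x₀ (7 / 4 * r), ω x ^ p = 0 := fun x hx => by
    rw [hωz x hx, zero_rpow hp0.ne']
  by_cases hum : AEMeasurable u
  · have hωc : Continuous ω := (LipschitzWith.of_dist_le' (K := c / r) fun x y => by
      rw [Real.dist_eq, dist_eq_norm]
      exact hLip x y).continuous
    have hcs : HasCompactSupport fun x => ω x ^ p :=
      HasCompactSupport.intro (isCompact_closedBall x₀ (7 / 4 * r)) fun x hx =>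
        hwz x fun h => hx (ball_subset_closedBall h)
    obtain ⟨L, hL⟩ := hω.lipschitzWith_of_hasCompactSupport hcs (by simp)
    obtain ⟨h1, h2⟩ := tendsto_integral_nonlocal S hn hp hs0 hs1 hu hum hV hU0 hd
      (x₀ := x₀) (by positivity) (by linarith : 7 / 4 * r < 15 / 8 * r) hUu hω.continuous
      (fun x => rpow_nonneg (hω0 x) p) (fun x => rpow_le_one (hω0 x) (hω1 x) hp0.le) hwz
      L.2 fun x y => by
        have := hL.dist_le_mul x y
        rwa [Real.dist_eq, dist_eq_norm] at this
    refine ⟨_, integral_nonlocal_le S hn hp hs0 hs1 hu hum hd hr hr1 hrR hu0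
      (fun x hx => hUu x (ball_subset_ball (by linarith) hx)) hc hωc hω0 hω1 hωz hLip htail,
      h2.congr fun k => ?_⟩
    exact integral_prod _ (h1 k)
  · have hΛ : 0 < Λ := zero_lt_one.trans_le S.hΛ
    have hI : 0 ≤ ∫ h : En n, truncKer n p s c h := integral_nonneg fun h => truncKer_nonneg hc h
    refine ⟨0, by positivity, tendsto_const_nhds.congr fun k => ?_⟩
    refine (integral_nonlocal_eq_zero_of_not_aemeasurable S hp hs0 hu measurableSet_ball hu0 hum
      (testFun_mul_rpow hω hwz ?_ (hV.contDiff k) (hV.nonneg k) hd (1 - p)) fun x => ?_).symm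
    · exact closedBall_subset_ball (by linarith)
    · have := hω0 x
      have := hV.nonneg k x
      positivity

/-- Caccioppoli-type logarithmic energy estimate for supersolutions. -/
theorem exists_log_energy_le (n : ℕ) {q : ℝ} (hs0 : 0 < s) (hs1 : s < 1) (hp : 1 < p)
    (hpn : p < n) (hq : (n : ℝ) < q) (hC₁ : 0 < C₁) (hC₂ : 0 < C₂) (hΛ : 0 < Λ) :
    ∃ E, 0 < E ∧ ∀ (S : Setting n p s C₁ C₂ Λ) (u f U : En n → ℝ) (G H : En n → En n)
      (V : ℕ → En n → ℝ) (x₀ : En n) (r R d : ℝ), 0 < r → r ≤ 1 → r < R / 2 →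
      ball x₀ R ⊆ S.Ω → IntegrableOn (fun x => |f x| ^ (q / p)) (ball x₀ R) →
      IsSupersol S f u G → (∀ x ∈ ball x₀ R, 0 ≤ u x) → dBound n p s q u f x₀ r R < d →
      IsSmoothApprox p V U H → (∀ x, 0 ≤ U x) → (∀ x ∈ ball x₀ (15 / 8 * r), U x = u x) →
      (∀ x ∈ ball x₀ (15 / 8 * r), H x = G x) →
      ∫⁻ x in ball x₀ (3 * r / 2), ‖(U x + d)⁻¹ • H x‖ₑ ^ p ≤
        ENNReal.ofReal (E * r ^ ((n : ℝ) - p)) := by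
  have hp0 : 0 < p := by linarith
  have hp1 : 0 < p - 1 := by linarith
  have hn : 0 < n := by exact_mod_cast hp0.trans hpn
  obtain ⟨c, hc, hcut⟩ := exists_rpow_cutoff n hp (a := 3 / 2) (b := 7 / 4) (by norm_num)
    (by norm_num)
  set b := volume.real (ball (0 : En n) 1) with hb
  have hb0 : 0 < b := volume_real_unit_ball_pos n
  set N₀ := Λ * (2 ^ p * (2 * ((7 / 4) ^ n * b) *
    ((∫ h : En n, truncKer n p s c h) + 8 ^ ((n : ℝ) + p * s)))) with hN₀
  have hI : 0 ≤ ∫ h : En n, truncKer n p s c h := integral_nonneg fun h => truncKer_nonneg hc.le h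
  set F₀ := b ^ (1 - 1 / (q / p))
  set ε := (p - 1) * C₁ / (2 * C₂) with hε
  set L₀ := C₂ * ε ^ (1 - p) * c ^ p * ((7 / 4) ^ n * b) with hL₀
  refine ⟨(L₀ + N₀ + F₀) / ((p - 1) * C₁ / 2), by positivity, ?_⟩
  intro S u f U G H V x₀ r R d hr hr1 hrR hBΩ hf hsup hu0 hdB hV hU0 hUu hHG
  have hR : 0 < R := by linarith
  have hd : 0 < d := (dBound_nonneg u f x₀ hr hR).trans_lt hdB
  obtain ⟨ω, hω, hω01, hω1', hωz, hLip, hωg⟩ := hcut x₀ r hr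
  have hω0 := fun x => (hω01 x).1
  have hω1 := fun x => (hω01 x).2
  have hwz : ∀ x ∉ ball x₀ (7 / 4 * r), ω x ^ p = 0 := fun x hx => by
    rw [hωz x hx, zero_rpow hp0.ne']
  have hcR : closedBall x₀ (7 / 4 * r) ⊆ ball x₀ R := closedBall_subset_ball (by linarith)
  have hw0 := fun x => rpow_nonneg (hω0 x) p
  have hw1 := fun x => rpow_le_one (hω0 x) (hω1 x) hp0.le
  obtain ⟨N, hN, hNt⟩ := exists_tendsto_nonlocal_le S hn hp hs0 hs1 hsup.2.1 hV hU0 hd hr hr1 hrR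
    hu0 hUu hc.le hω hω0 hω1 hωz hLip (rpow_one_sub_mul_tail_le hp hr hR hdB)
  obtain ⟨hLi, hLt⟩ := tendsto_integral_local S hp hV hU0 hd (hcR.trans hBΩ)
    (fun x hx => hHG x (closedBall_subset_ball (by linarith) hx)) hω hw0 hw1 hwz
  have hlow : ∀ k, -(F₀ * r ^ ((n : ℝ) - p)) ≤
      (∫ x, ⟪S.A x (G x), gradient (fun x => ω x ^ p * (V k x + d) ^ (1 - p)) x⟫) +
      ∫ x, ∫ y, Jp p (u x - u y) *
        (ω x ^ p * (V k x + d) ^ (1 - p) - ω y ^ p * (V k y + d) ^ (1 - p)) * S.K x y := by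
    intro k
    have hφ0 : ∀ x, 0 ≤ ω x ^ p * (V k x + d) ^ (1 - p) := fun x =>
      mul_nonneg (hw0 x) (rpow_nonneg (by linarith [hV.nonneg k x]) _)
    have h1 := hsup.2.2 _ (testFun_mul_rpow hω hwz (hcR.trans hBΩ) (hV.contDiff k)
      (hV.nonneg k) hd (1 - p)) hφ0
    have h2 := abs_integral_mul_le hp (hpn.trans hq) hr hR hdB hf hφ0 (fun x => by
      have h3 : (V k x + d) ^ (1 - p) ≤ d ^ (1 - p) :=
        rpow_le_rpow_of_nonpos hd (by linarith [hV.nonneg k x]) (by linarith)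
      have := hV.nonneg k x
      simpa using mul_le_mul (hw1 x) h3 (by positivity) zero_le_one)
      fun x hx => by
        rw [hwz x fun h => hx (hcR (ball_subset_closedBall h)), zero_mul]
    exact (neg_le_of_abs_le h2).trans h1
  have hlim := ge_of_tendsto' (hLt.add hNt) hlow
  have hXm : AEMeasurable (fun x => (ω x * ‖H x‖ / (U x + d)) ^ p) := by
    have hωc : Continuous ω := (LipschitzWith.of_dist_le' (K := c / r) fun x y => by
      rw [Real.dist_eq, dist_eq_norm]
      exact hLip x y).continuous
    exact (((hωc.aemeasurable.mul hV.memLp_grad_limit.1.norm.aemeasurable).div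
      (hV.memLp_limit.1.aemeasurable.add_const d)).pow_const p)
  have hX0 : ∀ x, 0 ≤ ω x * ‖H x‖ / (U x + d) := fun x =>
    div_nonneg (mul_nonneg (hω0 x) (norm_nonneg _)) (by linarith [hU0 x])
  have hXi : Integrable fun x => (ω x * ‖H x‖ / (U x + d)) ^ p := by
    have h1 := (hV.memLp_grad_limit.integrable_norm_rpow (by simpa using hp0)
      ENNReal.ofReal_ne_top).const_mul (d⁻¹ ^ p)
    rw [ENNReal.toReal_ofReal hp0.le] at h1
    refine h1.mono' hXm.aestronglyMeasurable (Eventually.of_forall fun x => ?_)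
    rw [Real.norm_of_nonneg (rpow_nonneg (hX0 x) p), ← mul_rpow (by positivity) (norm_nonneg _)]
    refine rpow_le_rpow (hX0 x) ?_ hp0.le
    have h2 := hU0 x
    have h3 := hω0 x
    rw [inv_mul_eq_div]
    gcongr
    · exact mul_le_of_le_one_left (norm_nonneg _) (hω1 x)
    · linarith
  have hιi : Integrable ((closedBall x₀ (7 / 4 * r)).indicator
      fun _ => C₂ * ε ^ (1 - p) * (c / r) ^ p) :=
    (integrable_indicator_iff measurableSet_closedBall).2
      (integrableOn_const (isCompact_closedBall _ _).measure_lt_top.ne)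
  have hmono := integral_mono_ae hLi (hιi.sub (hXi.const_mul ((p - 1) * C₁ / 2)))
    (S.ae_inner_test_le hp hU0 hd hc.le hr (hcR.trans hBΩ) hω0 hωz hωg)
  have hιI : ∫ x, (closedBall x₀ (7 / 4 * r)).indicator
      (fun _ => C₂ * ε ^ (1 - p) * (c / r) ^ p) x = L₀ * r ^ ((n : ℝ) - p) := by
    have : Nonempty (Fin n) := ⟨⟨0, hn⟩⟩
    rw [integral_indicator measurableSet_closedBall, setIntegral_const, smul_eq_mul,
      Measure.real, Measure.addHaar_closedBall_eq_addHaar_ball, ← Measure.real,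
      volume_real_ball_eq x₀ (by positivity), mul_pow, div_rpow hc.le hr.le, rpow_sub hr,
      rpow_natCast, hL₀]
    ring
  simp only [Pi.sub_apply] at hmono
  rw [integral_sub hιi (hXi.const_mul _), integral_const_mul, hιI] at hmono
  have hfin : ∫ x, (ω x * ‖H x‖ / (U x + d)) ^ p ≤
      (L₀ + N₀ + F₀) / ((p - 1) * C₁ / 2) * r ^ ((n : ℝ) - p) := by
    rw [div_mul_eq_mul_div, le_div_iff₀ (by positivity)]
    linarith
  refine le_trans ?_ (ENNReal.ofReal_le_ofReal hfin)
  rw [ofReal_integral_eq_lintegral_ofReal hXi (Eventually.of_forall fun x => rpow_nonneg (hX0 x) p)]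
  refine le_trans (setLIntegral_mono' measurableSet_ball fun x hx => ?_) (setLIntegral_le_lintegral _ _)
  have hx1 : ω x = 1 := hω1' x (ball_subset_closedBall (by convert hx using 2; ring))
  rw [hx1, one_mul, ← ENNReal.ofReal_rpow_of_nonneg (by have := hX0 x; rwa [hx1, one_mul] at this)
    hp0.le, ← ofReal_norm, norm_smul, norm_inv, Real.norm_of_nonneg (by linarith [hU0 x]),
    inv_mul_eq_div]

end Energy

section Localization

open Filter

/-- Near the ball, a supersolution agrees with a global nonnegative Sobolev function that satisfies
the logarithmic energy estimate. -/
theorem exists_extension_log_energy_le (n : ℕ) {p s q C₁ C₂ Λ : ℝ} (hs0 : 0 < s) (hs1 : s < 1)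
    (hp : 1 < p) (hpn : p < n) (hq : (n : ℝ) < q) (hC₁ : 0 < C₁) (hC₂ : 0 < C₂) (hΛ : 0 < Λ) :
    ∃ E, 0 < E ∧ ∀ (S : Setting n p s C₁ C₂ Λ) (u f : En n → ℝ) (G : En n → En n)
      (x₀ : En n) (r R d : ℝ), 0 < r → r ≤ 1 → r < R / 2 →
      ball x₀ R ⊆ S.Ω → IntegrableOn (fun x => |f x| ^ (q / p)) (ball x₀ R) →
      IsSupersol S f u G → (∀ x ∈ ball x₀ R, 0 ≤ u x) → dBound n p s q u f x₀ r R < d →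
      ∃ (U : En n → ℝ) (H : En n → En n), MemLp U (ENNReal.ofReal p) volume ∧
        MemLp H (ENNReal.ofReal p) volume ∧ HasWeakGradOn U H univ ∧ (∀ x, 0 ≤ U x) ∧
        (∀ x ∈ ball x₀ (3 * r / 2), U x = u x) ∧
        ∫⁻ x in ball x₀ (3 * r / 2), ‖(U x + d)⁻¹ • H x‖ₑ ^ p ≤
          ENNReal.ofReal (E * r ^ ((n : ℝ) - p)) := by
  have hp0 : 0 < p := by linarith
  obtain ⟨E, hE, hen⟩ := exists_log_energy_le n hs0 hs1 hp hpn hq hC₁ hC₂ hΛ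
  obtain ⟨_, -, hcut⟩ := exists_smooth_cutoff n (a := 15 / 8) (b := 31 / 16) (by norm_num)
    (by norm_num)
  refine ⟨E, hE, fun S u f G x₀ r R d hr hr1 hrR hBΩ hf hsup hu0 hd => ?_⟩
  obtain ⟨χ, hχs, hχ01, hχ1, hχz, -, -⟩ := hcut x₀ r hr
  have hχ1' : ∀ x ∈ ball x₀ (15 / 8 * r), χ x = 1 := fun x hx => hχ1 x (ball_subset_closedBall hx)
  have hχ : TestFun (ball x₀ R) χ := by
    simpa using testFun_mul_rpow hχs hχz
      (closedBall_subset_ball (by linarith) : closedBall x₀ (31 / 16 * r) ⊆ ball x₀ R)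
      (contDiff_const (c := (0 : ℝ))) (fun _ => le_rfl) one_pos 0
  have hχg : ∀ x ∈ ball x₀ (15 / 8 * r), gradient χ x = 0 := fun x hx => by
    have h : χ =ᶠ[𝓝 x] fun _ => 1 := by
      filter_upwards [isOpen_ball.mem_nhds hx] with y hy using hχ1' y hy
    rw [← norm_eq_zero, norm_gradient_eq, h.fderiv_eq]
    simp
  have hW : MemW1pLoc p u G (ball x₀ R) := hsup.1.mono hBΩ
  have hUm := hW.memLp_mul hp0 hu0 hχ
  have hU0 : ∀ x, 0 ≤ χ x * u x := fun x => by
    by_cases hx : x ∈ ball x₀ R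
    · exact mul_nonneg (hχ01 x).1 (hu0 x hx)
    · rw [hχz x fun h => hx (ball_subset_ball (by linarith) h), zero_mul]
  have hUu : ∀ x ∈ ball x₀ (15 / 8 * r), χ x * u x = u x := fun x hx => by
    rw [hχ1' x hx, one_mul]
  have hsub : ball x₀ (3 * r / 2) ⊆ ball x₀ (15 / 8 * r) := ball_subset_ball (by linarith)
  by_cases hG : AEStronglyMeasurable (fun x => χ x • G x) volume
  · have hHm := (hW.memLp_smul hp0 hχ hG).add (hW.memLp_smul_gradient hp0 hu0 hχ)
    have hwk := hW.hasWeakGradOn_mul hp.le hu0 hχ hG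
    obtain ⟨V, hV⟩ := exists_isSmoothApprox hp.le hUm hHm hwk hU0
    refine ⟨_, _, hUm, hHm, hwk, hU0, fun x hx => hUu x (hsub hx),
      hen S u f _ G _ V x₀ r R d hr hr1 hrR hBΩ hf hsup hu0 hd hV hU0 hUu fun x hx => ?_⟩
    simp [hχ1' x hx, hχg x hx]
  · have hW0 := hW.zero_of_not_aestronglyMeasurable hp.le hu0 hχ hG
    have h0 : AEStronglyMeasurable (fun x => χ x • (0 : En n → En n) x) volume := by
      simpa using aestronglyMeasurable_const
    refine ⟨_, _, hUm, (hW0.memLp_smul hp0 hχ h0).add (hW0.memLp_smul_gradient hp0 hu0 hχ),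
      hW0.hasWeakGradOn_mul hp.le hu0 hχ h0, hU0, fun x hx => hUu x (hsub hx), ?_⟩
    refine (setLIntegral_congr_fun (g := fun _ => 0) measurableSet_ball fun x hx => ?_).trans_le
      (by simp)
    simp [hχg x (hsub hx), hp0]

end Localization

/-- **Level-set estimate for the logarithm of a supersolution** (Lemma 4.3). -/
theorem level_set_estimate_log
    (n : ℕ) (p s q C₁ C₂ Λ c₀ : ℝ)
    (hs0 : 0 < s) (hs1 : s < 1) (hp : 1 < p) (hpn : p < n) (hq : (n : ℝ) < q)
    (hc₀ : 0 < c₀) :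
    ∃ C : ℝ, 0 < C ∧
      ∀ (S : Setting n p s C₁ C₂ Λ) (u f : En n → ℝ) (G : En n → En n)
        (x₀ : En n) (r R d : ℝ) (ψ : En n → ℝ),
        0 < r → r ≤ 1 → r < R / 2 →
        ball x₀ R ⊆ S.Ω →
        IntegrableOn (fun x => |f x| ^ (q / p)) (ball x₀ R) →
        IsSupersol S f u G →
        (∀ x ∈ ball x₀ R, 0 ≤ u x) →
        dBound n p s q u f x₀ r R < d →
        TestFun (ball x₀ (3 * r / 2)) ψ →
        (∀ x, 0 ≤ ψ x ∧ ψ x ≤ 1) →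
        (∀ x ∈ ball x₀ r, ψ x = 1) →
        (∀ x ∈ ball x₀ (3 * r / 2), ‖gradient ψ x‖ ≤ c₀ / r) →
        ∀ a : ℝ, 0 < a →
          volume {x ∈ ball x₀ r |
              a < Real.log (u x + d) -
                (∫ z in ball x₀ (3 * r / 2), ψ z ^ p * Real.log (u z + d)) /
                  (∫ z in ball x₀ (3 * r / 2), ψ z ^ p)} ≤
            ENNReal.ofReal (C * (volume (ball x₀ (r / 2))).toReal / a ^ p) ∧
          volume {x ∈ ball x₀ r |
              a < -Real.log (u x + d) +
                (∫ z in ball x₀ (3 * r / 2), ψ z ^ p * Real.log (u z + d)) /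
                  (∫ z in ball x₀ (3 * r / 2), ψ z ^ p)} ≤
            ENNReal.ofReal (C * (volume (ball x₀ (r / 2))).toReal / a ^ p) := by
  by_cases hpos : 0 < C₁ ∧ 0 < C₂ ∧ 1 ≤ Λ
  swap
  · exact ⟨1, one_pos, fun S => absurd ⟨S.hC₁, S.hC₂, S.hΛ⟩ hpos⟩
  obtain ⟨hC₁, hC₂, hΛ⟩ := hpos
  obtain ⟨E, hE, hext⟩ := exists_extension_log_energy_le n hs0 hs1 hp hpn hq hC₁ hC₂
    (zero_lt_one.trans_le hΛ)
  obtain ⟨C, hC, hlev⟩ := exists_level_set_log_le n hp hE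
  refine ⟨C, hC, ?_⟩
  intro S u f G x₀ r R d ψ hr hr1 hrR hBΩ hf hsup hu0 hd hψ hψ01 hψ1 _ a ha
  have hd0 : 0 < d := (dBound_nonneg u f x₀ hr (by linarith)).trans_lt hd
  obtain ⟨U, H, hU, hH, hw, hU0, hUu, hen⟩ := hext S u f G x₀ r R d hr hr1 hrR hBΩ hf hsup hu0 hd
  have key := hlev U H x₀ r d ψ hU hH hw hU0 hd0 hr hen hψ.1.continuous hψ01 hψ1 a ha
  have hI : ∫ z in ball x₀ (3 * r / 2), ψ z ^ p * Real.log (U z + d) =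
      ∫ z in ball x₀ (3 * r / 2), ψ z ^ p * Real.log (u z + d) :=
    setIntegral_congr_fun measurableSet_ball fun z hz => by simp only [hUu z hz]
  rw [hI] at key
  have hsub : ball x₀ r ⊆ ball x₀ (3 * r / 2) := ball_subset_ball (by linarith)
  refine ⟨(measure_mono ?_).trans key, (measure_mono ?_).trans key⟩
  · rintro x ⟨hx, hax⟩
    refine ⟨hsub hx, ?_⟩
    rw [mem_ofPred_eq, hUu x (hsub hx)]
    exact hax.le.trans (le_abs_self _)
  · rintro x ⟨hx, hax⟩
    refine ⟨hsub hx, ?_⟩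
    rw [mem_ofPred_eq, hUu x (hsub hx), abs_sub_comm]
    exact (hax.trans_eq (neg_add_eq_sub _ _)).le.trans (le_abs_self _)

end
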